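/- Let X be an abelian variety of dimension g over an algebraically closed field F of characteristic zero. Then the endomorphism algebra End⁰(X) = End(X) ⊗ ℚ has ℚ-dimension strictly less than (2g)². -/

import Mathlib

open CategoryTheory CategoryTheory.Limits AlgebraicGeometry
open scoped TensorProduct

/-- An abelian variety over a field `F`: a smooth proper geometrically
connected commutative group object in the category of schemes over `Spec F`. -/
structure AbelianVariety (F : Type) [Field F] where
  /-- the underlying scheme over `Spec F` -/
  X : Over (Spec (CommRingCat.of F))
  /-- the group law -/
  mul : Limits.prod X X ⟶ X
  /-- the unit section -/
  one : ⊤_ (Over (Spec (CommRingCat.of F))) ⟶ X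
  /-- the inverse -/
  inv : X ⟶ X
  mul_assoc : prod.map mul (𝟙 X) ≫ mul =
    (prod.associator X X X).hom ≫ prod.map (𝟙 X) mul ≫ mul
  one_mul : prod.lift (terminal.from X ≫ one) (𝟙 X) ≫ mul = 𝟙 X
  mul_one : prod.lift (𝟙 X) (terminal.from X ≫ one) ≫ mul = 𝟙 X
  mul_inv : prod.lift (𝟙 X) inv ≫ mul = terminal.from X ≫ one
  mul_comm : (prod.braiding X X).hom ≫ mul = mul
  proper : IsProper X.hom
  smooth : IsSmooth X.hom
  connected : ConnectedSpace X.left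
  nonempty : Nonempty X.left


namespace AVProof
open Filter Topology

section Analysis

variable {V W : Type} [NormedAddCommGroup V] [NormedSpace ℂ V]
  [NormedAddCommGroup W] [NormedSpace ℂ W]

lemma quad_est (f : V → W) (hf : ContDiffAt ℂ 2 f 0) (h1 : fderiv ℂ f 0 = 0) :
    ∃ C > 0, ∃ r > 0, ∀ ρ ≤ r, ∀ x y, ‖x‖ ≤ ρ → ‖y‖ ≤ ρ → ‖f x - f y‖ ≤ C * ρ * ‖x - y‖ := by
  have hd : ContDiffAt ℂ 1 (fderiv ℂ f) 0 := hf.fderiv_right (by norm_num)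
  have hd2 : DifferentiableAt ℂ (fderiv ℂ f) 0 := hd.differentiableAt (by norm_num)
  obtain ⟨C, hC, hb⟩ := (hd2.hasFDerivAt.isBigO_sub).exists_pos
  have hb := hb.bound
  have he : ∀ᶠ x in 𝓝 (0 : V), DifferentiableAt ℂ f x := by
    have := hf.eventually (by norm_num)
    filter_upwards [this] with x hx using hx.differentiableAt (by norm_num)
  obtain ⟨r, hr, hball⟩ := Metric.eventually_nhds_iff_ball.1 (hb.and he)
  refine ⟨C, hC, r / 2, by positivity, fun ρ hρ x y hx hy => ?_⟩
  have hsub : ∀ z ∈ Metric.closedBall (0 : V) ρ, z ∈ Metric.ball (0 : V) r := by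
    intro z hz
    rw [mem_closedBall_zero_iff] at hz
    rw [mem_ball_zero_iff]; linarith
  refine (convex_closedBall (0 : V) ρ).norm_image_sub_le_of_norm_fderiv_le (𝕜 := ℂ) (f := f)
    (fun z hz => (hball z (hsub z hz)).2) (fun z hz => ?_) ?_ ?_
  · have := (hball z (hsub z hz)).1
    rw [h1, sub_zero, sub_zero] at this
    rw [mem_closedBall_zero_iff] at hz
    refine this.trans ?_
    gcongr
  · rwa [mem_closedBall_zero_iff]
  · rwa [mem_closedBall_zero_iff]

lemma koenigs [CompleteSpace V] (h : V → V) (C r : ℝ) (hC : 0 < C) (hr : 0 < r) (h0 : h 0 = 0)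
    (hest : ∀ ρ ≤ r, ∀ x y, ‖x‖ ≤ ρ → ‖y‖ ≤ ρ →
      ‖(h x - (1 / 2 : ℂ) • x) - (h y - (1 / 2 : ℂ) • y)‖ ≤ C * ρ * ‖x - y‖) :
    ∃ (L : V → V), ∃ C' > 0, ∃ r' > 0, r' ≤ r ∧
      (∀ ρ ≤ r', ∀ x y, ‖x‖ ≤ ρ → ‖y‖ ≤ ρ → ‖(L x - L y) - (x - y)‖ ≤ C' * ρ * ‖x - y‖) ∧
      (∀ x, ‖x‖ ≤ r' → ∀ k : ℕ, ‖h^[k] x‖ ≤ (2 / 3 : ℝ) ^ k * ‖x‖) ∧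
      (∀ x, ‖x‖ ≤ r' → Tendsto (fun k : ℕ => (2 : ℂ) ^ k • h^[k] x) atTop (𝓝 (L x))) := by
  set r' := min r (1 / (6 * C)) with hr'
  have hr'0 : 0 < r' := by positivity
  have hCr : C * r' ≤ 1 / 6 := by
    have : r' ≤ 1 / (6 * C) := min_le_right _ _
    calc C * r' ≤ C * (1 / (6 * C)) := by gcongr
      _ = 1 / 6 := by field_simp
  have hcontr : ∀ x y, ‖x‖ ≤ r' → ‖y‖ ≤ r' → ‖h x - h y‖ ≤ 2 / 3 * ‖x - y‖ := by
    intro x y hx hy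
    have e := hest r' (min_le_left _ _) x y hx hy
    have : h x - h y = ((h x - (1 / 2 : ℂ) • x) - (h y - (1 / 2 : ℂ) • y)) + (1 / 2 : ℂ) • (x - y) := by
      rw [smul_sub]; abel
    rw [this]
    refine (norm_add_le _ _).trans ?_
    rw [norm_smul]
    have h2 : ‖(1 / 2 : ℂ)‖ = 1 / 2 := by norm_num
    rw [h2]
    have : C * r' * ‖x - y‖ ≤ 1 / 6 * ‖x - y‖ := by gcongr
    linarith
  have hcontr0 : ∀ x, ‖x‖ ≤ r' → ‖h x‖ ≤ 2 / 3 * ‖x‖ := by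
    intro x hx
    simpa [h0] using hcontr x 0 hx (by simpa using hr'0.le)
  have hit : ∀ x, ‖x‖ ≤ r' → ∀ k : ℕ, ‖h^[k] x‖ ≤ (2 / 3 : ℝ) ^ k * ‖x‖ := by
    intro x hx k
    induction k with
    | zero => simp
    | succ k ih =>
      rw [Function.iterate_succ_apply']
      have h1 : ‖h^[k] x‖ ≤ r' := by
        refine ih.trans (le_trans ?_ hx)
        exact mul_le_of_le_one_left (norm_nonneg _) (pow_le_one₀ (by norm_num) (by norm_num))
      refine (hcontr0 _ h1).trans ?_
      rw [pow_succ]; nlinarith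
  have hitr : ∀ x, ‖x‖ ≤ r' → ∀ k : ℕ, ‖h^[k] x‖ ≤ r' := fun x hx k =>
    (hit x hx k).trans (le_trans (mul_le_of_le_one_left (norm_nonneg _)
      (pow_le_one₀ (by norm_num) (by norm_num))) hx)
  have hit2 : ∀ x y, ‖x‖ ≤ r' → ‖y‖ ≤ r' → ∀ k : ℕ,
      ‖h^[k] x - h^[k] y‖ ≤ (2 / 3 : ℝ) ^ k * ‖x - y‖ := by
    intro x y hx hy k
    induction k with
    | zero => simp
    | succ k ih =>
      rw [Function.iterate_succ_apply', Function.iterate_succ_apply']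
      refine (hcontr _ _ (hitr x hx k) (hitr y hy k)).trans ?_
      rw [pow_succ]; nlinarith
  have hstep : ∀ ρ ≤ r', ∀ x y, ‖x‖ ≤ ρ → ‖y‖ ≤ ρ → ∀ k : ℕ,
      dist ((2 : ℂ) ^ k • h^[k] x - (2 : ℂ) ^ k • h^[k] y)
        ((2 : ℂ) ^ (k + 1) • h^[k + 1] x - (2 : ℂ) ^ (k + 1) • h^[k + 1] y) ≤
        (2 * C * ρ * ‖x - y‖) * (8 / 9 : ℝ) ^ k := by
    intro ρ hρ x y hx hy k
    have hρ0 : 0 ≤ ρ := (norm_nonneg _).trans hx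
    rw [dist_comm, dist_eq_norm]
    have e : ((2 : ℂ) ^ (k + 1) • h^[k + 1] x - (2 : ℂ) ^ (k + 1) • h^[k + 1] y) -
        ((2 : ℂ) ^ k • h^[k] x - (2 : ℂ) ^ k • h^[k] y) =
        (2 : ℂ) ^ (k + 1) • ((h (h^[k] x) - (1 / 2 : ℂ) • h^[k] x) -
          (h (h^[k] y) - (1 / 2 : ℂ) • h^[k] y)) := by
      rw [Function.iterate_succ_apply', Function.iterate_succ_apply']
      have : (2 : ℂ) ^ (k + 1) * (1 / 2) = 2 ^ k := by rw [pow_succ]; ring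
      simp only [smul_sub, smul_smul, this]; abel
    rw [e, norm_smul, norm_pow]
    have hbd : ∀ z, ‖z‖ ≤ ρ → ‖h^[k] z‖ ≤ (2 / 3 : ℝ) ^ k * ρ := fun z hz =>
      (hit z (hz.trans hρ) k).trans (by gcongr)
    have hle : (2 / 3 : ℝ) ^ k * ρ ≤ r :=
      (mul_le_of_le_one_left hρ0 (pow_le_one₀ (by norm_num) (by norm_num))).trans
        (hρ.trans (min_le_left _ _))
    have h1 := hest _ hle _ _ (hbd x hx) (hbd y hy)
    have h2 := hit2 x y (hx.trans hρ) (hy.trans hρ) k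
    have h3 : ‖(2 : ℂ)‖ = 2 := by norm_num
    rw [h3]
    calc (2 : ℝ) ^ (k + 1) * _ ≤ 2 ^ (k + 1) * (C * ((2 / 3) ^ k * ρ) * ((2 / 3) ^ k * ‖x - y‖)) := by
          gcongr
          refine h1.trans ?_
          gcongr
      _ = (2 * C * ρ * ‖x - y‖) * (2 * (2 / 3) * (2 / 3) : ℝ) ^ k := by
          rw [mul_pow, mul_pow, pow_succ]; ring
      _ = _ := by norm_num
  have hz : ∀ k : ℕ, h^[k] 0 = 0 := fun k => Function.iterate_fixed h0 k
  have hlim : ∀ x, ‖x‖ ≤ r' → ∃ l, Tendsto (fun k : ℕ => (2 : ℂ) ^ k • h^[k] x) atTop (𝓝 l) := by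
    intro x hx
    apply cauchySeq_tendsto_of_complete
    refine cauchySeq_of_le_geometric (8 / 9 : ℝ) (2 * C * r' * ‖x - 0‖) (by norm_num) (fun k => ?_)
    have := hstep r' le_rfl x 0 hx (by simpa using hr'0.le) k
    simpa [hz] using this
  choose! L hL using hlim
  refine ⟨L, 2 * C * 9, by positivity, r', hr'0, min_le_left _ _, ?_, hit, hL⟩
  intro ρ hρ x y hx hy
  have ht := (hL x (hx.trans hρ)).sub (hL y (hy.trans hρ))
  have := dist_le_of_le_geometric_of_tendsto₀ (8 / 9 : ℝ) (2 * C * ρ * ‖x - y‖) (by norm_num)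
    (hstep ρ hρ x y hx hy) ht
  rw [dist_comm, dist_eq_norm] at this
  simp only [pow_zero, one_smul, Function.iterate_zero, id] at this
  refine this.trans (le_of_eq ?_)
  ring

/-- Extending a local homomorphism from a vector space. -/
lemma extend_local {G : Type} [AddCommGroup G] (e : V → G) (ρ : ℝ) (hρ : 0 < ρ)
    (he : ∀ v w, ‖v‖ < ρ → ‖w‖ < ρ → e (v + w) = e v + e w) :
    ∃ E : V →+ G, ∀ v, ‖v‖ < ρ → E v = e v := by
  have hhalf : ∀ v, ‖v‖ < ρ → e v = (2 : ℕ) • e ((1 / 2 : ℂ) • v) := by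
    intro v hv
    have h2 : ‖(1 / 2 : ℂ) • v‖ < ρ := by
      rw [norm_smul]
      have : ‖(1 / 2 : ℂ)‖ = 1 / 2 := by norm_num
      rw [this]; nlinarith [norm_nonneg v]
    rw [two_nsmul, ← he _ _ h2 h2, ← add_smul]; norm_num
  let P : V → ℕ → Prop := fun v k => ‖(1 / 2 : ℂ) ^ k • v‖ < ρ
  have hP : ∀ v, ∃ k₀, ∀ k ≥ k₀, P v k := by
    intro v
    have : Tendsto (fun k : ℕ => (1 / 2 : ℂ) ^ k • v) atTop (𝓝 ((0 : ℂ) • v)) :=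
      (tendsto_pow_atTop_nhds_zero_of_norm_lt_one (by norm_num)).smul_const v
    rw [zero_smul] at this
    have := this.norm.eventually_lt_const (u := ρ) (by simpa using hρ)
    exact eventually_atTop.1 this
  have hstab : ∀ v k j, P v k → (2 ^ (k + j) : ℕ) • e ((1 / 2 : ℂ) ^ (k + j) • v) =
      (2 ^ k : ℕ) • e ((1 / 2 : ℂ) ^ k • v) ∧ P v (k + j) := by
    intro v k j hk
    induction j with
    | zero => exact ⟨rfl, hk⟩
    | succ j ih =>
      refine ⟨?_, ?_⟩
      · rw [← ih.1, hhalf _ ih.2, smul_smul, smul_smul, ← add_assoc, pow_succ, pow_succ']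
      · show ‖_‖ < ρ
        rw [← add_assoc, pow_succ', mul_smul, norm_smul]
        have : ‖(1 / 2 : ℂ)‖ = 1 / 2 := by norm_num
        rw [this]
        have := ih.2
        simp only [P] at this
        nlinarith [norm_nonneg ((1 / 2 : ℂ) ^ (k + j) • v)]
  choose k₀ hk₀ using hP
  let E : V → G := fun v => (2 ^ k₀ v : ℕ) • e ((1 / 2 : ℂ) ^ k₀ v • v)
  have hE : ∀ v k, P v k → E v = (2 ^ k : ℕ) • e ((1 / 2 : ℂ) ^ k • v) := by
    intro v k hk
    have h1 := (hstab v k (k₀ v) hk).1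
    have h2 := (hstab v (k₀ v) k (hk₀ v _ le_rfl)).1
    rw [add_comm] at h2
    exact h2.symm.trans h1
  have hE0 : ∀ v, ‖v‖ < ρ → E v = e v := by
    intro v hv
    have := hE v 0 (by simpa [P] using hv)
    simpa using this
  refine ⟨AddMonoidHom.mk' E ?_, hE0⟩
  intro v w
  let k := max (max (k₀ v) (k₀ w)) (k₀ (v + w))
  have hv := hk₀ v k (by simp [k])
  have hw := hk₀ w k (by simp [k])
  have hvw := hk₀ (v + w) k (by simp [k])
  rw [hE _ _ hv, hE _ _ hw, hE _ _ hvw, smul_add, he _ _ hv hw, smul_add]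

end Analysis
end AVProof

namespace AVProof
open Filter Topology

section Exp

variable {V : Type} [NormedAddCommGroup V] [NormedSpace ℂ V] [CompleteSpace V]

lemma deriv_group_law {G : Type} [AddCommGroup G] (c : V → G) (c0 : c 0 = 0)
    (cinj : ∃ U ∈ 𝓝 (0 : V), Set.InjOn c U)
    (m : V × V → V) (hm : ContDiffAt ℂ 2 m 0) (m0 : m 0 = 0)
    (hcm : ∀ᶠ p in 𝓝 (0 : V × V), c p.1 + c p.2 = c (m p)) :
    fderiv ℂ m 0 = ContinuousLinearMap.fst ℂ V V + ContinuousLinearMap.snd ℂ V V := by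
  obtain ⟨U, hU, hinj⟩ := cinj
  have hd : HasFDerivAt m (fderiv ℂ m 0) (0 : V × V) :=
    (hm.differentiableAt (by norm_num)).hasFDerivAt
  have hcont : Tendsto m (𝓝 0) (𝓝 0) := by simpa [ContinuousAt, m0] using hm.continuousAt
  have h1 : ∀ᶠ s in 𝓝 (0 : V), m (s, 0) = s := by
    have t : Tendsto (fun s : V => (s, (0 : V))) (𝓝 0) (𝓝 (0 : V × V)) := by
      have : Continuous (fun s : V => (s, (0 : V))) := by fun_prop
      exact this.tendsto' _ _ rfl
    filter_upwards [t.eventually hcm, (hcont.comp t).eventually hU, hU] with s hs hs1 hs2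
    apply hinj hs1 hs2
    simpa [c0] using hs.symm
  have h2 : ∀ᶠ s in 𝓝 (0 : V), m (0, s) = s := by
    have t : Tendsto (fun s : V => ((0 : V), s)) (𝓝 0) (𝓝 (0 : V × V)) := by
      have : Continuous (fun s : V => ((0 : V), s)) := by fun_prop
      exact this.tendsto' _ _ rfl
    filter_upwards [t.eventually hcm, (hcont.comp t).eventually hU, hU] with s hs hs1 hs2
    apply hinj hs1 hs2
    simpa [c0] using hs.symm
  have e1 : (fderiv ℂ m 0).comp (ContinuousLinearMap.inl ℂ V V) = ContinuousLinearMap.id ℂ V := by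
    have hA : HasFDerivAt (fun s : V => m (s, 0))
        ((fderiv ℂ m 0).comp (ContinuousLinearMap.inl ℂ V V)) 0 :=
      HasFDerivAt.comp (0 : V) (f := fun s : V => (s, (0 : V))) (g := m) hd
        (ContinuousLinearMap.inl ℂ V V).hasFDerivAt
    have hB : HasFDerivAt (fun s : V => m (s, 0)) (ContinuousLinearMap.id ℂ V) 0 :=
      (hasFDerivAt_id _).congr_of_eventuallyEq h1
    exact hA.unique hB
  have e2 : (fderiv ℂ m 0).comp (ContinuousLinearMap.inr ℂ V V) = ContinuousLinearMap.id ℂ V := by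
    have hA : HasFDerivAt (fun s : V => m (0, s))
        ((fderiv ℂ m 0).comp (ContinuousLinearMap.inr ℂ V V)) 0 :=
      HasFDerivAt.comp (0 : V) (f := fun s : V => ((0 : V), s)) (g := m) hd
        (ContinuousLinearMap.inr ℂ V V).hasFDerivAt
    have hB : HasFDerivAt (fun s : V => m (0, s)) (ContinuousLinearMap.id ℂ V) 0 :=
      (hasFDerivAt_id _).congr_of_eventuallyEq h2
    exact hA.unique hB
  ext p
  · simpa using congr($e1 p)
  · simpa using congr($e2 p)

/-- data of the logarithm -/
lemma exists_log {G : Type} [AddCommGroup G] (c : V → G) (c0 : c 0 = 0)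
    (cinj : ∃ U ∈ 𝓝 (0 : V), Set.InjOn c U)
    (m : V × V → V) (hm : ContDiffAt ℂ 2 m 0) (m0 : m 0 = 0)
    (hcm : ∀ᶠ p in 𝓝 (0 : V × V), c p.1 + c p.2 = c (m p)) :
    ∃ L : V → V, L 0 = 0 ∧ HasStrictFDerivAt L (ContinuousLinearMap.id ℂ V) 0 ∧
      ∀ᶠ p in 𝓝 (0 : V × V), L (m p) = L p.1 + L p.2 := by
  have hdm := deriv_group_law c c0 cinj m hm m0 hcm
  obtain ⟨U, hU, hinj⟩ := cinj
  have hcont : Tendsto m (𝓝 0) (𝓝 0) := by simpa [ContinuousAt, m0] using hm.continuousAt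
  let two : V ≃L[ℂ] V := ContinuousLinearEquiv.smulLeft (Units.mk0 (2 : ℂ) two_ne_zero)
  let diag : V →L[ℂ] V × V := (ContinuousLinearMap.id ℂ V).prod (ContinuousLinearMap.id ℂ V)
  let d : V → V := fun s => m (s, s)
  have hdc : ContDiffAt ℂ 2 d 0 :=
    ContDiffAt.comp (0 : V) (g := m) (f := diag) (by exact hm) diag.contDiff.contDiffAt
  have hdd : HasFDerivAt d (two : V →L[ℂ] V) 0 := by
    have hd : HasFDerivAt m (fderiv ℂ m 0) (diag 0) := by
      exact (hm.differentiableAt (by norm_num)).hasFDerivAt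
    have := HasFDerivAt.comp (0 : V) (f := diag) (g := m) hd diag.hasFDerivAt
    rw [hdm] at this
    have e : (two : V →L[ℂ] V) = (ContinuousLinearMap.fst ℂ V V +
        ContinuousLinearMap.snd ℂ V V).comp diag := by
      ext s
      exact two_smul ℂ s
    rw [e]
    exact this
  have hd0 : d 0 = 0 := m0
  have hdcont : Tendsto d (𝓝 0) (𝓝 0) := by simpa [ContinuousAt, hd0] using hdc.continuousAt
  have hds : HasStrictFDerivAt d (two : V →L[ℂ] V) 0 := hdc.hasStrictFDerivAt' hdd (by norm_num)
  let h : V → V := hdc.localInverse hdd (by norm_num)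
  have hhc : ContDiffAt ℂ 2 h 0 := by
    have := hdc.to_localInverse hdd (by norm_num)
    rwa [hd0] at this
  have hhd : HasFDerivAt h (two.symm : V →L[ℂ] V) 0 := by
    have := hds.to_localInverse.hasFDerivAt
    rwa [hd0] at this
  have hleft : ∀ᶠ x in 𝓝 (0 : V), h (d x) = x := hds.eventually_left_inverse
  have hright : ∀ᶠ x in 𝓝 (0 : V), d (h x) = x := by
    have := hds.eventually_right_inverse
    rwa [hd0] at this
  have h0 : h 0 = 0 := by
    have := hleft.self_of_nhds
    rwa [hd0] at this
  have hhcont : Tendsto h (𝓝 0) (𝓝 0) := by simpa [ContinuousAt, h0] using hhc.continuousAt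
  -- the estimate on h
  have hq : ContDiffAt ℂ 2 (fun x => h x - (1 / 2 : ℂ) • x) 0 :=
    hhc.sub (contDiffAt_id.const_smul _)
  have hq1 : fderiv ℂ (fun x => h x - (1 / 2 : ℂ) • x) 0 = 0 := by
    have := hhd.fun_sub ((hasFDerivAt_id (𝕜 := ℂ) (0 : V)).const_smul (1 / 2 : ℂ))
    refine this.fderiv.trans ?_
    ext s
    have e : two.symm s = (1 / 2 : ℂ) • s := by
      rw [ContinuousLinearEquiv.symm_apply_eq]
      change s = (2 : ℂ) • ((1 / 2 : ℂ) • s)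
      rw [smul_smul]; norm_num
    simp [e]
  obtain ⟨C, hC, r, hr, hest⟩ := quad_est _ hq hq1
  obtain ⟨L, C', hC', r', hr', hrr, hLest, hit, hLt⟩ := koenigs h C r hC hr h0 hest
  have hL0 : L 0 = 0 := by
    have := hLt 0 (by simpa using hr'.le)
    simp only [Function.iterate_fixed h0, smul_zero] at this
    exact tendsto_nhds_unique this tendsto_const_nhds
  refine ⟨L, hL0, ?_, ?_⟩
  · rw [hasStrictFDerivAt_iff_isLittleO, Asymptotics.isLittleO_iff]
    intro ε hε
    have hpos : 0 < min r' (ε / C') := by positivity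
    have hb : Metric.ball (0 : V) (min r' (ε / C')) ∈ 𝓝 (0 : V) := Metric.ball_mem_nhds _ hpos
    filter_upwards [prod_mem_nhds hb hb] with p hp
    obtain ⟨hp1, hp2⟩ := hp
    rw [mem_ball_zero_iff] at hp1 hp2
    have := hLest (min r' (ε / C')) (min_le_left _ _) p.1 p.2 hp1.le hp2.le
    refine this.trans ?_
    gcongr
    calc C' * min r' (ε / C') ≤ C' * (ε / C') := by gcongr; exact min_le_right _ _
      _ = ε := by field_simp
  · -- h commutes with m
    have hpair : Tendsto (fun p : V × V => (h p.1, h p.2)) (𝓝 0) (𝓝 (0 : V × V)) :=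
      (hhcont.comp (continuous_fst.tendsto' (0 : V × V) 0 rfl)).prodMk_nhds
        (hhcont.comp (continuous_snd.tendsto' (0 : V × V) 0 rfl))
    have hcd : ∀ᶠ x in 𝓝 (0 : V), c (d x) = c x + c x := by
      have t : Tendsto (fun s : V => (s, s)) (𝓝 0) (𝓝 (0 : V × V)) :=
        (continuous_id.prodMk continuous_id).tendsto' _ _ rfl
      filter_upwards [t.eventually hcm] with x hx using hx.symm
    have hcomm : ∀ᶠ p in 𝓝 (0 : V × V), h (m p) = m (h p.1, h p.2) := by
      have hf := continuous_fst.tendsto' (0 : V × V) (0 : V) rfl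
      have hs := continuous_snd.tendsto' (0 : V × V) (0 : V) rfl
      have hx := hcont.comp hpair
      filter_upwards [hcm, hpair.eventually hcm, hf.eventually hright, hs.eventually hright,
        (hhcont.comp hf).eventually hcd, (hhcont.comp hs).eventually hcd, hx.eventually hcd,
        hx.eventually hleft, (hdcont.comp hx).eventually hU, hcont.eventually hU]
        with p h1 h2 h3 h4 h5 h6 h7 h8 h9 h10
      simp only [Function.comp] at *
      have : d (m (h p.1, h p.2)) = m p := by
        apply hinj h9 h10
        rw [h7, ← h2, ← h1]
        simp only [h3, h4] at h5 h6
        simp only [h5, h6]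
        abel
      rw [← this, h8]
    -- estimate on m
    have hqm : ContDiffAt ℂ 2 (fun p : V × V => m p - (p.1 + p.2)) 0 :=
      hm.sub (contDiffAt_fst.add contDiffAt_snd)
    have hqm1 : fderiv ℂ (fun p : V × V => m p - (p.1 + p.2)) 0 = 0 := by
      have hd : HasFDerivAt m (fderiv ℂ m 0) (0 : V × V) :=
        (hm.differentiableAt (by norm_num)).hasFDerivAt
      have := hd.fun_sub ((hasFDerivAt_fst (𝕜 := ℂ) (p := (0 : V × V))).fun_add hasFDerivAt_snd)
      rw [this.fderiv, hdm]
      simp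
    obtain ⟨Cm, hCm, rm, hrm, hmest⟩ := quad_est _ hqm hqm1
    obtain ⟨δ, hδ, hball⟩ := Metric.eventually_nhds_iff_ball.1 hcomm
    have hpos : 0 < min (min rm (δ / 2)) r' := by positivity
    have hmb : ∀ᶠ p in 𝓝 (0 : V × V), ‖m p‖ ≤ r' := by
      have := hcont.norm.eventually_lt_const (u := r') (by simpa using hr')
      filter_upwards [this] with p hp using hp.le
    filter_upwards [Metric.ball_mem_nhds (0 : V × V) hpos, hmb] with p hp hmp
    rw [mem_ball_zero_iff] at hp
    have hpr : ‖p‖ < r' := hp.trans_le (min_le_right _ _)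
    have hpm : ‖p‖ < rm := hp.trans_le ((min_le_left _ _).trans (min_le_left _ _))
    have hpd : ‖p‖ < δ := (hp.trans_le ((min_le_left _ _).trans (min_le_right _ _))).trans
      (by linarith)
    have hp1 : ‖p.1‖ ≤ ‖p‖ := norm_fst_le p
    have hp2 : ‖p.2‖ ≤ ‖p‖ := norm_snd_le p
    let q : ℕ → V × V := fun k => (h^[k] p.1, h^[k] p.2)
    have hqb : ∀ k, ‖q k‖ ≤ (2 / 3 : ℝ) ^ k * ‖p‖ := by
      intro k
      refine norm_prod_le_iff.2 ⟨(hit p.1 (hp1.trans hpr.le) k).trans (by gcongr),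
        (hit p.2 (hp2.trans hpr.le) k).trans (by gcongr)⟩
    have hqb' : ∀ k, ‖q k‖ ≤ ‖p‖ := fun k => (hqb k).trans
      (mul_le_of_le_one_left (norm_nonneg _) (pow_le_one₀ (by norm_num) (by norm_num)))
    have hitm : ∀ k, h^[k] (m p) = m (q k) := by
      intro k
      induction k with
      | zero => rfl
      | succ k ih =>
        rw [Function.iterate_succ_apply', ih, hball (q k)
          (by rw [mem_ball_zero_iff]; exact (hqb' k).trans_lt hpd)]
        simp only [q, Function.iterate_succ_apply']
    have t1 := hLt (m p) hmp
    have t2 := (hLt p.1 (hp1.trans hpr.le)).add (hLt p.2 (hp2.trans hpr.le))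
    have t3 : Tendsto (fun k : ℕ => (2 : ℂ) ^ k • (m (q k) - ((q k).1 + (q k).2))) atTop (𝓝 0) := by
      have hz : Tendsto (fun k : ℕ => Cm * ‖p‖ ^ 2 * (8 / 9 : ℝ) ^ k) atTop (𝓝 0) := by
        simpa using (tendsto_pow_atTop_nhds_zero_of_lt_one (r := (8 / 9 : ℝ)) (by norm_num)
          (by norm_num)).const_mul (Cm * ‖p‖ ^ 2)
      refine squeeze_zero_norm (fun k => ?_) hz
      rw [norm_smul, norm_pow]
      have h3 : ‖(2 : ℂ)‖ = 2 := by norm_num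
      rw [h3]
      have e := hmest ‖q k‖ ((hqb' k).trans hpm.le) (q k) 0 le_rfl (by simp)
      simp only [Prod.fst_zero, Prod.snd_zero, m0, add_zero, sub_zero] at e
      calc (2 : ℝ) ^ k * ‖m (q k) - ((q k).1 + (q k).2)‖
          ≤ 2 ^ k * (Cm * ((2 / 3) ^ k * ‖p‖) * ((2 / 3) ^ k * ‖p‖)) := by
            gcongr
            refine e.trans ?_
            gcongr
            · exact hqb k
            · exact hqb k
        _ = Cm * ‖p‖ ^ 2 * (2 * (2 / 3) * (2 / 3) : ℝ) ^ k := by rw [mul_pow, mul_pow]; ring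
        _ = _ := by norm_num
    have t4 := t3.add t2
    rw [zero_add] at t4
    refine tendsto_nhds_unique t1 (t4.congr fun k => ?_)
    rw [hitm k, ← smul_add, ← smul_add]
    simp [q]

end Exp
end AVProof

namespace AVProof
open Filter Topology

section Exp3

variable {V : Type} [NormedAddCommGroup V] [NormedSpace ℂ V] [CompleteSpace V]

lemma exists_exp {G : Type} [AddCommGroup G] (c : V → G) (c0 : c 0 = 0)
    (cinj : ∃ U ∈ 𝓝 (0 : V), Set.InjOn c U)
    (m : V × V → V) (hm : ContDiffAt ℂ 2 m 0) (m0 : m 0 = 0)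
    (hcm : ∀ᶠ p in 𝓝 (0 : V × V), c p.1 + c p.2 = c (m p)) :
    ∃ (E : V →+ G) (L l : V → V), L 0 = 0 ∧ l 0 = 0 ∧
      HasFDerivAt L (ContinuousLinearMap.id ℂ V) 0 ∧
      HasFDerivAt l (ContinuousLinearMap.id ℂ V) 0 ∧
      (∀ᶠ v in 𝓝 (0 : V), E v = c (l v)) ∧
      (∀ᶠ s in 𝓝 (0 : V), E (L s) = c s) ∧
      ∃ ρ > 0, ∀ v, ‖v‖ < ρ → E v = 0 → v = 0 := by
  obtain ⟨L, L0, hL, hLm⟩ := exists_log c c0 cinj m hm m0 hcm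
  obtain ⟨U, hU, hinj⟩ := cinj
  have hmc : Tendsto m (𝓝 0) (𝓝 0) := by simpa [ContinuousAt, m0] using hm.continuousAt
  have hL' : HasStrictFDerivAt L ((ContinuousLinearEquiv.refl ℂ V : V ≃L[ℂ] V) : V →L[ℂ] V) 0 := hL
  let l : V → V := hL'.localInverse
  have hleft : ∀ᶠ x in 𝓝 (0 : V), l (L x) = x := hL'.eventually_left_inverse
  have hright : ∀ᶠ x in 𝓝 (0 : V), L (l x) = x := by
    have := hL'.eventually_right_inverse
    rwa [L0] at this
  have hld : HasFDerivAt l (ContinuousLinearMap.id ℂ V) 0 := by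
    have := hL'.to_localInverse.hasFDerivAt
    rw [L0] at this
    exact this
  have l0 : l 0 = 0 := by
    have := hleft.self_of_nhds
    rwa [L0] at this
  have hlc : Tendsto l (𝓝 0) (𝓝 0) := by simpa [ContinuousAt, l0] using hld.continuousAt
  have hLc : Tendsto L (𝓝 0) (𝓝 0) := by
    simpa [ContinuousAt, L0] using hL.hasFDerivAt.continuousAt
  have hpair : Tendsto (fun p : V × V => (l p.1, l p.2)) (𝓝 0) (𝓝 (0 : V × V)) :=
    (hlc.comp (continuous_fst.tendsto' (0 : V × V) 0 rfl)).prodMk_nhds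
      (hlc.comp (continuous_snd.tendsto' (0 : V × V) 0 rfl))
  have t1 : Tendsto (Prod.fst : V × V → V) (𝓝 0) (𝓝 0) := continuous_fst.tendsto' _ _ rfl
  have t2 : Tendsto (Prod.snd : V × V → V) (𝓝 0) (𝓝 0) := continuous_snd.tendsto' _ _ rfl
  have hadd : ∀ᶠ p in 𝓝 (0 : V × V), c (l (p.1 + p.2)) = c (l p.1) + c (l p.2) := by
    filter_upwards [hpair.eventually hLm, hpair.eventually hcm, (hmc.comp hpair).eventually hleft,
      t1.eventually hright, t2.eventually hright] with p h1 h2 h3 h4 h5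
    simp only [Function.comp] at h3
    rw [h4, h5] at h1
    rw [h2, ← h3, h1]
  obtain ⟨ρ, hρ, hball⟩ := Metric.eventually_nhds_iff_ball.1 hadd
  obtain ⟨E, hE⟩ := extend_local (fun v => c (l v)) ρ hρ (by
    intro v w hv hw
    exact hball (v, w) (by simp [Prod.norm_def, hv, hw]))
  have hE' : ∀ᶠ v in 𝓝 (0 : V), E v = c (l v) := by
    filter_upwards [Metric.ball_mem_nhds (0 : V) hρ] with v hv
    exact hE v (by simpa using hv)
  refine ⟨E, L, l, L0, l0, hL.hasFDerivAt, hld, hE', ?_, ?_⟩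
  · filter_upwards [hLc.eventually hE', hleft] with s h1 h2
    rw [h1, h2]
  · have : ∀ᶠ v in 𝓝 (0 : V), E v = 0 → v = 0 := by
      filter_upwards [hE', hlc.eventually hU, hright] with v h1 h2 h3 h4
      have : l v = 0 := hinj h2 (mem_of_mem_nhds hU) (by rw [← h1, h4, c0])
      rw [← h3, this, L0]
    obtain ⟨ρ, hρ, hball⟩ := Metric.eventually_nhds_iff_ball.1 this
    exact ⟨ρ, hρ, fun v hv => hball v (by simpa using hv)⟩

/-- endomorphisms are linear in the exponential chart -/
lemma endo_linear {G : Type} [AddCommGroup G] (c : V → G)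
    (E : V →+ G) (L l : V → V) (L0 : L 0 = 0) (l0 : l 0 = 0)
    (hL : HasFDerivAt L (ContinuousLinearMap.id ℂ V) 0)
    (hl : HasFDerivAt l (ContinuousLinearMap.id ℂ V) 0)
    (hE : ∀ᶠ v in 𝓝 (0 : V), E v = c (l v))
    (hE2 : ∀ᶠ s in 𝓝 (0 : V), E (L s) = c s)
    (hdisc : ∃ ρ > 0, ∀ v, ‖v‖ < ρ → E v = 0 → v = 0)
    (φ : G →+ G) (f : V → V) (D : V →L[ℂ] V) (f0 : f 0 = 0) (hf : HasFDerivAt f D 0)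
    (hφ : ∀ᶠ s in 𝓝 (0 : V), φ (c s) = c (f s)) (v : V) : φ (E v) = E (D v) := by
  obtain ⟨ρ, hρ, hdisc⟩ := hdisc
  have hlc : Tendsto l (𝓝 0) (𝓝 0) := by simpa [ContinuousAt, l0] using hl.continuousAt
  have hfc : Tendsto f (𝓝 0) (𝓝 0) := by simpa [ContinuousAt, f0] using hf.continuousAt
  let ψ : V → V := fun v => L (f (l v))
  have hψ : HasFDerivAt ψ D 0 := by
    have h1 : HasFDerivAt (f ∘ l) (D.comp (ContinuousLinearMap.id ℂ V)) 0 :=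
      HasFDerivAt.comp (0 : V) (by rw [l0]; exact hf) hl
    have h2 : HasFDerivAt (L ∘ (f ∘ l))
        ((ContinuousLinearMap.id ℂ V).comp (D.comp (ContinuousLinearMap.id ℂ V))) 0 :=
      HasFDerivAt.comp (0 : V) (by simpa [l0, f0] using hL) h1
    exact h2
  have ψ0 : ψ 0 = 0 := by simp [ψ, l0, f0, L0]
  have hψE : ∀ᶠ v in 𝓝 (0 : V), φ (E v) = E (ψ v) := by
    filter_upwards [hE, hlc.eventually hφ, (hfc.comp hlc).eventually hE2] with v h1 h2 h3
    simp only [Function.comp] at h3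
    rw [h1, h2, ← h3]
  have hz : Tendsto (fun k : ℕ => (1 / 2 : ℂ) ^ k • v) atTop (𝓝 0) := by
    have : Tendsto (fun k : ℕ => (1 / 2 : ℂ) ^ k • v) atTop (𝓝 ((0 : ℂ) • v)) :=
      (tendsto_pow_atTop_nhds_zero_of_norm_lt_one (by norm_num)).smul_const v
    simpa using this
  let w : ℕ → V := fun k => (2 ^ k : ℕ) • ψ ((1 / 2 : ℂ) ^ k • v)
  have hw : Tendsto w atTop (𝓝 (D v)) := by
    have h1 := hψ.isLittleO
    simp only [ψ0, sub_zero] at h1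
    have h2 := h1.comp_tendsto hz
    have hpow : ∀ k : ℕ, ((2 ^ k : ℕ) : ℂ) * (1 / 2 : ℂ) ^ k = 1 := by
      intro k; push_cast; rw [← mul_pow]; norm_num
    rw [tendsto_iff_norm_sub_tendsto_zero, ← Asymptotics.isLittleO_one_iff ℝ, Asymptotics.isLittleO_norm_left]
    rw [Asymptotics.isLittleO_iff] at h2 ⊢
    intro ε hε
    have hε' : 0 < ε / (‖v‖ + 1) := by positivity
    filter_upwards [h2 hε'] with k hk
    simp only [Function.comp, map_smul] at hk
    have e : w k - D v = ((2 ^ k : ℕ) : ℂ) •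
        (ψ ((1 / 2 : ℂ) ^ k • v) - (1 / 2 : ℂ) ^ k • D v) := by
      rw [smul_sub, smul_smul, hpow, one_smul, Nat.cast_smul_eq_nsmul]
    rw [e, norm_smul]
    calc _ ≤ ‖((2 ^ k : ℕ) : ℂ)‖ * (ε / (‖v‖ + 1) * ‖(1 / 2 : ℂ) ^ k • v‖) := by gcongr
      _ = ‖((2 ^ k : ℕ) : ℂ) * (1 / 2 : ℂ) ^ k‖ * (ε / (‖v‖ + 1) * ‖v‖) := by
        rw [norm_smul, norm_mul]; ring
      _ = ε * (‖v‖ / (‖v‖ + 1)) := by rw [hpow]; simp; ring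
      _ ≤ ε * 1 := by
        gcongr
        rw [div_le_one (by positivity)]; linarith
      _ = ε * ‖(1 : ℝ)‖ := by simp
  have hEw : ∀ᶠ k in atTop, E (w k) = φ (E v) := by
    filter_upwards [hz.eventually hψE] with k hk
    simp only [w, map_nsmul, ← hk]
    rw [← map_nsmul, ← map_nsmul, ← Nat.cast_smul_eq_nsmul ℂ, smul_smul]
    congr 2
    have : ((2 ^ k : ℕ) : ℂ) * (1 / 2 : ℂ) ^ k = 1 := by
      push_cast; rw [← mul_pow]; norm_num
    rw [this, one_smul]
  -- eventually constant
  have hnear : ∀ᶠ k in atTop, ‖w k - D v‖ < ρ / 2 := by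
    have := (tendsto_iff_norm_sub_tendsto_zero.1 hw).eventually (gt_mem_nhds (by positivity : 0 < ρ / 2))
    exact this
  obtain ⟨N, hN⟩ := (hEw.and hnear).exists_forall_of_atTop
  have hconst : ∀ k ≥ N, w k = w N := by
    intro k hk
    rw [← sub_eq_zero]
    apply hdisc
    · calc ‖w k - w N‖ = ‖(w k - D v) - (w N - D v)‖ := by congr 1; abel
        _ ≤ ‖w k - D v‖ + ‖w N - D v‖ := norm_sub_le _ _
        _ < ρ := by linarith [(hN k hk).2, (hN N le_rfl).2]
    · rw [map_sub, (hN k hk).1, (hN N le_rfl).1, sub_self]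
  have : D v = w N := by
    apply tendsto_nhds_unique hw
    apply tendsto_const_nhds.congr'
    filter_upwards [eventually_ge_atTop N] with k hk using (hconst k hk).symm
  rw [this, (hN N le_rfl).1]

lemma kernel_span [FiniteDimensional ℂ V] {G : Type} [AddCommGroup G] (c : V → G)
    (E : V →+ G) (L : V → V) (L0 : L 0 = 0)
    (hL : HasFDerivAt L (ContinuousLinearMap.id ℂ V) 0)
    (hE2 : ∀ᶠ s in 𝓝 (0 : V), E (L s) = c s)
    (hcpt : ∀ W ∈ 𝓝 (0 : V), ∃ T : Finset G, ∀ x : G, ∃ g ∈ T, ∃ s ∈ W, x - g = c s) :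
    Submodule.span ℝ {v : V | E v = 0} = ⊤ := by
  have hLc : Tendsto L (𝓝 0) (𝓝 0) := by simpa [ContinuousAt, L0] using hL.continuousAt
  obtain ⟨T, hT⟩ := hcpt _ (hE2.and (hLc.eventually (Metric.ball_mem_nhds 0 one_pos)))
  have hex : ∀ g : G, ∃ u : V, (∃ u, E u = g) → E u = g := by
    intro g
    by_cases h : ∃ u, E u = g
    · obtain ⟨u, hu⟩ := h; exact ⟨u, fun _ => hu⟩
    · exact ⟨0, fun h' => absurd h' h⟩
  choose u hu using hex
  obtain ⟨R, hR⟩ : ∃ R : ℝ, ∀ g ∈ T, ‖u g‖ ≤ R := by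
    obtain ⟨R, hR⟩ := (T.image (fun g => ‖u g‖)).bddAbove
    exact ⟨R, fun g hg => hR (by simpa using ⟨g, hg, rfl⟩)⟩
  have hcov : ∀ v : V, ∃ y, E y = 0 ∧ ‖v - y‖ ≤ R + 1 := by
    intro v
    obtain ⟨g, hg, s, ⟨hs1, hs2⟩, hs⟩ := hT (E v)
    have hgu : E (u g) = g := hu g ⟨v - L s, by rw [map_sub, hs1, ← hs]; abel⟩
    refine ⟨v - u g - L s, ?_, ?_⟩
    · rw [map_sub, map_sub, hgu, hs1, ← hs, sub_self]
    · have : v - (v - u g - L s) = u g + L s := by abel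
      rw [this]
      have h1 : ‖L s‖ < 1 := by simpa using hs2
      linarith [norm_add_le (u g) (L s), hR g hg]
  by_contra hne
  have hxx : ∃ x : V, x ∉ Submodule.span ℝ {v : V | E v = 0} := by
    by_contra h
    push Not at h
    exact hne (eq_top_iff.2 fun x _ => h x)
  have : FiniteDimensional ℝ V := FiniteDimensional.complexToReal V
  obtain ⟨x, hx, hx1, hx2⟩ := riesz_lemma_of_lt_one (𝕜 := ℝ)
    (Submodule.closed_of_finiteDimensional (Submodule.span ℝ {v : V | E v = 0})) hxx
    (r := 1 / 2) (by norm_num)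
  have hR0 : 0 ≤ R + 1 := by
    obtain ⟨y, -, hy⟩ := hcov 0
    exact (norm_nonneg _).trans hy
  set t : ℝ := 2 * (R + 2) with ht
  have htp : 0 < t := by linarith
  obtain ⟨y, hy, hy2⟩ := hcov (t • x)
  have := hx2 (t⁻¹ • y) (Submodule.smul_mem _ _ (Submodule.subset_span hy))
  have e : t • x - y = t • (x - t⁻¹ • y) := by
    rw [smul_sub, smul_smul, mul_inv_cancel₀ htp.ne', one_smul]
  rw [e, norm_smul, Real.norm_eq_abs, abs_of_pos htp] at hy2
  nlinarith

theorem analytic_bound [FiniteDimensional ℂ V] {G : Type} [AddCommGroup G] (c : V → G)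
    (c0 : c 0 = 0) (cinj : ∃ U ∈ 𝓝 (0 : V), Set.InjOn c U)
    (m : V × V → V) (hm : ContDiffAt ℂ 2 m 0) (m0 : m 0 = 0)
    (hcm : ∀ᶠ p in 𝓝 (0 : V × V), c p.1 + c p.2 = c (m p))
    (hcpt : ∀ W ∈ 𝓝 (0 : V), ∃ T : Finset G, ∀ x : G, ∃ g ∈ T, ∃ s ∈ W, x - g = c s)
    {ι : Type} [Fintype ι] (φ : ι → (G →+ G))
    (hφ : ∀ k, ∃ (f : V → V) (D : V →L[ℂ] V), f 0 = 0 ∧ HasFDerivAt f D 0 ∧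
      ∀ᶠ s in 𝓝 (0 : V), φ k (c s) = c (f s))
    (hind : ∀ n : ι → ℤ, (∀ᶠ s in 𝓝 (0 : V), (∑ k, n k • φ k) (c s) = 0) → n = 0) :
    Fintype.card ι ≤ 2 * (Module.finrank ℂ V) ^ 2 := by
  obtain ⟨E, L, l, L0, l0, hL, hl, hE, hE2, hdisc⟩ := exists_exp c c0 cinj m hm m0 hcm
  have hspan := kernel_span c E L L0 hL hE2 hcpt
  choose f D f0 hf hfc using hφ
  have hlin : ∀ k v, φ k (E v) = E (D k v) := fun k v =>
    endo_linear c E L l L0 l0 hL hl hE hE2 hdisc (φ k) (f k) (D k) (f0 k) (hf k) (hfc k) v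
  have : FiniteDimensional ℝ V := FiniteDimensional.complexToReal V
  have : FiniteDimensional ℂ (V →L[ℂ] V) := inferInstance
  have : FiniteDimensional ℝ (V →L[ℂ] V) := FiniteDimensional.complexToReal _
  obtain ⟨ρ, hρ, hdisc⟩ := hdisc
  -- subgroup of operators preserving the kernel
  let Γ : AddSubgroup (V →L[ℂ] V) :=
    { carrier := {A | ∀ v, E v = 0 → E (A v) = 0}
      add_mem' := by
        intro a b ha hb v hv
        simp [ha v hv, hb v hv]
      zero_mem' := by intro v hv; simp
      neg_mem' := by
        intro a ha v hv
        simp [ha v hv] }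
  have hDΓ : ∀ k, D k ∈ Γ := fun k v hv => by rw [← hlin, hv, map_zero]
  have hlind : LinearIndependent ℤ D := by
    rw [Fintype.linearIndependent_iff]
    intro n hn
    have := hind n ?_
    · exact fun i => congrFun this i
    · have key : ∀ v, (∑ k, n k • φ k) (E v) = 0 := by
        intro v
        have h1 : (∑ k, n k • D k) v = 0 := by rw [hn]; rfl
        have : (∑ k, n k • φ k) (E v) = E ((∑ k, n k • D k) v) := by
          simp [map_sum, hlin]
        rw [this, h1, map_zero]
      filter_upwards [hE2] with s hs
      rw [← hs]; exact key _
  have hΓdisc : ∃ δ > 0, ∀ A ∈ Γ, ‖A‖ < δ → A = 0 := by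
    obtain ⟨b, hb, hbs, hbl⟩ := exists_linearIndependent ℝ {v : V | E v = 0}
    have hfin : b.Finite := hbl.setFinite
    obtain ⟨R, hR⟩ : ∃ R : ℝ, ∀ g ∈ b, ‖g‖ ≤ R := by
      obtain ⟨R, hR⟩ := (hfin.image (fun g => ‖g‖)).bddAbove
      exact ⟨R, fun g hg => hR ⟨g, hg, rfl⟩⟩
    refine ⟨ρ / (|R| + 1), by positivity, fun A hA hAn => ?_⟩
    have h0 : ∀ x ∈ b, A x = 0 := by
      intro x hx
      apply hdisc _ _ (hA x (hb hx))
      calc ‖A x‖ ≤ ‖A‖ * ‖x‖ := A.le_opNorm x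
        _ ≤ ‖A‖ * (|R| + 1) := by
          gcongr; linarith [hR x hx, le_abs_self R]
        _ < ρ / (|R| + 1) * (|R| + 1) := by gcongr
        _ = ρ := by field_simp
    have : (A : V →ₗ[ℂ] V).restrictScalars ℝ = 0 := by
      apply LinearMap.ext_on (hbs.trans hspan)
      intro x hx
      exact h0 x hx
    ext v
    exact congr($this v)
  obtain ⟨δ, hδ, hΓdisc⟩ := hΓdisc
  have hsub : ∀ x ∈ Submodule.span ℤ (Set.range D), x ∈ Γ := by
    intro x hx
    have : Submodule.span ℤ (Set.range D) ≤ Γ.toIntSubmodule := by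
      rw [Submodule.span_le]
      rintro _ ⟨k, rfl⟩
      exact hDΓ k
    exact this hx
  have hdt : DiscreteTopology (Submodule.span ℤ (Set.range D)) := by
    apply DiscreteTopology.of_forall_le_dist hδ
    intro x y hxy
    by_contra hlt
    push Not at hlt
    apply hxy
    have := hΓdisc (x - y : V →L[ℂ] V) (Γ.sub_mem (hsub _ x.2) (hsub _ y.2)) (by
      rw [← dist_eq_norm]; exact hlt)
    exact Subtype.ext (sub_eq_zero.1 this)
  have h1 := Real.finrank_eq_int_finrank_of_discrete hdt
  have h2 : Set.finrank ℤ (Set.range D) = Fintype.card ι := finrank_span_eq_card hlind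
  have h3 : Set.finrank ℝ (Set.range D) ≤ Module.finrank ℝ (V →L[ℂ] V) := Submodule.finrank_le _
  have h4 : Module.finrank ℝ (V →L[ℂ] V) = 2 * Module.finrank ℂ (V →L[ℂ] V) := by
    rw [← Module.finrank_mul_finrank ℝ ℂ (V →L[ℂ] V), Complex.finrank_real_complex]
  have h5 : Module.finrank ℂ (V →L[ℂ] V) = (Module.finrank ℂ V) ^ 2 := by
    rw [← (LinearMap.toContinuousLinearMap (𝕜 := ℂ) (E := V) (F' := V)).finrank_eq,
      Module.finrank_linearMap, sq]
  rw [← h2, ← h1, ← h5, ← h4]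
  exact h3

end Exp3
end AVProof

namespace AVProof

/-- faithfully flat quasi-compact morphisms -/
abbrev FFQ : MorphismProperty Scheme.{0} := @Surjective ⊓ @Flat ⊓ @QuasiCompact

lemma ffq_of_isPullback {A B C D : Scheme.{0}} {a : A ⟶ B} {b : A ⟶ C} {c : B ⟶ D} {d : C ⟶ D}
    (h : IsPullback a b c d) (hd : FFQ d) : FFQ a :=
  ⟨⟨MorphismProperty.of_isPullback (P := @Surjective) h.flip hd.1.1,
    MorphismProperty.of_isPullback (P := @Flat) h.flip hd.1.2⟩,
    MorphismProperty.of_isPullback (P := @QuasiCompact) h.flip hd.2⟩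

/-- gluing of forms -/
theorem glue_form {S' S X : Scheme.{0}} (σ : S' ⟶ S)
    (hσ : FFQ σ)
    (f : X ⟶ S') (J : Set X.Opens)
    (hinf : ∀ U ∈ J, ∀ V ∈ J, U ⊓ V ∈ J) (hcov : ∀ x : X, ∃ U ∈ J, x ∈ U)
    (G : J ⥤ Scheme.{0}) (p : ∀ U : J, U.1.toScheme ⟶ G.obj U)
    (hp : ∀ (U V : J) (h : V ⟶ U), X.homOfLE (leOfHom h) ≫ p U = p V ≫ G.map h)
    (q : ∀ U : J, G.obj U ⟶ S) (hq : ∀ (U V : J) (h : V ⟶ U), G.map h ≫ q U = q V)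
    (hpb : ∀ U : J, IsPullback (p U) (U.1.ι ≫ f) (q U) σ) :
    ∃ (Y : Scheme.{0}) (π : X ⟶ Y) (s : Y ⟶ S), IsPullback π f s σ := by
  have hpb2 : ∀ (U V : J) (h : V ⟶ U), IsPullback (X.homOfLE (leOfHom h)) (p V) (p U) (G.map h) := by
    intro U V h
    refine IsPullback.of_right ?_ (hp U V h) (hpb U).flip
    rw [hq]
    simpa using (hpb V).flip
  have hpQ : ∀ U : J, FFQ (p U) := fun U => ffq_of_isPullback (hpb U) hσ
  have hsurj : ∀ U : J, Function.Surjective (p U) := fun U => (hpQ U).1.1.1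
  have hopen : ∀ {U V : J} (h : V ⟶ U), IsOpenImmersion (G.map h) := by
    intro U V h
    exact MorphismProperty.of_isPullback_of_descendsAlong (P := @IsOpenImmersion)
      (hpb2 U V h).flip.flip (hpQ U) inferInstance
  have hmem : ∀ {U V : J} (h : V ⟶ U) (x : U.1.toScheme) (y : G.obj V), p U x = G.map h y →
      ∃ z : V.1.toScheme, X.homOfLE (leOfHom h) z = x ∧ p V z = y := by
    intro U V h x y hxy
    obtain ⟨z, h1, h2⟩ := Scheme.Pullback.exists_preimage_pullback x y hxy
    refine ⟨(hpb2 U V h).isoPullback.inv z, ?_, ?_⟩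
    · rw [← h1, ← Scheme.Hom.comp_apply]; simp
    · rw [← h2, ← Scheme.Hom.comp_apply]; simp
  have hdir : (G ⋙ Scheme.forget).IsLocallyDirected := by
    constructor
    intro i j k fi fj xi xj hx
    replace hx : G.map fi xi = G.map fj xj := hx
    obtain ⟨x, hxx⟩ := hsurj k (G.map fi xi)
    obtain ⟨zi, hzi, hzi2⟩ := hmem fi x xi hxx
    obtain ⟨zj, hzj, hzj2⟩ := hmem fj x xj (hxx.trans hx)
    let l : J := ⟨i.1 ⊓ j.1, hinf _ i.2 _ j.2⟩
    have hle1 : l ≤ i := (fun _ hx => hx.1 : i.1 ⊓ j.1 ≤ i.1)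
    let fli : l ⟶ i := homOfLE hle1
    have hle2 : l ≤ j := (fun _ hx => hx.2 : i.1 ⊓ j.1 ≤ j.1)
    let flj : l ⟶ j := homOfLE hle2
    have e1 : k.1.ι x = i.1.ι zi := by rw [← hzi, ← Scheme.Hom.comp_apply]; simp
    have e2 : k.1.ι x = j.1.ι zj := by rw [← hzj, ← Scheme.Hom.comp_apply]; simp
    have hxl : k.1.ι x ∈ l.1 := ⟨by rw [e1]; exact zi.2, by rw [e2]; exact zj.2⟩
    let z : l.1.toScheme := ⟨k.1.ι x, hxl⟩
    have f1 : X.homOfLE (leOfHom fli) z = zi := by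
      apply i.1.ι.isOpenEmbedding.injective
      rw [← Scheme.Hom.comp_apply]
      simp only [Scheme.homOfLE_ι]
      exact e1
    have f2 : X.homOfLE (leOfHom flj) z = zj := by
      apply j.1.ι.isOpenEmbedding.injective
      rw [← Scheme.Hom.comp_apply]
      simp only [Scheme.homOfLE_ι]
      exact e2
    refine ⟨l, fli, flj, p l z, ?_, ?_⟩
    · change G.map fli (p l z) = xi
      rw [← Scheme.Hom.comp_apply, ← hp, Scheme.Hom.comp_apply, f1, hzi2]
    · change G.map flj (p l z) = xj
      rw [← Scheme.Hom.comp_apply, ← hp, Scheme.Hom.comp_apply, f2, hzj2]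
  let Y := colimit G
  let 𝒰 : X.OpenCover := X.openCoverOfIsOpenCover (fun U : J => U.1) (by
    rw [TopologicalSpace.IsOpenCover, eq_top_iff]
    intro x _
    obtain ⟨U, hU, hx⟩ := hcov x
    exact TopologicalSpace.Opens.mem_iSup.2 ⟨⟨U, hU⟩, hx⟩)
  let gU : ∀ U : J, U.1.toScheme ⟶ Y := fun U => p U ≫ colimit.ι G U
  have hg : ∀ (U V : J) (h : V ⟶ U), X.homOfLE (leOfHom h) ≫ gU U = gU V := by
    intro U V h
    simp only [gU]
    rw [← Category.assoc, hp U V h, Category.assoc, colimit.w]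
  have hcompat : ∀ U V : J, pullback.fst U.1.ι V.1.ι ≫ gU U = pullback.snd U.1.ι V.1.ι ≫ gU V := by
    intro U V
    let l : J := ⟨U.1 ⊓ V.1, hinf _ U.2 _ V.2⟩
    have hle1 : l ≤ U := (fun _ hx => hx.1 : U.1 ⊓ V.1 ≤ U.1)
    let f1 : l ⟶ U := homOfLE hle1
    have hle2 : l ≤ V := (fun _ hx => hx.2 : U.1 ⊓ V.1 ≤ V.1)
    let f2 : l ⟶ V := homOfLE hle2
    let a : pullback U.1.ι V.1.ι ⟶ l.1.toScheme :=
      IsOpenImmersion.lift l.1.ι (pullback.fst U.1.ι V.1.ι ≫ U.1.ι) (by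
        rintro _ ⟨z, rfl⟩
        rw [Scheme.Opens.range_ι]
        refine ⟨?_, ?_⟩
        · rw [Scheme.Hom.comp_apply]; exact (pullback.fst U.1.ι V.1.ι z).2
        · rw [pullback.condition, Scheme.Hom.comp_apply]; exact (pullback.snd U.1.ι V.1.ι z).2)
    have a0 : a ≫ l.1.ι = pullback.fst U.1.ι V.1.ι ≫ U.1.ι := IsOpenImmersion.lift_fac _ _ _
    have a1 : a ≫ X.homOfLE (leOfHom f1) = pullback.fst U.1.ι V.1.ι := by
      rw [← cancel_mono U.1.ι, Category.assoc, Scheme.homOfLE_ι, a0]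
    have a2 : a ≫ X.homOfLE (leOfHom f2) = pullback.snd U.1.ι V.1.ι := by
      rw [← cancel_mono V.1.ι, Category.assoc, Scheme.homOfLE_ι, a0,
        pullback.condition]
    rw [← a1, ← a2, Category.assoc, Category.assoc, hg U l f1, hg V l f2]
  let π : X ⟶ Y := 𝒰.glueMorphisms gU hcompat
  have hπ : ∀ U : J, U.1.ι ≫ π = p U ≫ colimit.ι G U := fun U => 𝒰.ι_glueMorphisms gU hcompat U
  have hnat : ∀ (i j : J) (h : i ⟶ j),
      G.map h ≫ q j = q i ≫ ((Functor.const J).obj S).map h := by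
    intro i j h; simp [hq]
  let s : Y ⟶ S := colimit.desc G { pt := S, ι := { app := q, naturality := hnat } }
  have hs : ∀ U, colimit.ι G U ≫ s = q U := fun U => by simp [s]
  have hcomm : π ≫ s = f ≫ σ := by
    have this : ∀ U : J, U.1.ι ≫ π ≫ s = U.1.ι ≫ f ≫ σ := by
      intro U
      rw [← Category.assoc, hπ, Category.assoc, hs, (hpb U).w, Category.assoc]
    apply 𝒰.hom_ext
    intro U
    exact this U
  -- preimages
  have hpre : ∀ (U : J) (x : X) (y : G.obj U), π x = colimit.ι G U y → x ∈ U.1 := by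
    intro U x y hxy
    obtain ⟨V, hV, hx⟩ := hcov x
    let V' : J := ⟨V, hV⟩
    let x' : V'.1.toScheme := ⟨x, hx⟩
    have e : π x = colimit.ι G V' (p V' x') := by
      rw [← Scheme.Hom.comp_apply, ← hπ, Scheme.Hom.comp_apply]; rfl
    rw [e] at hxy
    obtain ⟨k, fi, fj, w, hw1, hw2⟩ := (Scheme.IsLocallyDirected.ι_eq_ι_iff G).1 hxy
    obtain ⟨z, hz, -⟩ := hmem fi x' w hw1.symm
    have : x = k.1.ι z := by
      have : V'.1.ι x' = k.1.ι z := by rw [← hz, ← Scheme.Hom.comp_apply]; simp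
      exact this
    rw [this]
    exact (leOfHom fj) z.2
  have sq1 : ∀ U : J, IsPullback U.1.ι (p U) π (colimit.ι G U) := by
    intro U
    have hr : ∀ t : PullbackCone π (colimit.ι G U), Set.range t.fst ⊆ Set.range U.1.ι := by
      rintro t _ ⟨z, rfl⟩
      rw [Scheme.Opens.range_ι]
      apply hpre U _ (t.snd z)
      rw [← Scheme.Hom.comp_apply, ← Scheme.Hom.comp_apply, t.condition]
    have hl : ∀ t : PullbackCone π (colimit.ι G U),
        IsOpenImmersion.lift U.1.ι t.fst (hr t) ≫ U.1.ι = t.fst :=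
      fun t => IsOpenImmersion.lift_fac _ _ _
    refine ⟨⟨hπ U⟩, ⟨PullbackCone.IsLimit.mk _ (fun t => IsOpenImmersion.lift U.1.ι t.fst (hr t))
      hl ?_ ?_⟩⟩
    · intro t
      rw [← cancel_mono (colimit.ι G U), Category.assoc, ← hπ, ← Category.assoc,
        hl, t.condition]
    · intro t m h1 h2
      rw [← cancel_mono U.1.ι, h1, hl]
  refine ⟨Y, π, s, ?_⟩
  obtain ⟨r, r1, r2⟩ : ∃ r : X ⟶ pullback s σ, r ≫ pullback.fst s σ = π ∧ r ≫ pullback.snd s σ = f :=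
    ⟨pullback.lift π f hcomm, pullback.lift_fst _ _ _, pullback.lift_snd _ _ _⟩
  suffices hr : IsIso r by
    exact IsPullback.of_iso_pullback ⟨hcomm⟩ (asIso r) r1 r2
  let 𝒱 : (pullback s σ).OpenCover := (Scheme.IsLocallyDirected.openCover G).pullback₁ (pullback.fst s σ)
  have key : (MorphismProperty.isomorphisms Scheme.{0}) r := by
    rw [IsZariskiLocalAtTarget.iff_of_openCover (P := MorphismProperty.isomorphisms Scheme.{0}) 𝒱]
    suffices key2 : ∀ U : J, MorphismProperty.isomorphisms Scheme.{0}
        (pullback.snd r (pullback.fst (pullback.fst s σ) (colimit.ι G U))) from fun U => key2 U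
    intro U
    let b : pullback (pullback.fst s σ) (colimit.ι G U) ⟶ pullback s σ := pullback.fst _ _
    change MorphismProperty.isomorphisms Scheme.{0} (pullback.snd r b)
    have right : IsPullback b (pullback.snd (pullback.fst s σ) (colimit.ι G U)) (pullback.fst s σ)
      (colimit.ι G U) := IsPullback.of_hasPullback _ _
    obtain ⟨u, u1, u2⟩ : ∃ u : U.1.toScheme ⟶ pullback (pullback.fst s σ) (colimit.ι G U),
        u ≫ b = U.1.ι ≫ r ∧ u ≫ pullback.snd (pullback.fst s σ) (colimit.ι G U) = p U :=
      ⟨pullback.lift (U.1.ι ≫ r) (p U) (by rw [Category.assoc, r1, hπ]), pullback.lift_fst _ _ _,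
        pullback.lift_snd _ _ _⟩
    have left : IsPullback U.1.ι u r b := by
      have : IsPullback (u ≫ pullback.snd (pullback.fst s σ) (colimit.ι G U)) U.1.ι
          (colimit.ι G U) (r ≫ pullback.fst s σ) := by
        rw [u2, r1]; exact (sq1 U).flip
      exact (IsPullback.of_right this u1 right.flip).flip
    have big : IsPullback (pullback.snd (pullback.fst s σ) (colimit.ι G U)) (b ≫ pullback.snd s σ)
        (q U) σ := by
      have := IsPullback.paste_vert right.flip (IsPullback.of_hasPullback s σ)
      rw [hs U] at this
      exact this
    have hu : IsIso u := by
      have e : u = (IsPullback.isoIsPullback _ _ (hpb U) big).hom := by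
        apply big.hom_ext
        · rw [u2]; simp
        · rw [← Category.assoc, u1, Category.assoc, r2]; simp
      rw [e]; infer_instance
    have : pullback.snd r b = (left.flip.flip.isoPullback).inv ≫ u := by simp
    rw [this]
    exact (MorphismProperty.isomorphisms.iff _).2 inferInstance
  exact key

end AVProof

namespace AVProof

theorem form_alg (F R : Type) [Field F] [CommRing R] [Algebra F R] [Algebra.FinitePresentation F R] :
    ∃ (v : Set R) (C : Set F), v.Finite ∧ C.Finite ∧ Algebra.adjoin F v = ⊤ ∧
      ∀ (K : Type) [Field K] [Algebra K F] [Algebra K R] [IsScalarTower K F R],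
        C ⊆ Set.range (algebraMap K F) →
        IsBaseChange F ((Algebra.adjoin K v).val.toLinearMap) := by
  obtain ⟨n, m, ⟨P⟩⟩ := Algebra.Presentation.exists_presentation_fin F R
  refine ⟨Set.range P.val, P.coeffs, Set.finite_range _, P.finite_coeffs, ?_, ?_⟩
  · rw [Algebra.adjoin_range_eq_range_aeval]
    exact (AlgHom.range_eq_top _).2 fun x => ⟨P.σ x, P.aeval_val_σ x⟩
  · intro K _ _ _ _ hC
    have : P.HasCoeffs K := ⟨hC⟩
    let e := P.tensorModelOfHasCoeffsEquiv K
    let j : P.ModelOfHasCoeffs K →ₐ[K] R :=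
      (e.toAlgHom.restrictScalars K).comp Algebra.TensorProduct.includeRight
    have hj : Function.Injective j := by
      refine e.injective.comp ?_
      exact Algebra.TensorProduct.includeRight_injective (algebraMap K F).injective
    have hval : ∀ y : MvPolynomial (Fin n) K, j (Ideal.Quotient.mk _ y) = MvPolynomial.aeval P.val y := by
      intro y
      change e (1 ⊗ₜ _) = _
      erw [P.tensorModelOfHasCoeffsEquiv_tmul K]
      simp
    have hrange : j.range = Algebra.adjoin K (Set.range P.val) := by
      rw [Algebra.adjoin_range_eq_range_aeval]
      ext x
      constructor
      · rintro ⟨y, rfl⟩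
        obtain ⟨y, rfl⟩ := Ideal.Quotient.mk_surjective y
        exact ⟨y, (hval y).symm⟩
      · rintro ⟨y, rfl⟩
        exact ⟨Ideal.Quotient.mk _ y, hval y⟩
    rw [← hrange]
    let e2 : P.ModelOfHasCoeffs K ≃ₐ[K] j.range := AlgEquiv.ofInjective j hj
    refine IsBaseChange.of_equiv ((e2.symm.toLinearEquiv.baseChange K F _ _).trans e.toLinearEquiv) ?_
    intro x
    obtain ⟨y, rfl⟩ := e2.surjective x
    change e (1 ⊗ₜ (e2.symm (e2 y))) = j y
    rw [e2.symm_apply_apply]; rfl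

theorem mem_adjoin_fin (F R : Type) [Field F] [CommRing R] [Algebra F R] (v : Set R)
    (hv : Algebra.adjoin F v = ⊤) (x : R) :
    ∃ C : Set F, C.Finite ∧ ∀ (K : Type) [Field K] [Algebra K F] [Algebra K R] [IsScalarTower K F R],
        C ⊆ Set.range (algebraMap K F) → x ∈ Algebra.adjoin K v := by
  have hx : x ∈ Algebra.adjoin F (Set.range (Subtype.val : v → R)) := by
    rw [Subtype.range_coe, hv]; trivial
  rw [Algebra.adjoin_range_eq_range_aeval] at hx
  obtain ⟨p, hp⟩ := hx
  refine ⟨p.coeffs, Finset.finite_toSet _, ?_⟩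
  intro K _ _ _ _ hC
  obtain ⟨p', rfl⟩ := MvPolynomial.mem_range_map_iff_coeffs_subset.2 hC
  have : x ∈ Algebra.adjoin K (Set.range (Subtype.val : v → R)) := by
    rw [Algebra.adjoin_range_eq_range_aeval]
    refine ⟨p', ?_⟩
    rw [← hp]
    exact (MvPolynomial.aeval_map_algebraMap F _ _).symm
  rwa [Subtype.range_coe] at this

end AVProof

namespace AVProof

lemma pb_local (K F R : Type) [Field K] [Field F] [CommRing R] [Algebra K F] [Algebra F R] [Algebra K R]
    [IsScalarTower K F R] (B : Subalgebra K R) (h : IsBaseChange F B.val.toLinearMap) :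
    IsPullback (Spec.map (CommRingCat.ofHom B.subtype))
      (Spec.map (CommRingCat.ofHom (algebraMap F R)))
      (Spec.map (CommRingCat.ofHom (algebraMap K B)))
      (Spec.map (CommRingCat.ofHom (algebraMap K F))) := by
  have : Algebra.IsPushout K F B R := ⟨h⟩
  have := CommRingCat.isPushout_of_isPushout K F B R
  exact (isPullback_SpecMap_of_isPushout _ _ _ _ this).flip

lemma ffq_field (K F : Type) [Field K] [Field F] [Algebra K F] :
    FFQ (Spec.map (CommRingCat.ofHom (algebraMap K F))) := by
  refine ⟨⟨?_, ?_⟩, inferInstance⟩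
  · constructor
    intro x
    have : Subsingleton (Spec (CommRingCat.of K)) :=
      inferInstanceAs (Subsingleton (PrimeSpectrum K))
    have : Nonempty (Spec (CommRingCat.of F)) := inferInstanceAs (Nonempty (PrimeSpectrum F))
    exact ⟨Classical.arbitrary _, Subsingleton.elim _ _⟩
  · refine (Flat.SpecMap_iff).2 ?_
    rw [CommRingCat.hom_ofHom, RingHom.flat_algebraMap_iff]
    infer_instance

/-- structure map to sections -/
noncomputable def strMap {X : Scheme.{0}} {R : CommRingCat.{0}} (f : X ⟶ Spec R) (U : X.Opens) :
    R ⟶ Γ(X, U) :=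
  (Scheme.ΓSpecIso R).inv ≫ f.appTop ≫ X.presheaf.map (homOfLE le_top).op

lemma strMap_map {X : Scheme.{0}} {R : CommRingCat.{0}} (f : X ⟶ Spec R) {U V : X.Opens} (h : V ≤ U) :
    strMap f U ≫ X.presheaf.map (homOfLE h).op = strMap f V := by
  simp only [strMap, Category.assoc, ← X.presheaf.map_comp]
  rfl

lemma toSpecΓ_strMap {X : Scheme.{0}} {R : CommRingCat.{0}} (f : X ⟶ Spec R) (U : X.Opens) :
    U.toSpecΓ ≫ Spec.map (strMap f U) = U.ι ≫ f := by
  rw [strMap, Spec.map_comp, Spec.map_comp, Category.assoc,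
    Scheme.Opens.toSpecΓ_SpecMap_presheaf_map_top_assoc,
    ← Scheme.toSpecΓ_naturality_assoc, toSpecΓ_SpecMap_ΓSpecIso_inv]
  simp

lemma strMap_fp {X : Scheme.{0}} {R : CommRingCat.{0}} (f : X ⟶ Spec R) [LocallyOfFinitePresentation f]
    {U : X.Opens} (hU : IsAffineOpen U) : (strMap f U).hom.FinitePresentation := by
  have h1 := f.finitePresentation_appLE (isAffineOpen_top _) hU le_top
  have h2 : strMap f U = (Scheme.ΓSpecIso R).inv ≫ f.appLE ⊤ U le_top := by
    rfl
  rw [h2, CommRingCat.hom_comp]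
  refine h1.comp (RingHom.FinitePresentation.of_bijective ?_)
  exact ConcreteCategory.bijective_of_isIso (Scheme.ΓSpecIso R).inv

lemma exists_J (X : Scheme.{0}) [CompactSpace X]
    (haff : ∀ U V : X.Opens, IsAffineOpen U → IsAffineOpen V → IsAffineOpen (U ⊓ V)) :
    ∃ J : Set X.Opens, J.Finite ∧ (∀ U ∈ J, IsAffineOpen U) ∧ (∀ U ∈ J, ∀ V ∈ J, U ⊓ V ∈ J) ∧
      (∀ x : X, ∃ U ∈ J, x ∈ U) := by
  let 𝒰 := X.affineCover.finiteSubcover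
  let s : Set X.Opens := Set.range (fun i : 𝒰.I₀ => (𝒰.f i).opensRange)
  refine ⟨infClosure s, ?_, ?_, ?_, ?_⟩
  · exact (Set.finite_range _).infClosure
  · intro U hU
    have h1 : s ⊆ {U : X.Opens | IsAffineOpen U} := by
      rintro _ ⟨i, rfl⟩
      have : IsAffine (𝒰.X i) := by dsimp [𝒰]; infer_instance
      exact isAffineOpen_opensRange _
    have h2 : InfClosed {U : X.Opens | IsAffineOpen U} := fun U hU V hV => haff U V hU hV
    exact infClosure_min h1 h2 hU
  · exact fun U hU V hV => infClosed_infClosure hU hV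
  · intro x
    exact ⟨_, subset_infClosure ⟨𝒰.idx x, rfl⟩, 𝒰.covers x⟩

theorem scheme_form (F : Type) [Field F] (X : Scheme.{0}) (f : X ⟶ Spec (CommRingCat.of F))
    [IsSeparated f] [CompactSpace X] [LocallyOfFinitePresentation f] :
    ∃ C : Set F, C.Finite ∧ ∀ (K : Type) [Field K] [Algebra K F], C ⊆ Set.range (algebraMap K F) →
      ∃ (Y : Scheme.{0}) (π : X ⟶ Y) (s : Y ⟶ Spec (CommRingCat.of K)),
        IsPullback π f s (Spec.map (CommRingCat.ofHom (algebraMap K F))) := by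
  have haff : ∀ U V : X.Opens, IsAffineOpen U → IsAffineOpen V → IsAffineOpen (U ⊓ V) := by
    have : IsAffineHom (pullback.diagonal f) := inferInstance
    intro U V hU hV
    exact isAffineHom_diagonal_iff.1 this ⊤ (isAffineOpen_top _) U le_top V le_top hU hV
  obtain ⟨J, hJ, hJaff, hinf, hcov⟩ := exists_J X haff
  letI alg : ∀ U : X.Opens, Algebra F Γ(X, U) := fun U => (strMap f U).hom.toAlgebra
  have hfp : ∀ U : J, Algebra.FinitePresentation F Γ(X, U.1) := fun U => strMap_fp f (hJaff _ U.2)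
  choose v C hv hC htop hbc using fun U : J => form_alg F Γ(X, U.1)
  have hmem := fun (V : J) (x : Γ(X, V.1)) => mem_adjoin_fin F Γ(X, V.1) (v V) (htop V) x
  choose D hD hDmem using hmem
  have : Finite J := hJ
  let Cs : Set F := (⋃ U, C U) ∪ ⋃ (U : J) (V : {V : J // V ≤ U}) (x : v U),
    D V.1 (X.presheaf.map (homOfLE (show V.1.1 ≤ U.1 from V.2)).op x.1)
  refine ⟨Cs, ?_, ?_⟩
  · refine (Set.finite_iUnion hC).union (Set.finite_iUnion fun U => Set.finite_iUnion fun V => ?_)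
    have : Finite (v U) := hv U
    exact Set.finite_iUnion fun x => hD _ _
  intro K _ _ hK
  letI algK : ∀ U : X.Opens, Algebra K Γ(X, U) := fun U =>
    ((strMap f U).hom.comp (algebraMap K F)).toAlgebra
  have tow : ∀ U : X.Opens, IsScalarTower K F Γ(X, U) := fun U => IsScalarTower.of_algebraMap_eq' rfl
  let B : ∀ U : J, Subalgebra K Γ(X, U.1) := fun U => Algebra.adjoin K (v U)
  let ρ : ∀ {U V : J} (h : V ⟶ U), Γ(X, U.1) →ₐ[K] Γ(X, V.1) := fun {U V} h =>
    { (X.presheaf.map (homOfLE (show V.1 ≤ U.1 from leOfHom h)).op).hom with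
      commutes' := fun r => by
        change (X.presheaf.map (homOfLE (show V.1 ≤ U.1 from leOfHom h)).op) (strMap f U.1 (algebraMap K F r)) = _
        rw [← CommRingCat.comp_apply, strMap_map]; rfl }
  have hρ : ∀ {U V : J} (h : V ⟶ U), ∀ x ∈ B U, ρ h x ∈ B V := by
    intro U V h x hx
    suffices B U ≤ (B V).comap (ρ h) from this hx
    refine Algebra.adjoin_le fun y hy => ?_
    change ρ h y ∈ B V
    refine hDmem V _ K (Set.Subset.trans ?_ hK)
    refine Set.Subset.trans ?_ Set.subset_union_right
    intro z hz
    exact Set.mem_iUnion.2 ⟨U, Set.mem_iUnion.2 ⟨⟨V, leOfHom h⟩, Set.mem_iUnion.2 ⟨⟨y, hy⟩, hz⟩⟩⟩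
  let r : ∀ {U V : J} (h : V ⟶ U), B U →+* B V := fun {U V} h =>
    ((ρ h).toRingHom.comp (B U).subtype).codRestrict (B V) (fun x => hρ h _ x.2)
  let G : J ⥤ Scheme.{0} :=
    { obj := fun U => Spec (CommRingCat.of (B U))
      map := fun h => Spec.map (CommRingCat.ofHom (r h))
      map_id := by
        intro U
        rw [← Spec.map_id]
        congr 1
        ext x
        change X.presheaf.map (𝟙 (Opposite.op U.1)) x.1 = x.1
        rw [X.presheaf.map_id]; rfl
      map_comp := by
        intro U V W g h
        rw [← Spec.map_comp]
        congr 1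
        ext x
        change X.presheaf.map _ x.1 = X.presheaf.map _ (X.presheaf.map _ x.1)
        rw [← CommRingCat.comp_apply, ← X.presheaf.map_comp]; rfl }
  let p : ∀ U : J, U.1.toScheme ⟶ G.obj U := fun U =>
    U.1.toSpecΓ ≫ Spec.map (CommRingCat.ofHom (B U).subtype)
  let q : ∀ U : J, G.obj U ⟶ Spec (CommRingCat.of K) := fun U =>
    Spec.map (CommRingCat.ofHom (algebraMap K (B U)))
  refine glue_form (Spec.map (CommRingCat.ofHom (algebraMap K F))) ?_ f J hinf hcov G p ?_ q ?_ ?_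
  · exact ffq_field K F
  · intro U V h
    change _ ≫ U.1.toSpecΓ ≫ Spec.map _ = (V.1.toSpecΓ ≫ Spec.map _) ≫ Spec.map _
    rw [← Scheme.Opens.toSpecΓ_SpecMap_presheaf_map_assoc, Category.assoc, ← Spec.map_comp,
      ← Spec.map_comp]
    rfl
  · intro U V h
    change Spec.map _ ≫ Spec.map _ = Spec.map _
    rw [← Spec.map_comp]
    congr 1
    ext x
    exact (ρ h).commutes x
  · intro U
    have h1 := pb_local K F Γ(X, U.1) (B U) (hbc U K (Set.Subset.trans (fun x hx =>
      Or.inl (Set.mem_iUnion.2 ⟨U, hx⟩)) hK))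
    have h2 : U.1.ι ≫ f = U.1.toSpecΓ ≫ Spec.map (CommRingCat.ofHom (algebraMap F Γ(X, U.1))) :=
      (toSpecΓ_strMap f U.1).symm
    rw [h2]
    have : IsIso U.1.toSpecΓ := (hJaff U.1 U.2).isoSpec.isIso_hom
    exact IsPullback.of_iso h1 (asIso U.1.toSpecΓ).symm (Iso.refl _) (Iso.refl _) (Iso.refl _)
      (by simp [p]) (by simp) (by simp [q, G]) (by simp)

end AVProof

namespace AVProof

section
variable {K F : Type} [Field K] [Field F] [Algebra K F] (S : Finset F → IntermediateField K F)

/-- Spec of the base-field inclusion -/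
noncomputable def gmap (C : Finset F) : Spec (CommRingCat.of (S C)) ⟶ Spec (CommRingCat.of K) :=
  Spec.map (CommRingCat.ofHom (algebraMap K (S C)))

noncomputable def smap (C : Finset F) : Spec (CommRingCat.of F) ⟶ Spec (CommRingCat.of (S C)) :=
  Spec.map (CommRingCat.ofHom (algebraMap (S C) F))

variable (K F) in
noncomputable def sig : Spec (CommRingCat.of F) ⟶ Spec (CommRingCat.of K) :=
  Spec.map (CommRingCat.ofHom (algebraMap K F))

lemma smap_gmap (C : Finset F) : smap S C ≫ gmap S C = sig K F := by
  rw [smap, gmap, ← Spec.map_comp]; rfl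

noncomputable def rmap (hS : Monotone S) {C D : Finset F} (h : C ≤ D) :
    CommRingCat.of (S C) ⟶ CommRingCat.of (S D) :=
  CommRingCat.ofHom (IntermediateField.inclusion (hS h)).toRingHom

/-- The functor of intermediate fields. -/
noncomputable def Rfun (hS : Monotone S) : Finset F ⥤ CommRingCat.{0} where
  obj C := CommRingCat.of (S C)
  map {C D} h := rmap S hS (leOfHom h)
  map_id C := by ext x; rfl
  map_comp f g := by ext x; rfl

noncomputable def Rcocone (hS : Monotone S) : Cocone (Rfun S hS) where
  pt := CommRingCat.of F
  ι := { app := fun C => CommRingCat.ofHom (algebraMap (S C) F)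
         naturality := by intros; ext x; rfl }

noncomputable def Rcolim (hS : Monotone S) (hmem : ∀ C : Finset F, ∀ x ∈ C, x ∈ S C) :
    IsColimit (Rcocone S hS) := by
  classical
  have key : ∀ (s : Cocone (Rfun S hS)) (C D : Finset F) (x : F)
      (h1 : x ∈ S C) (h2 : x ∈ S D),
      s.ι.app C ⟨x, h1⟩ = s.ι.app D ⟨x, h2⟩ := by
    intro s C D x h1 h2
    have e1 := congr($(s.w (homOfLE (Finset.subset_union_left : C ⊆ C ∪ D))) ⟨x, h1⟩)
    have e2 := congr($(s.w (homOfLE (Finset.subset_union_right : D ⊆ C ∪ D))) ⟨x, h2⟩)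
    rw [← e1, ← e2]; rfl
  let d : ∀ s : Cocone (Rfun S hS), F →+* s.pt := fun s =>
    { toFun := fun x => s.ι.app {x} ⟨x, hmem _ _ (by simp)⟩
      map_one' := by
        exact map_one (s.ι.app {1}).hom
      map_zero' := by
        exact map_zero (s.ι.app {0}).hom
      map_mul' := by
        intro x y
        rw [key s {x} {x, y} x _ (hmem _ _ (by simp)), key s {y} {x, y} y _ (hmem _ _ (by simp)),
          key s {x * y} {x, y} (x * y) _ (mul_mem (hmem _ _ (by simp)) (hmem _ _ (by simp)))]
        exact map_mul (s.ι.app {x, y}).hom ⟨x, _⟩ ⟨y, _⟩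
      map_add' := by
        intro x y
        rw [key s {x} {x, y} x _ (hmem _ _ (by simp)), key s {y} {x, y} y _ (hmem _ _ (by simp)),
          key s {x + y} {x, y} (x + y) _ (add_mem (hmem _ _ (by simp)) (hmem _ _ (by simp)))]
        exact map_add (s.ι.app {x, y}).hom ⟨x, _⟩ ⟨y, _⟩ }
  exact
  { desc := fun s => CommRingCat.ofHom (d s)
    fac := by
      intro s C
      ext x
      exact key s _ C x.1 _ x.2
    uniq := by
      intro s m hm
      ext (x : F)
      exact congr($(hm ({x} : Finset F)) ⟨x, hmem _ _ (Finset.mem_singleton_self x)⟩) }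

noncomputable def Scone (hS : Monotone S) : Cone ((Rfun S hS).op ⋙ Scheme.Spec) :=
  Scheme.Spec.mapCone (Rcocone S hS).op

noncomputable def Slim (hS : Monotone S) (hmem : ∀ C : Finset F, ∀ x ∈ C, x ∈ S C) :
    IsLimit (Scone S hS) := isLimitOfPreserves Scheme.Spec (Rcolim S hS hmem).op

lemma map_gmap (hS : Monotone S) {C D : Finset F} (h : C ≤ D) :
    Spec.map (rmap S hS h) ≫ gmap S C = gmap S D := by
  rw [gmap, ← Spec.map_comp]; rfl

lemma smap_map (hS : Monotone S) {C D : Finset F} (h : C ≤ D) :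
    smap S D ≫ Spec.map (rmap S hS h) = smap S C := by
  rw [smap, ← Spec.map_comp]; rfl

section
variable {T : Scheme.{0}} (t : T ⟶ Spec (CommRingCat.of K))

noncomputable def pmap (hS : Monotone S) {C D : Finset F} (h : C ≤ D) :
    pullback t (gmap S D) ⟶ pullback t (gmap S C) :=
  pullback.lift (pullback.fst _ _) (pullback.snd _ _ ≫ Spec.map (rmap S hS h))
    (by rw [Category.assoc, map_gmap, pullback.condition])

noncomputable def cmap (C : Finset F) : pullback t (sig K F) ⟶ pullback t (gmap S C) :=
  pullback.lift (pullback.fst _ _) (pullback.snd _ _ ≫ smap S C)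
    (by rw [Category.assoc, smap_gmap, pullback.condition])

lemma pmap_fst (hS : Monotone S) {C D : Finset F} (h : C ≤ D) :
    pmap S t hS h ≫ pullback.fst _ _ = pullback.fst _ _ := pullback.lift_fst _ _ _
lemma pmap_snd (hS : Monotone S) {C D : Finset F} (h : C ≤ D) :
    pmap S t hS h ≫ pullback.snd _ _ = pullback.snd _ _ ≫ Spec.map (rmap S hS h) :=
  pullback.lift_snd _ _ _
lemma cmap_fst (C : Finset F) : cmap S t C ≫ pullback.fst _ _ = pullback.fst _ _ :=
  pullback.lift_fst _ _ _
lemma cmap_snd (C : Finset F) : cmap S t C ≫ pullback.snd _ _ = pullback.snd _ _ ≫ smap S C :=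
  pullback.lift_snd _ _ _

lemma pmap_fst_assoc (hS : Monotone S) {C D : Finset F} (h : C ≤ D) {Z : Scheme} (k : T ⟶ Z) :
    pmap S t hS h ≫ pullback.fst _ _ ≫ k = pullback.fst _ _ ≫ k := by
  rw [← Category.assoc, pmap_fst]
lemma pmap_snd_assoc (hS : Monotone S) {C D : Finset F} (h : C ≤ D) {Z : Scheme}
    (k : Spec (CommRingCat.of (S C)) ⟶ Z) :
    pmap S t hS h ≫ pullback.snd _ _ ≫ k =
      pullback.snd _ _ ≫ Spec.map (rmap S hS h) ≫ k := by
  rw [← Category.assoc, pmap_snd, Category.assoc]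
lemma cmap_fst_assoc (C : Finset F) {Z : Scheme} (k : T ⟶ Z) :
    cmap S t C ≫ pullback.fst _ _ ≫ k = pullback.fst _ _ ≫ k := by
  rw [← Category.assoc, cmap_fst]
lemma cmap_snd_assoc (C : Finset F) {Z : Scheme} (k : Spec (CommRingCat.of (S C)) ⟶ Z) :
    cmap S t C ≫ pullback.snd _ _ ≫ k = pullback.snd _ _ ≫ smap S C ≫ k := by
  rw [← Category.assoc, cmap_snd, Category.assoc]

lemma cmap_pmap (hS : Monotone S) {C D : Finset F} (h : C ≤ D) :
    cmap S t D ≫ pmap S t hS h = cmap S t C := by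
  apply pullback.hom_ext
  · rw [Category.assoc, pmap_fst, cmap_fst, cmap_fst]
  · rw [Category.assoc, pmap_snd, cmap_snd_assoc, smap_map, cmap_snd]

noncomputable def Dfun (hS : Monotone S) : (Finset F)ᵒᵖ ⥤ Scheme.{0} where
  obj C := pullback t (gmap S C.unop)
  map {C D} h := pmap S t hS (leOfHom h.unop)
  map_id C := by
    apply pullback.hom_ext
    · rw [pmap_fst]; exact (Category.id_comp _).symm
    · rw [pmap_snd]
      have : rmap S hS (leOfHom (𝟙 C : C ⟶ C).unop) = 𝟙 _ := by ext x; rfl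
      rw [this, Spec.map_id]
      exact (Category.comp_id _).trans (Category.id_comp _).symm
  map_comp {C D E} f g := by
    apply pullback.hom_ext
    · rw [pmap_fst, Category.assoc, pmap_fst, pmap_fst]
    · rw [pmap_snd, Category.assoc, pmap_snd, pmap_snd_assoc, ← Spec.map_comp]; rfl

noncomputable def Dcone (hS : Monotone S) : Cone (Dfun S t hS) where
  pt := pullback t (sig K F)
  π := { app := fun C => cmap S t C.unop
         naturality := by
          intro C E h
          exact (Category.id_comp _).trans (cmap_pmap S t hS (leOfHom h.unop)).symm }

noncomputable def Dlim (hS : Monotone S) (hmem : ∀ C : Finset F, ∀ x ∈ C, x ∈ S C) :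
    IsLimit (Dcone S t hS) := by
  let pi : ∀ (s : Cone (Dfun S t hS)) (C : Finset F), s.pt ⟶ pullback t (gmap S C) :=
    fun s C => s.π.app (Opposite.op C)
  have hpi : ∀ (s : Cone (Dfun S t hS)) {C D : Finset F} (h : C ≤ D),
    pi s D ≫ pmap S t hS h = pi s C := fun s C D h => s.w (homOfLE h).op
  have hpi2 : ∀ (s : Cone (Dfun S t hS)) {C D : Finset F} (h : C ≤ D),
    pi s C ≫ pullback.snd _ _ = (pi s D ≫ pullback.snd _ _) ≫ Spec.map (rmap S hS h) := by
    intro s C D h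
    rw [← hpi s h, Category.assoc, pmap_snd, Category.assoc]
  let sc : ∀ s : Cone (Dfun S t hS), Cone ((Rfun S hS).op ⋙ Scheme.Spec) := fun s =>
      { pt := s.pt
        π := { app := fun C => pi s C.unop ≫ pullback.snd _ _
               naturality := by
                intro C E h
                refine (Category.id_comp _).trans ?_
                exact hpi2 s (leOfHom h.unop) } }
  have hfst : ∀ (s : Cone (Dfun S t hS)) (C : Finset F), pi s C ≫ pullback.fst t (gmap S C) =
        pi s ∅ ≫ pullback.fst t (gmap S ∅) := by
      intro s C
      rw [← hpi s (Finset.empty_subset C), Category.assoc, pmap_fst]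
  let l : ∀ s : Cone (Dfun S t hS), s.pt ⟶ Spec (CommRingCat.of F) :=
    fun s => (Slim S hS hmem).lift (sc s)
  have hl : ∀ (s : Cone (Dfun S t hS)) (C : Finset F), l s ≫ smap S C = pi s C ≫ pullback.snd _ _ :=
      fun s C => (Slim S hS hmem).fac (sc s) (Opposite.op C)
  have hcond : ∀ s : Cone (Dfun S t hS), (pi s ∅ ≫ pullback.fst t (gmap S ∅)) ≫ t =
        l s ≫ sig K F := by
      intro s
      rw [← smap_gmap S ∅, ← Category.assoc, hl s, Category.assoc, Category.assoc,
        pullback.condition]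
  have huniq : ∀ (s : Cone (Dfun S t hS)) (m : s.pt ⟶ pullback t (sig K F)),
      (∀ C : Finset F, m ≫ cmap S t C = pi s C) → m = pullback.lift _ _ (hcond s) := by
    intro s m hm2
    apply pullback.hom_ext
    · rw [pullback.lift_fst, ← hm2, Category.assoc, cmap_fst]
    · rw [pullback.lift_snd]
      have h3 : ∀ C : Finset F, (m ≫ pullback.snd _ _) ≫ smap S C = l s ≫ smap S C := by
        intro C
        rw [hl, ← hm2, Category.assoc, Category.assoc, cmap_snd]
      exact (Slim S hS hmem).hom_ext fun C => h3 C.unop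
  exact
    { lift := fun s => pullback.lift _ _ (hcond s)
      fac := by
        intro s C
        change pullback.lift _ _ (hcond s) ≫ cmap S t C.unop = pi s C.unop
        apply pullback.hom_ext
        · rw [Category.assoc, cmap_fst, pullback.lift_fst]
          exact (hfst s C.unop).symm
        · rw [Category.assoc, cmap_snd, pullback.lift_snd_assoc]
          exact hl s C.unop
      uniq := fun s m hm => huniq s m fun C => hm (Opposite.op C) }

end

theorem descend_hom (hS : Monotone S) (hmem : ∀ C : Finset F, ∀ x ∈ C, x ∈ S C)
    {T Y : Scheme.{0}} (t : T ⟶ Spec (CommRingCat.of K)) (y : Y ⟶ Spec (CommRingCat.of K))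
    [CompactSpace T] [QuasiSeparatedSpace T] [LocallyOfFinitePresentation y]
    (c : pullback t (sig K F) ⟶ Y)
    (hc : c ≫ y = pullback.fst _ _ ≫ t) :
    ∃ C : Finset F, ∀ C' : Finset F, C ≤ C' → ∃ a : pullback t (gmap S C') ⟶ Y,
      a ≫ y = pullback.fst _ _ ≫ t ∧ cmap S t C' ≫ a = c := by
  let tt : Dfun S t hS ⟶ (Functor.const _).obj (Spec (CommRingCat.of K)) :=
    { app := fun C => pullback.fst t (gmap S C.unop) ≫ t
      naturality := by
        intro C E h
        refine Eq.trans ?_ (Category.comp_id _).symm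
        exact pmap_fst_assoc S t hS (leOfHom h.unop) t }
  have aff : ∀ C, IsAffineHom (gmap S C) := by intro C; unfold gmap; infer_instance
  have hfa : ∀ C : Finset F, IsAffineHom (pullback.fst t (gmap S C)) :=
    fun C => MorphismProperty.of_isPullback (P := @IsAffineHom) (IsPullback.of_hasPullback t (gmap S C)).flip (aff C)
  have i1 : ∀ {i j} (f : i ⟶ j), IsAffineHom ((Dfun S t hS).map f) := by
    intro i j f
    have h1 : IsAffineHom (pmap S t hS (leOfHom f.unop) ≫ pullback.fst t (gmap S j.unop)) := by
      rw [pmap_fst]; exact hfa _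
    have h2 : IsAffineHom (pullback.fst t (gmap S j.unop)) := hfa _
    exact IsAffineHom.of_comp (pmap S t hS (leOfHom f.unop)) (pullback.fst t (gmap S j.unop))
  have i2 : ∀ i, CompactSpace ((Dfun S t hS).obj i) := by
    intro i
    have h0 : IsAffineHom (pullback.fst t (gmap S i.unop)) := hfa i.unop
    have h1 : QuasiCompact (pullback.fst t (gmap S i.unop)) := inferInstance
    have h2 : CompactSpace ↥(pullback t (gmap S i.unop)) := QuasiCompact.compactSpace_of_compactSpace (pullback.fst t (gmap S i.unop))
    exact h2
  have i3 : ∀ i, QuasiSeparatedSpace ((Dfun S t hS).obj i) := by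
    intro i
    have h0 : IsAffineHom (pullback.fst t (gmap S i.unop)) := hfa i.unop
    have h1 : QuasiSeparated (pullback.fst t (gmap S i.unop)) := inferInstance
    have h2 : QuasiSeparatedSpace ↥(pullback t (gmap S i.unop)) := quasiSeparatedSpace_of_quasiSeparated (pullback.fst t (gmap S i.unop))
    exact h2
  obtain ⟨i, g', hg', hg2'⟩ := Scheme.exists_π_app_comp_eq_of_locallyOfFinitePresentation
    (Dfun S t hS) tt y (Dcone S t hS) (Dlim S t hS hmem) c (by
      ext C
      change cmap S t C.unop ≫ pullback.fst t (gmap S C.unop) ≫ t = c ≫ y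
      rw [cmap_fst_assoc, hc])
  obtain ⟨g, hg, hg2⟩ : ∃ g : pullback t (gmap S i.unop) ⟶ Y, cmap S t i.unop ≫ g = c ∧
      g ≫ y = pullback.fst t (gmap S i.unop) ≫ t := ⟨g', hg', hg2'⟩
  refine ⟨i.unop, fun C' hC' => ⟨pmap S t hS hC' ≫ g, ?_, ?_⟩⟩
  · rw [Category.assoc, hg2, pmap_fst_assoc]
  · rw [← hg, ← cmap_pmap S t hS hC', Category.assoc]

end

end AVProof

namespace AVProof

universe v u

/-- a commutative group functor structure on Hom(-, Y) -/
class GrpFun {C : Type u} [Category.{v} C] (Y : C) where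
  grp : ∀ T : C, AddCommGroup (T ⟶ Y)
  comp_add : ∀ {T T' : C} (f : T' ⟶ T) (a b : T ⟶ Y), f ≫ (a + b) = f ≫ a + f ≫ b

attribute [instance] GrpFun.grp

section
variable {C : Type u} [Category.{v} C] {Y : C} [GrpFun Y]

/-- precomposition as a homomorphism -/
def preHom {T T' : C} (f : T' ⟶ T) : (T ⟶ Y) →+ (T' ⟶ Y) :=
  AddMonoidHom.mk' (fun a => f ≫ a) (GrpFun.comp_add f)

lemma comp_add {T T' : C} (f : T' ⟶ T) (a b : T ⟶ Y) : f ≫ (a + b) = f ≫ a + f ≫ b :=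
  GrpFun.comp_add f a b
lemma comp_zero {T T' : C} (f : T' ⟶ T) : f ≫ (0 : T ⟶ Y) = 0 := map_zero (preHom f)
lemma comp_neg {T T' : C} (f : T' ⟶ T) (a : T ⟶ Y) : f ≫ (-a) = - (f ≫ a) := map_neg (preHom f) a
lemma comp_sub {T T' : C} (f : T' ⟶ T) (a b : T ⟶ Y) : f ≫ (a - b) = f ≫ a - f ≫ b :=
  map_sub (preHom f) a b
lemma comp_zsmul {T T' : C} (f : T' ⟶ T) (n : ℤ) (a : T ⟶ Y) : f ≫ (n • a) = n • (f ≫ a) :=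
  map_zsmul (preHom f) n a
lemma comp_sum {T T' : C} (f : T' ⟶ T) {ι : Type*} (s : Finset ι) (a : ι → (T ⟶ Y)) :
    f ≫ (∑ i ∈ s, a i) = ∑ i ∈ s, f ≫ a i := map_sum (preHom f) a s

/-- A morphism is an endomorphism of the group functor. -/
def IsHomm (φ : Y ⟶ Y) : Prop := ∀ (T : C) (a b : T ⟶ Y), (a + b) ≫ φ = a ≫ φ + b ≫ φ
end

section
universe v' u'
variable {C : Type u} [Category.{v} C] {D : Type u'} [Category.{v'} D] (L : C ⥤ D) [L.Faithful]
  {Y : C} {X : D} [GrpFun X] (e : L.obj Y ≅ X)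

theorem transport (T₂ : C) (p1 p2 m : T₂ ⟶ Y)
    (hl : ∀ (T : C) (a b : T ⟶ Y), ∃ l : T ⟶ T₂, l ≫ p1 = a ∧ l ≫ p2 = b)
    (hm : L.map m ≫ e.hom = L.map p1 ≫ e.hom + L.map p2 ≫ e.hom)
    (i : Y ⟶ Y) (hi : L.map i ≫ e.hom = - e.hom)
    (T₁ : C) (hT : ∀ T : C, Nonempty (T ⟶ T₁)) (z : T₁ ⟶ Y) (hz : L.map z ≫ e.hom = 0) :
    ∃ _ : GrpFun Y, ∀ (T : C) (a b : T ⟶ Y),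
      L.map (a + b) ≫ e.hom = L.map a ≫ e.hom + L.map b ≫ e.hom := by
  let bc : ∀ T : C, (T ⟶ Y) → (L.obj T ⟶ X) := fun T a => L.map a ≫ e.hom
  have inj : ∀ T, Function.Injective (bc T) := by
    intro T a b h
    exact L.map_injective ((cancel_mono e.hom).1 h)
  have bcc : ∀ {T T' : C} (f : T' ⟶ T) (a : T ⟶ Y), bc T' (f ≫ a) = L.map f ≫ bc T a := by
    intro T T' f a; simp [bc]
  let R : ∀ T, AddSubgroup (L.obj T ⟶ X) := fun T =>
    { carrier := Set.range (bc T)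
      add_mem' := by
        rintro _ _ ⟨a, rfl⟩ ⟨b, rfl⟩
        obtain ⟨l, rfl, rfl⟩ := hl T a b
        refine ⟨l ≫ m, ?_⟩
        rw [bcc, bcc, bcc, ← comp_add]
        exact congrArg _ hm
      zero_mem' := by
        obtain ⟨l⟩ := hT T
        exact ⟨l ≫ z, by rw [bcc, ← comp_zero (L.map l)]; exact congrArg _ hz⟩
      neg_mem' := by
        rintro _ ⟨a, rfl⟩
        refine ⟨a ≫ i, ?_⟩
        rw [bcc]
        change _ ≫ _ = - (_ ≫ _)
        rw [← comp_neg]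
        exact congrArg _ hi }
  let E : ∀ T, (T ⟶ Y) ≃ R T := fun T => Equiv.ofInjective _ (inj T)
  let grp : ∀ T, AddCommGroup (T ⟶ Y) := fun T => (E T).addCommGroup
  have hadd : ∀ T (a b : T ⟶ Y), bc T (a + b) = bc T a + bc T b := by
    intro T a b
    have h1 : E T (a + b) = E T a + E T b := Equiv.apply_symm_apply _ _
    exact congrArg Subtype.val h1
  refine ⟨⟨grp, ?_⟩, hadd⟩
  intro T T' f a b
  apply inj
  rw [bcc, hadd, hadd, bcc, bcc, comp_add]
end

end AVProof

namespace AVProof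

/-- base change of a morphism, plainly typed -/
noncomputable def pbm {A B T T' : Scheme.{0}} (σ : A ⟶ B) {t : T ⟶ B} {t' : T' ⟶ B} (f : T ⟶ T')
    (hf : f ≫ t' = t) : pullback t σ ⟶ pullback t' σ :=
  pullback.lift (pullback.fst _ _ ≫ f) (pullback.snd _ _) (by
    rw [Category.assoc, hf, pullback.condition])
lemma pbm_fst {A B T T' : Scheme.{0}} (σ : A ⟶ B) {t : T ⟶ B} {t' : T' ⟶ B} (f : T ⟶ T')
    (hf : f ≫ t' = t) : pbm σ f hf ≫ pullback.fst _ _ = pullback.fst _ _ ≫ f :=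
  pullback.lift_fst _ _ _
lemma pbm_snd {A B T T' : Scheme.{0}} (σ : A ⟶ B) {t : T ⟶ B} {t' : T' ⟶ B} (f : T ⟶ T')
    (hf : f ≫ t' = t) : pbm σ f hf ≫ pullback.snd _ _ = pullback.snd _ _ :=
  pullback.lift_snd _ _ _
lemma pbm_left {A B : Scheme.{0}} (σ : A ⟶ B) {T T' : Over B} (f : T ⟶ T') :
    ((Over.pullback σ).map f).left = pbm σ f.left (Over.w f) := rfl

section
variable {K F : Type} [Field K] [Field F] [Algebra K F] (S : Finset F → IntermediateField K F)

noncomputable def nuHom (C : Finset F) {T : Scheme.{0}} (t : T ⟶ Spec (CommRingCat.of K)) :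
    pullback (pullback.snd t (gmap S C)) (smap S C) ⟶ pullback t (sig K F) :=
  pullback.lift (pullback.fst _ _ ≫ pullback.fst _ _) (pullback.snd _ _) (by
    rw [Category.assoc, pullback.condition, pullback.condition_assoc, smap_gmap])

lemma nuHom_fst (C : Finset F) {T : Scheme.{0}} (t : T ⟶ Spec (CommRingCat.of K)) :
    nuHom S C t ≫ pullback.fst _ _ = pullback.fst _ _ ≫ pullback.fst _ _ := pullback.lift_fst _ _ _
lemma nuHom_snd (C : Finset F) {T : Scheme.{0}} (t : T ⟶ Spec (CommRingCat.of K)) :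
    nuHom S C t ≫ pullback.snd _ _ = pullback.snd _ _ := pullback.lift_snd _ _ _
lemma nuHom_cmap (C : Finset F) {T : Scheme.{0}} (t : T ⟶ Spec (CommRingCat.of K)) :
    nuHom S C t ≫ cmap S t C = pullback.fst _ _ := by
  apply pullback.hom_ext
  · rw [Category.assoc, cmap_fst, nuHom_fst]
  · rw [Category.assoc, cmap_snd, ← Category.assoc, nuHom_snd, pullback.condition]

noncomputable def nuInv (C : Finset F) {T : Scheme.{0}} (t : T ⟶ Spec (CommRingCat.of K)) :
    pullback t (sig K F) ⟶ pullback (pullback.snd t (gmap S C)) (smap S C) :=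
  pullback.lift (cmap S t C) (pullback.snd _ _) (cmap_snd S t C)
lemma nuInv_fst (C : Finset F) {T : Scheme.{0}} (t : T ⟶ Spec (CommRingCat.of K)) :
    nuInv S C t ≫ pullback.fst _ _ = cmap S t C := pullback.lift_fst _ _ _
lemma nuInv_snd (C : Finset F) {T : Scheme.{0}} (t : T ⟶ Spec (CommRingCat.of K)) :
    nuInv S C t ≫ pullback.snd _ _ = pullback.snd _ _ := pullback.lift_snd _ _ _

noncomputable def nuIso (C : Finset F) {T : Scheme.{0}} (t : T ⟶ Spec (CommRingCat.of K)) :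
    pullback (pullback.snd t (gmap S C)) (smap S C) ≅ pullback t (sig K F) where
  hom := nuHom S C t
  inv := nuInv S C t
  hom_inv_id := by
    apply pullback.hom_ext
    · rw [Category.assoc, nuInv_fst, nuHom_cmap, Category.id_comp]
    · rw [Category.assoc, nuInv_snd, nuHom_snd, Category.id_comp]
  inv_hom_id := by
    apply pullback.hom_ext
    · rw [Category.assoc, nuHom_fst, ← Category.assoc, nuInv_fst, cmap_fst, Category.id_comp]
    · rw [Category.assoc, nuHom_snd, nuInv_snd, Category.id_comp]

noncomputable def nu (C : Finset F) (T : Over (Spec (CommRingCat.of K))) :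
    (Over.pullback (smap S C)).obj ((Over.pullback (gmap S C)).obj T) ≅
      (Over.pullback (sig K F)).obj T :=
  Over.isoMk (nuIso S C T.hom) (nuHom_snd S C T.hom)

lemma nu_left (C : Finset F) (T : Over (Spec (CommRingCat.of K))) :
    (nu S C T).hom.left = nuHom S C T.hom := rfl

lemma nu_nat (C : Finset F) {T T' : Over (Spec (CommRingCat.of K))} (f : T ⟶ T') :
    (Over.pullback (smap S C)).map ((Over.pullback (gmap S C)).map f) ≫ (nu S C T').hom =
      (nu S C T).hom ≫ (Over.pullback (sig K F)).map f := by
  apply Over.OverMorphism.ext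
  have key : pbm (smap S C) (pbm (gmap S C) f.left (Over.w f)) (pbm_snd _ _ _) ≫ nuHom S C T'.hom =
      nuHom S C T.hom ≫ pbm (sig K F) f.left (Over.w f) := by
    apply pullback.hom_ext
    · rw [Category.assoc, nuHom_fst, ← Category.assoc, pbm_fst, Category.assoc,
        pbm_fst, Category.assoc, pbm_fst, ← Category.assoc, ← Category.assoc, nuHom_fst]
    · rw [Category.assoc, nuHom_snd, pbm_snd, Category.assoc, pbm_snd, nuHom_snd]
  exact key

theorem descend_over (hS : Monotone S) (hmem : ∀ C : Finset F, ∀ x ∈ C, x ∈ S C)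
    (T Y : Over (Spec (CommRingCat.of K)))
    [CompactSpace T.left] [QuasiSeparatedSpace T.left] [LocallyOfFinitePresentation Y.hom]
    (α : (Over.pullback (sig K F)).obj T ⟶ (Over.pullback (sig K F)).obj Y) :
    ∃ C : Finset F, ∀ C' : Finset F, C ≤ C' →
      ∃ a : (Over.pullback (gmap S C')).obj T ⟶ (Over.pullback (gmap S C')).obj Y,
      (Over.pullback (smap S C')).map a ≫ (nu S C' Y).hom = (nu S C' T).hom ≫ α := by
  obtain ⟨al, hal⟩ : ∃ al : pullback T.hom (sig K F) ⟶ pullback Y.hom (sig K F), al = α.left :=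
    ⟨_, rfl⟩
  have hw : al ≫ pullback.snd _ _ = pullback.snd _ _ := by rw [hal]; exact Over.w α
  obtain ⟨C, hC⟩ := descend_hom S hS hmem T.hom Y.hom (al ≫ pullback.fst _ _) (by
    rw [Category.assoc, pullback.condition, ← Category.assoc, hw, pullback.condition])
  refine ⟨C, fun C' hC' => ?_⟩
  obtain ⟨a, ha, ha2⟩ := hC C' hC'
  obtain ⟨l, hl1, hl2⟩ : ∃ l : pullback T.hom (gmap S C') ⟶ pullback Y.hom (gmap S C'),
      l ≫ pullback.fst _ _ = a ∧ l ≫ pullback.snd _ _ = pullback.snd _ _ :=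
    ⟨pullback.lift a (pullback.snd _ _) (by rw [ha, pullback.condition]),
      pullback.lift_fst _ _ _, pullback.lift_snd _ _ _⟩
  refine ⟨Over.homMk l hl2, ?_⟩
  apply Over.OverMorphism.ext
  have key : pbm (smap S C') l hl2 ≫ nuHom S C' Y.hom = nuHom S C' T.hom ≫ al := by
    apply pullback.hom_ext
    · rw [Category.assoc, nuHom_fst, ← Category.assoc, pbm_fst, Category.assoc,
        hl1, Category.assoc, ← ha2, ← Category.assoc, nuHom_cmap]
    · rw [Category.assoc, nuHom_snd, pbm_snd, Category.assoc, hw, nuHom_snd]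
  rw [hal] at key
  exact key

end

end AVProof

namespace AVProof

/-- universally closed as a morphism property -/
def UC : MorphismProperty Scheme.{0} := @UniversallyClosed

lemma diag_descend (P Q : MorphismProperty Scheme.{0}) [P.DescendsAlong Q] [P.RespectsIso]
    [Q.IsStableUnderBaseChange] {A B C D : Scheme.{0}} {a : A ⟶ B} {b : A ⟶ C} {c : B ⟶ D}
    {d : C ⟶ D} (h : IsPullback a b c d) (hd : Q d) (hb : P (pullback.diagonal b)) :
    P (pullback.diagonal c) :=
  MorphismProperty.of_isPullback_of_descendsAlong (P := MorphismProperty.diagonal P) (Q := Q)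
    h.flip hd hb

lemma isSep_descend {A B C D : Scheme.{0}} {a : A ⟶ B} {b : A ⟶ C} {c : B ⟶ D} {d : C ⟶ D}
    (h : IsPullback a b c d) (hd : FFQ d) [IsSeparated b] : IsSeparated c := by
  have i1 : UC.DescendsAlong FFQ :=
    inferInstanceAs (MorphismProperty.DescendsAlong @UniversallyClosed (@Surjective ⊓ @Flat ⊓ @QuasiCompact))
  have i2 : UC.RespectsIso := universallyClosed_respectsIso
  have i3 : FFQ.IsStableUnderBaseChange := by
    constructor
    intro X Y Y' S f g f' g' sq hg
    exact ffq_of_isPullback sq.flip hg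
  have hb : UniversallyClosed (pullback.diagonal b) := inferInstance
  have h2 : UniversallyClosed (pullback.diagonal c) := diag_descend UC FFQ h hd hb
  refine ⟨?_⟩
  rw [IsClosedImmersion.iff_isPreimmersion]
  refine ⟨inferInstance, ?_⟩
  rw [← Set.image_univ]
  exact (pullback.diagonal c).isClosedMap _ isClosed_univ

lemma isProper_descend {A B C D : Scheme.{0}} {a : A ⟶ B} {b : A ⟶ C} {c : B ⟶ D} {d : C ⟶ D}
    (h : IsPullback a b c d) (hd : FFQ d) [IsProper b] : IsProper c := by
  have := isSep_descend h hd
  have : UniversallyClosed c :=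
    MorphismProperty.of_isPullback_of_descendsAlong (Q := FFQ) h.flip hd (inferInstanceAs (UniversallyClosed b))
  have : LocallyOfFiniteType c :=
    MorphismProperty.of_isPullback_of_descendsAlong (Q := FFQ) h.flip hd (inferInstanceAs (LocallyOfFiniteType b))
  constructor

lemma ffq_sig (K F : Type) [Field K] [Field F] [Algebra K F] : FFQ (sig K F) := ffq_field K F

lemma faithful_sig (K F : Type) [Field K] [Field F] [Algebra K F] : (Over.pullback (sig K F)).Faithful := by
  have h := ffq_sig K F
  have h1 : Surjective (sig K F) := h.1.1
  have h2 : Flat (sig K F) := h.1.2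
  have h3 : QuasiCompact (sig K F) := h.2
  infer_instance

end AVProof

namespace AVProof

theorem descent_level {K F : Type} [Field K] [Field F] [Algebra K F]
    (S : Finset F → IntermediateField K F)
    (hS : Monotone S) (hmem : ∀ C : Finset F, ∀ x ∈ C, x ∈ S C)
    (Y : Over (Spec (CommRingCat.of K))) [IsSeparated Y.hom] [QuasiCompact Y.hom]
    [LocallyOfFinitePresentation Y.hom] (X : Over (Spec (CommRingCat.of F))) [GrpFun X]
    (e : (Over.pullback (sig K F)).obj Y ≅ X) {ι : Type} [Fintype ι] (φ : ι → (X ⟶ X)) :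
    ∃ C : Finset F, ∃ (_ : GrpFun ((Over.pullback (gmap S C)).obj Y))
      (ψ : ι → ((Over.pullback (gmap S C)).obj Y ⟶ (Over.pullback (gmap S C)).obj Y)),
      (∀ (T : Over (Spec (CommRingCat.of (S C)))) (a b : T ⟶ (Over.pullback (gmap S C)).obj Y),
        (Over.pullback (smap S C)).map (a + b) ≫ (nu S C Y ≪≫ e).hom =
        (Over.pullback (smap S C)).map a ≫ (nu S C Y ≪≫ e).hom +
        (Over.pullback (smap S C)).map b ≫ (nu S C Y ≪≫ e).hom) ∧
      ∀ k, (Over.pullback (smap S C)).map (ψ k) ≫ (nu S C Y ≪≫ e).hom =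
        (nu S C Y ≪≫ e).hom ≫ φ k := by
  classical
  -- universal objects over K
  have hcY : CompactSpace Y.left := QuasiCompact.compactSpace_of_compactSpace Y.hom
  have hqY : QuasiSeparatedSpace Y.left := quasiSeparatedSpace_of_quasiSeparated Y.hom
  obtain ⟨P, q1, q2, hP1, hP2, hPl⟩ : ∃ (P : Over (Spec (CommRingCat.of K))) (q1 q2 : P ⟶ Y),
      CompactSpace P.left ∧ QuasiSeparatedSpace P.left ∧
      ∀ (T : Scheme) (a b : T ⟶ Y.left), a ≫ Y.hom = b ≫ Y.hom →
        ∃ l : T ⟶ P.left, l ≫ q1.left = a ∧ l ≫ q2.left = b := by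
    refine ⟨Over.mk (pullback.fst Y.hom Y.hom ≫ Y.hom), Over.homMk (pullback.fst _ _) rfl,
      Over.homMk (pullback.snd _ _) pullback.condition.symm, ?_, ?_, ?_⟩
    · have : QuasiCompact (pullback.fst Y.hom Y.hom ≫ Y.hom) := inferInstance
      exact QuasiCompact.compactSpace_of_compactSpace (pullback.fst Y.hom Y.hom ≫ Y.hom)
    · have : IsSeparated (pullback.fst Y.hom Y.hom ≫ Y.hom) := inferInstance
      have : QuasiSeparated (pullback.fst Y.hom Y.hom ≫ Y.hom) := inferInstance
      exact quasiSeparatedSpace_of_quasiSeparated (pullback.fst Y.hom Y.hom ≫ Y.hom)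
    · intro T a b h
      exact ⟨pullback.lift a b h, pullback.lift_fst _ _ _, pullback.lift_snd _ _ _⟩
  obtain ⟨P₁, hP₁, hP₁c, hP₁q⟩ : ∃ P : Over (Spec (CommRingCat.of K)), P = Over.mk (𝟙 _) ∧
      CompactSpace P.left ∧ QuasiSeparatedSpace P.left :=
    ⟨_, rfl, inferInstanceAs (CompactSpace (Spec _)), inferInstanceAs (QuasiSeparatedSpace (Spec _))⟩
  let L := Over.pullback (sig K F)
  obtain ⟨Cm, hCm⟩ := descend_over S hS hmem P Y
    ((L.map q1 ≫ e.hom + L.map q2 ≫ e.hom) ≫ e.inv)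
  obtain ⟨Ci, hCi⟩ := descend_over S hS hmem Y Y ((-e.hom) ≫ e.inv)
  obtain ⟨Cz, hCz⟩ := descend_over S hS hmem P₁ Y ((0 : L.obj P₁ ⟶ X) ≫ e.inv)
  have hφ := fun k => descend_over S hS hmem Y Y (e.hom ≫ φ k ≫ e.inv)
  choose Cφ hCφ using hφ
  let C := Cm ∪ Ci ∪ Cz ∪ Finset.univ.biUnion Cφ
  obtain ⟨m, hm⟩ := hCm C (fun x hx => by simp [C, hx])
  obtain ⟨i, hi⟩ := hCi C (fun x hx => by simp [C, hx])
  obtain ⟨z, hz⟩ := hCz C (fun x hx => by simp [C, hx])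
  have hC' : ∀ k, Cφ k ≤ C := fun k x hx => by
    simp only [C, Finset.mem_union, Finset.mem_biUnion]; exact Or.inr ⟨k, Finset.mem_univ _, hx⟩
  choose ψ hψ using fun k => hCφ k C (hC' k)
  clear_value C
  have hf : (Over.pullback (smap S C)).Faithful := faithful_sig (S C) F
  refine ⟨C, ?_⟩
  have htr := transport (Over.pullback (smap S C)) (nu S C Y ≪≫ e)
    ((Over.pullback (gmap S C)).obj P) ((Over.pullback (gmap S C)).map q1)
    ((Over.pullback (gmap S C)).map q2) m ?_ ?_ i ?_ ((Over.pullback (gmap S C)).obj P₁) ?_ z ?_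
  · obtain ⟨G, hG⟩ := htr
    refine ⟨G, ψ, hG, ?_⟩
    intro k
    rw [Iso.trans_hom, ← Category.assoc, hψ]
    simp
  · intro T a b
    obtain ⟨a', ha1, ha2⟩ : ∃ a' : T.left ⟶ pullback Y.hom (gmap S C), a' = a.left ∧
      a' ≫ pullback.snd _ _ = T.hom := ⟨a.left, rfl, Over.w a⟩
    obtain ⟨b', hb1, hb2⟩ : ∃ b' : T.left ⟶ pullback Y.hom (gmap S C), b' = b.left ∧
      b' ≫ pullback.snd _ _ = T.hom := ⟨b.left, rfl, Over.w b⟩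
    obtain ⟨l, hl1, hl2⟩ := hPl T.left (a' ≫ pullback.fst _ _) (b' ≫ pullback.fst _ _) (by
      rw [Category.assoc, Category.assoc, pullback.condition, ← Category.assoc, ha2,
        ← Category.assoc, hb2])
    obtain ⟨l', hl'1, hl'2⟩ : ∃ l' : T.left ⟶ pullback P.hom (gmap S C),
      l' ≫ pullback.fst _ _ = l ∧ l' ≫ pullback.snd _ _ = T.hom := by
      refine ⟨pullback.lift l T.hom ?_, pullback.lift_fst _ _ _, pullback.lift_snd _ _ _⟩
      rw [← Over.w q1, ← Category.assoc, hl1, Category.assoc, pullback.condition,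
        ← Category.assoc, ha2]
    refine ⟨Over.homMk l' hl'2, ?_, ?_⟩
    · apply Over.OverMorphism.ext
      have : l' ≫ pbm (gmap S C) q1.left (Over.w q1) = a' := by
        apply pullback.hom_ext
        · rw [Category.assoc, pbm_fst, ← Category.assoc, hl'1, hl1]
        · rw [Category.assoc, pbm_snd, hl'2, ha2]
      rw [ha1] at this
      exact this
    · apply Over.OverMorphism.ext
      have : l' ≫ pbm (gmap S C) q2.left (Over.w q2) = b' := by
        apply pullback.hom_ext
        · rw [Category.assoc, pbm_fst, ← Category.assoc, hl'1, hl2]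
        · rw [Category.assoc, pbm_snd, hl'2, hb2]
      rw [hb1] at this
      exact this
  · rw [Iso.trans_hom, ← Category.assoc, ← Category.assoc, ← Category.assoc, hm, nu_nat, nu_nat]
    simp only [Category.assoc, Iso.inv_hom_id, Category.comp_id]
    rw [comp_add]
  · rw [Iso.trans_hom, ← Category.assoc, hi]
    simp only [Category.assoc, Iso.inv_hom_id, Category.comp_id]
    rw [comp_neg]
  · intro T
    subst hP₁
    exact ⟨Over.homMk (U := T) (V := (Over.pullback (gmap S C)).obj (Over.mk (𝟙 _)))
      (pullback.lift (T.hom ≫ gmap S C) T.hom (Category.comp_id _)) (pullback.lift_snd _ _ _)⟩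
  · rw [Iso.trans_hom, ← Category.assoc, hz]
    simp only [Category.assoc, Iso.inv_hom_id, Category.comp_id]
    rw [comp_zero]

end AVProof

namespace AVProof

lemma exists_overIso {K F : Type} [Field K] [Field F] [Algebra K F]
    (X : Over (Spec (CommRingCat.of F))) {Y : Scheme.{0}} (π : X.left ⟶ Y)
    (s : Y ⟶ Spec (CommRingCat.of K)) (h : IsPullback π X.hom s (sig K F)) :
    Nonempty ((Over.pullback (sig K F)).obj (Over.mk s) ≅ X) :=
  ⟨Over.isoMk (h.isoPullback).symm (h.isoPullback_inv_snd)⟩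

lemma countable_adjoin {K F : Type} [Field K] [Field F] [Algebra K F] [Countable K] (C : Set F)
    (hC : C.Countable) : Countable (IntermediateField.adjoin K C) := by
  have : Countable C := hC
  rw [← Cardinal.mk_le_aleph0_iff]
  refine (IntermediateField.cardinalMk_adjoin_le K C).trans ?_
  simp

theorem descent {F : Type} [Field F] [CharZero F] (X : Over (Spec (CommRingCat.of F)))
    [IsProper X.hom] [LocallyOfFinitePresentation X.hom] [GrpFun X]
    {ι : Type} [Fintype ι] (φ : ι → (X ⟶ X)) :
    ∃ (K : Type) (_ : Field K) (_ : Algebra K F) (_ : Countable K)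
      (Y : Over (Spec (CommRingCat.of K))) (e : (Over.pullback (sig K F)).obj Y ≅ X)
      (_ : GrpFun Y) (ψ : ι → (Y ⟶ Y)),
      (∀ (T : Over (Spec (CommRingCat.of K))) (a b : T ⟶ Y),
        (Over.pullback (sig K F)).map (a + b) ≫ e.hom =
        (Over.pullback (sig K F)).map a ≫ e.hom + (Over.pullback (sig K F)).map b ≫ e.hom) ∧
      ∀ k, (Over.pullback (sig K F)).map (ψ k) ≫ e.hom = e.hom ≫ φ k := by
  have hcX : CompactSpace X.left := QuasiCompact.compactSpace_of_compactSpace X.hom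
  obtain ⟨C₀, hC₀, H⟩ := scheme_form F X.left X.hom
  obtain ⟨K₀, _, _, hK₀c, hK₀⟩ : ∃ (K : Type) (_ : Field K) (_ : Algebra K F) (_ : Countable K),
      C₀ ⊆ Set.range (algebraMap K F) := by
    refine ⟨IntermediateField.adjoin ℚ C₀, inferInstance, inferInstance,
      countable_adjoin C₀ hC₀.countable, ?_⟩
    intro x hx
    exact ⟨⟨x, IntermediateField.subset_adjoin ℚ C₀ hx⟩, rfl⟩
  obtain ⟨Y₀, π, s, hpb⟩ := H K₀ hK₀
  replace hpb : IsPullback π X.hom s (sig K₀ F) := hpb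
  obtain ⟨e₀⟩ := exists_overIso X π s hpb
  have hp : IsProper s := isProper_descend hpb (ffq_sig K₀ F)
  have hl : LocallyOfFinitePresentation s :=
    MorphismProperty.of_isPullback_of_descendsAlong (P := @LocallyOfFinitePresentation) (Q := FFQ)
      hpb.flip (ffq_sig K₀ F) inferInstance
  obtain ⟨S, hS, hmem, hcount⟩ : ∃ S : Finset F → IntermediateField K₀ F, Monotone S ∧
      (∀ C : Finset F, ∀ x ∈ C, x ∈ S C) ∧ ∀ C, Countable (S C) :=
    ⟨fun C => IntermediateField.adjoin K₀ (C : Set F),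
      fun C D h => IntermediateField.adjoin.mono K₀ _ _ (by exact_mod_cast h),
      fun C x hx => IntermediateField.subset_adjoin K₀ _ hx,
      fun C => countable_adjoin _ C.countable_toSet⟩
  have i1 : IsProper (Over.mk s).hom := hp
  have i2 : LocallyOfFinitePresentation (Over.mk s).hom := hl
  obtain ⟨C, G, ψ, h1, h2⟩ := descent_level S hS hmem (Over.mk s) X e₀ φ
  exact ⟨S C, inferInstance, inferInstance, hcount C, _, nu S C (Over.mk s) ≪≫ e₀, G, ψ, h1, h2⟩

end AVProof

namespace AVProof
lemma embed_complex (K : Type) [Field K] [CharZero K] [Countable K] : Nonempty (K →+* ℂ) := by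
  let R := MvPolynomial ℝ K
  let Q := FractionRing R
  let L := AlgebraicClosure Q
  have hcR : Cardinal.mk R = Cardinal.continuum := by
    simp only [R]
    rw [MvPolynomial.cardinalMk_eq_max]
    have : Cardinal.mk K ≤ Cardinal.aleph0 := Cardinal.mk_le_aleph0_iff.2 inferInstance
    rw [Cardinal.mk_real, max_eq_right (this.trans Cardinal.aleph0_le_continuum), max_eq_left Cardinal.aleph0_le_continuum]
  have hinfR : Infinite R := by
    rw [Cardinal.infinite_iff, hcR]; exact Cardinal.aleph0_le_continuum
  have hcQ : Cardinal.mk Q = Cardinal.continuum := by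
    simp only [Q]
    rw [Cardinal.mk_fractionRing, hcR]
  have : Infinite Q := by
    rw [Cardinal.infinite_iff, hcQ]; exact Cardinal.aleph0_le_continuum
  have hcL : Cardinal.mk L = Cardinal.continuum := by
    apply le_antisymm
    · have := Algebra.IsAlgebraic.cardinalMk_le_max Q L
      rw [hcQ, max_eq_left Cardinal.aleph0_le_continuum] at this
      exact this
    · rw [← hcQ]
      exact Cardinal.mk_le_of_injective (algebraMap Q L).injective
  have : CharZero L := by
    have : CharZero Q := charZero_of_injective_algebraMap (R := K) (A := Q) (algebraMap K Q).injective
    exact charZero_of_injective_algebraMap (algebraMap Q L).injective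
  obtain ⟨e⟩ := IsAlgClosed.ringEquiv_of_equiv_of_charZero (K := L) (L := ℂ)
    (by rw [hcL]; exact Cardinal.aleph0_lt_continuum)
    (Cardinal.eq.1 (by rw [hcL, Cardinal.mk_complex]))
  exact ⟨e.toRingHom.comp ((algebraMap Q L).comp (algebraMap K Q))⟩
end AVProof

namespace AVProof

theorem grpFun_of {C : Type*} [Category C] [HasBinaryProducts C] [HasTerminal C] (X : C)
    (mul : Limits.prod X X ⟶ X) (one : ⊤_ C ⟶ X) (inv : X ⟶ X)
    (mul_assoc : prod.map mul (𝟙 X) ≫ mul =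
      (prod.associator X X X).hom ≫ prod.map (𝟙 X) mul ≫ mul)
    (one_mul : prod.lift (terminal.from X ≫ one) (𝟙 X) ≫ mul = 𝟙 X)
    (mul_inv : prod.lift (𝟙 X) inv ≫ mul = terminal.from X ≫ one)
    (mul_comm : (prod.braiding X X).hom ≫ mul = mul) :
    ∃ _ : GrpFun X, ∀ (T : C) (a b : T ⟶ X), a + b = prod.lift a b ≫ mul := by
  let ad : ∀ {T : C}, (T ⟶ X) → (T ⟶ X) → (T ⟶ X) := fun a b => prod.lift a b ≫ mul
  let ze : ∀ T : C, (T ⟶ X) := fun T => terminal.from T ≫ one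
  have hnat : ∀ {T T' : C} (f : T' ⟶ T) (a b : T ⟶ X),
      f ≫ ad a b = ad (f ≫ a) (f ≫ b) := by
    intro T T' f a b; simp only [ad]; rw [← Category.assoc, prod.comp_lift]
  have hz : ∀ {T T' : C} (f : T' ⟶ T), f ≫ ze T = ze T' := by
    intro T T' f; simp only [ze]; rw [← Category.assoc, terminal.comp_from]
  have comm : ∀ {T : C} (a b : T ⟶ X), ad a b = ad b a := by
    intro T a b
    change _ ≫ mul = _ ≫ mul
    conv_lhs => rw [← mul_comm, ← Category.assoc]
    congr 1
    ext <;> simp [prod.lift_fst, prod.lift_snd, prod.lift_fst_assoc, prod.lift_snd_assoc, prod.map_fst, prod.map_snd]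
  have assoc : ∀ {T : C} (a b c : T ⟶ X), ad (ad a b) c = ad a (ad b c) := by
    intro T a b c
    have h := congrArg (fun k => prod.lift (prod.lift a b) c ≫ k) mul_assoc
    simp only [← Category.assoc] at h
    convert h using 1
    · simp only [ad]; congr 1; ext <;> simp [prod.lift_fst, prod.lift_snd, prod.lift_fst_assoc, prod.lift_snd_assoc, prod.map_fst, prod.map_snd]
    · simp only [ad]; congr 1; ext
      · simp [prod.lift_fst, prod.lift_snd, prod.lift_fst_assoc, prod.lift_snd_assoc]
      · simp only [prod.lift_snd, prod.associator_hom, Category.assoc, prod.map_snd]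
        simp only [← Category.assoc]
        congr 1
        ext <;> simp [prod.lift_fst, prod.lift_snd, prod.lift_fst_assoc, prod.lift_snd_assoc, prod.map_fst, prod.map_snd]
  have zadd : ∀ {T : C} (a : T ⟶ X), ad (ze T) a = a := by
    intro T a
    have h := congrArg (fun k => a ≫ k) one_mul
    simp only [Category.comp_id] at h
    refine Eq.trans ?_ h
    rw [← Category.assoc]
    simp only [ad]; congr 1; ext <;> simp [ze]
  have nadd : ∀ {T : C} (a : T ⟶ X), ad (a ≫ inv) a = ze T := by
    intro T a
    rw [comm]
    have h := congrArg (fun k => a ≫ k) mul_inv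
    refine Eq.trans ?_ (h.trans (hz a))
    change _ = a ≫ _ ≫ mul
    rw [← Category.assoc]
    simp only [ad]; congr 1; ext <;> simp [prod.lift_fst, prod.lift_snd, prod.lift_fst_assoc, prod.lift_snd_assoc, prod.map_fst, prod.map_snd]
  refine ⟨⟨fun T => by
    letI : Add (T ⟶ X) := ⟨ad⟩
    letI : Zero (T ⟶ X) := ⟨ze T⟩
    letI : Neg (T ⟶ X) := ⟨fun a => a ≫ inv⟩
    exact { AddGroup.ofLeftAxioms (G := (T ⟶ X)) assoc zadd nadd with add_comm := comm }, ?_⟩, ?_⟩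
  · intro T T' f a b
    exact hnat f a b
  · intro T a b
    rfl

theorem avGrp {F : Type} [Field F] (A : AbelianVariety F) :
    ∃ _ : GrpFun A.X, ∀ (T : Over (Spec (CommRingCat.of F))) (a b : T ⟶ A.X),
      a + b = prod.lift a b ≫ A.mul :=
  grpFun_of A.X A.mul A.one A.inv A.mul_assoc A.one_mul A.mul_inv A.mul_comm

lemma isHomm_of {C : Type*} [Category C] [HasBinaryProducts C] {X : C} [GrpFun X]
    (mul : Limits.prod X X ⟶ X) (h : ∀ (T : C) (a b : T ⟶ X), a + b = prod.lift a b ≫ mul)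
    (φ : X ⟶ X) (hφ : mul ≫ φ = prod.map φ φ ≫ mul) : IsHomm φ := by
  intro T a b
  rw [h, h, Category.assoc, hφ, ← Category.assoc]
  congr 1
  ext <;> simp [prod.lift_fst, prod.lift_snd, prod.lift_fst_assoc, prod.lift_snd_assoc, prod.map_fst, prod.map_snd]

end AVProof

namespace AVProof

section sp
variable (K : Type) [CommRing K]

/-- `Spec A` as an object over `Spec K`. -/
noncomputable def spO (A : Type) [CommRing A] [Algebra K A] : Over (Spec (CommRingCat.of K)) :=
  Over.mk (Spec.map (CommRingCat.ofHom (algebraMap K A)))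

variable {K}
variable {A B D : Type} [CommRing A] [Algebra K A] [CommRing B] [Algebra K B] [CommRing D] [Algebra K D]

/-- functoriality of `spO`. -/
noncomputable def spM (f : A →ₐ[K] B) : spO K B ⟶ spO K A :=
  Over.homMk (Spec.map (CommRingCat.ofHom f.toRingHom)) (by
    change Spec.map _ ≫ Spec.map _ = Spec.map _
    rw [← Spec.map_comp, ← CommRingCat.ofHom_comp]
    congr 2
    exact f.comp_algebraMap)

lemma spM_left (f : A →ₐ[K] B) : (spM f).left = Spec.map (CommRingCat.ofHom f.toRingHom) := rfl

lemma spM_comp (f : A →ₐ[K] B) (g : B →ₐ[K] D) : spM g ≫ spM f = spM (g.comp f) := by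
  ext1
  change Spec.map _ ≫ Spec.map _ = Spec.map _
  rw [← Spec.map_comp, ← CommRingCat.ofHom_comp]
  rfl

lemma spM_comp_assoc (f : A →ₐ[K] B) (g : B →ₐ[K] D) {Z} (k : spO K A ⟶ Z) :
    spM g ≫ spM f ≫ k = spM (g.comp f) ≫ k := by
  rw [← spM_comp, Category.assoc]

lemma spM_surj (q : spO K B ⟶ spO K A) : ∃ f : A →ₐ[K] B, q = spM f := by
  obtain ⟨f, hf⟩ : ∃ f : CommRingCat.of A ⟶ CommRingCat.of B, Spec.map f = q.left :=
    ⟨Spec.preimage q.left, Spec.map_preimage _⟩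
  have hw : Spec.map f ≫ Spec.map (CommRingCat.ofHom (algebraMap K A)) =
      Spec.map (CommRingCat.ofHom (algebraMap K B)) := by
    rw [hf]; exact Over.w q
  rw [← Spec.map_comp] at hw
  have hw2 := Spec.map_injective hw
  refine ⟨{ f.hom with commutes' := fun r => congr($(hw2).hom r) }, ?_⟩
  ext1
  rw [← hf]; rfl

lemma spM_inj {f g : A →ₐ[K] B} (h : spM f = spM g) : f = g := by
  have h1 : (spM f).left = (spM g).left := by rw [h]
  have h2 := Spec.map_injective h1
  ext a
  exact congr($(h2).hom a)

lemma comp_mono_inj {Y : Over (Spec (CommRingCat.of K))} (j : spO K A ⟶ Y) [Mono j.left]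
    {f g : A →ₐ[K] B} (h : spM f ≫ j = spM g ≫ j) : f = g := by
  apply spM_inj
  ext1
  rw [← cancel_mono j.left]
  exact congr($(h).left)

/-- factor through an open affine -/
lemma factor_open {Y T : Over (Spec (CommRingCat.of K))} (j : spO K A ⟶ Y) [IsOpenImmersion j.left]
    (f : T ⟶ Y) (h : Set.range f.left ⊆ Set.range j.left) : ∃ q : T ⟶ spO K A, q ≫ j = f := by
  have h1 := IsOpenImmersion.lift_fac j.left f.left h
  refine ⟨Over.homMk (IsOpenImmersion.lift j.left f.left h) ?_, ?_⟩
  · rw [← Over.w j, ← Category.assoc, h1, Over.w f]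
  · ext1; exact h1

theorem localMap {Y : Over (Spec (CommRingCat.of K))} (j : spO K A ⟶ Y) [IsOpenImmersion j.left]
    (f : spO K B ⟶ Y) (p : PrimeSpectrum B) (hp : f.left p ∈ Set.range j.left) :
    ∃ h : B, h ∉ p.asIdeal ∧ ∃ u : A →ₐ[K] Localization.Away h,
      spM (IsScalarTower.toAlgHom K B (Localization.Away h)) ≫ f = spM u ≫ j := by
  have hop : IsOpen (f.left ⁻¹' Set.range j.left) :=
    (j.left.isOpenEmbedding.isOpen_range).preimage f.left.continuous
  obtain ⟨_, ⟨h, rfl⟩, hph, hsub⟩ := PrimeSpectrum.isTopologicalBasis_basic_opens.exists_subset_of_mem_open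
    (show p ∈ _ from hp) hop
  refine ⟨h, hph, ?_⟩
  obtain ⟨q, hq⟩ := factor_open j (spM (IsScalarTower.toAlgHom K B (Localization.Away h)) ≫ f) (by
    rintro _ ⟨x, rfl⟩
    apply hsub
    have : (spM (IsScalarTower.toAlgHom K B (Localization.Away h))).left x ∈
      Set.range (PrimeSpectrum.comap (algebraMap B (Localization.Away h))) := ⟨x, rfl⟩
    rwa [PrimeSpectrum.localization_away_comap_range (Localization.Away h) h] at this)
  obtain ⟨u, rfl⟩ := spM_surj q
  exact ⟨u, hq.symm⟩

/-- pointwise consequence -/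
theorem localMap_eval {Y : Over (Spec (CommRingCat.of K))} (j : spO K A ⟶ Y)
    (f : spO K B ⟶ Y) (h : B) (u : A →ₐ[K] Localization.Away h)
    (hu : spM (IsScalarTower.toAlgHom K B (Localization.Away h)) ≫ f = spM u ≫ j)
    (β : B →ₐ[K] D) (hβ : IsUnit (β h)) :
    ∃ χ : A →ₐ[K] D, spM β ≫ f = spM χ ≫ j ∧
      ∀ (a : A) (b : B) (k : ℕ), u a * algebraMap B _ (h ^ k) = algebraMap B _ b → χ a * β h ^ k = β b := by
  let L : Localization.Away h →ₐ[K] D := IsLocalization.liftAlgHom (M := Submonoid.powers h) (f := β)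
    (by rintro ⟨_, k, rfl⟩; simpa using hβ.pow k)
  have hL : ∀ b : B, L (algebraMap B _ b) = β b := fun b => by
    simp only [L, IsLocalization.coe_liftAlgHom]
    exact IsLocalization.lift_eq _ _
  have hL2 : L.comp (IsScalarTower.toAlgHom K B (Localization.Away h)) = β := by
    ext b; exact hL b
  refine ⟨L.comp u, ?_, ?_⟩
  · rw [← spM_comp, Category.assoc, ← hu, ← Category.assoc, spM_comp, hL2]
  · intro a b k hab
    have := congrArg L hab
    rw [map_mul, hL, hL, map_pow] at this
    exact this

lemma away_form (h : B) (z : Localization.Away h) : ∃ (b : B) (k : ℕ), z * algebraMap B _ (h ^ k) = algebraMap B _ b := by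
  obtain ⟨⟨b, ⟨_, k, rfl⟩⟩, hb⟩ := IsLocalization.surj (Submonoid.powers h) z
  exact ⟨b, k, hb⟩
end sp
end AVProof

namespace AVProof
open Topology

section mv
variable {K : Type} [Field K] [Algebra K ℂ] {ι : Type} [Fintype ι]

lemma mv_contDiff (p : MvPolynomial ι K) : ContDiff ℂ 2 (fun z : ι → ℂ => MvPolynomial.aeval z p) := by
  induction p using MvPolynomial.induction_on with
  | C a => simpa using contDiff_const
  | add p q hp hq => simpa using hp.add hq
  | mul_X p i hp => simpa using hp.mul (contDiff_apply ℂ ℂ i)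

lemma mv_hasFDeriv (p : MvPolynomial ι K) (z : ι → ℂ) :
    HasFDerivAt (fun z : ι → ℂ => MvPolynomial.aeval z p)
      (∑ i, MvPolynomial.aeval z (MvPolynomial.pderiv i p) • (ContinuousLinearMap.proj (R := ℂ) (φ := fun _ : ι => ℂ) i)) z := by
  classical
  induction p using MvPolynomial.induction_on with
  | C a =>
    have h := hasFDerivAt_const (𝕜 := ℂ) (algebraMap K ℂ a) z
    have h2 := h.congr_fderiv (g' := ∑ i, MvPolynomial.aeval z (MvPolynomial.pderiv i (MvPolynomial.C a)) •
      (ContinuousLinearMap.proj (R := ℂ) (φ := fun _ : ι => ℂ) i)) (by ext v; simp)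
    refine h2.congr_of_eventuallyEq (Filter.Eventually.of_forall fun w => ?_)
    simp
  | add p q hp hq =>
    have := hp.add hq
    rw [← Finset.sum_add_distrib] at this
    simp only [← add_smul, ← map_add] at this
    refine this.congr_of_eventuallyEq (Filter.Eventually.of_forall fun w => ?_)
    simp
  | mul_X p i hp =>
    have := hp.mul (hasFDerivAt_apply i z)
    simp only [map_mul, MvPolynomial.aeval_X]
    refine this.congr_fderiv ?_
    ext v
    simp only [Derivation.leibniz, smul_eq_mul, map_add, map_mul, MvPolynomial.aeval_X,
      MvPolynomial.pderiv_X, Pi.single_apply, ContinuousLinearMap.add_apply,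
      ContinuousLinearMap.sum_apply, ContinuousLinearMap.smul_apply, ContinuousLinearMap.proj_apply,
      add_mul, Finset.sum_add_distrib, apply_ite, map_one, map_zero, mul_ite, mul_one, mul_zero, ite_mul, zero_mul]
    simp [Finset.mul_sum, mul_assoc]

theorem implicit {σ : Type} [Fintype σ] [DecidableEq σ] (rel : σ → MvPolynomial ι K) (mp : σ → ι) [Fintype {i // i ∉ Set.range mp}]
    (mpi : Function.Injective mp) (z0 : ι → ℂ) (h0 : ∀ j, MvPolynomial.aeval z0 (rel j) = 0)
    (hdet : (Matrix.of (fun i j : σ => MvPolynomial.aeval z0 (MvPolynomial.pderiv (mp i) (rel j)))).det ≠ 0) :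
    ∃ γ : ({i // i ∉ Set.range mp} → ℂ) → (ι → ℂ), ContDiffAt ℂ 2 γ 0 ∧ γ 0 = z0 ∧
      (∀ᶠ s in 𝓝 0, (∀ j, MvPolynomial.aeval (γ s) (rel j) = 0) ∧ ∀ i : {i // i ∉ Set.range mp}, γ s i = s i + z0 i) ∧
      ∀ᶠ z in 𝓝 z0, (∀ j, MvPolynomial.aeval z (rel j) = 0) → γ (fun i => z i - z0 i) = z := by
  classical
  let Φ : (ι → ℂ) → (σ → ℂ) × ({i // i ∉ Set.range mp} → ℂ) := fun z => (fun j => MvPolynomial.aeval z (rel j), fun i => z i - z0 i)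
  let D : (ι → ℂ) →L[ℂ] (σ → ℂ) × ({i // i ∉ Set.range mp} → ℂ) :=
    (ContinuousLinearMap.pi fun j => ∑ i, MvPolynomial.aeval z0 (MvPolynomial.pderiv i (rel j)) •
      (ContinuousLinearMap.proj (R := ℂ) (φ := fun _ : ι => ℂ) i)).prod
    (ContinuousLinearMap.pi fun i : {i // i ∉ Set.range mp} => ContinuousLinearMap.proj (R := ℂ) (φ := fun _ : ι => ℂ) i.1)
  have hΦ : ContDiff ℂ 2 Φ := by
    refine ContDiff.prodMk (contDiff_pi.2 fun j => mv_contDiff _) (contDiff_pi.2 fun i => ?_)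
    exact (contDiff_apply ℂ ℂ i.1).sub contDiff_const
  have hD : HasFDerivAt Φ D z0 := by
    refine HasFDerivAt.prodMk (hasFDerivAt_pi.2 fun j => mv_hasFDeriv _ _) (hasFDerivAt_pi.2 fun i => ?_)
    exact (hasFDerivAt_apply i.1 z0).sub_const _
  have hinj : Function.Injective D := by
    rw [injective_iff_map_eq_zero]
    intro v hv
    have h1 : ∀ j, ∑ i, MvPolynomial.aeval z0 (MvPolynomial.pderiv i (rel j)) * v i = 0 := fun j => by
      have := congrFun (congrArg Prod.fst hv) j
      simpa [D, ContinuousLinearMap.sum_apply] using this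
    have h2 : ∀ i, i ∉ Set.range mp → v i = 0 := fun i hi => by
      have := congrFun (congrArg Prod.snd hv) ⟨i, hi⟩
      simpa [D] using this
    have h3 : Matrix.vecMul (fun k => v (mp k)) (Matrix.of (fun i j : σ => MvPolynomial.aeval z0 (MvPolynomial.pderiv (mp i) (rel j)))) = 0 := by
      ext j
      rw [Pi.zero_apply, ← h1 j]
      simp only [Matrix.vecMul, dotProduct, Matrix.of_apply]
      rw [← Finset.sum_subset (Finset.subset_univ (Finset.univ.image mp)), Finset.sum_image (fun a _ b _ h => mpi h)]
      · exact Finset.sum_congr rfl fun i _ => mul_comm _ _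
      · intro i _ hi
        rw [h2 i (by simpa using hi), mul_zero]
    have h4 := Matrix.eq_zero_of_vecMul_eq_zero hdet h3
    ext i
    by_cases hi : i ∈ Set.range mp
    · obtain ⟨k, rfl⟩ := hi
      exact congrFun h4 k
    · exact h2 i hi
  have hcard : Module.finrank ℂ (ι → ℂ) = Module.finrank ℂ ((σ → ℂ) × ({i // i ∉ Set.range mp} → ℂ)) := by
    rw [Module.finrank_prod, Module.finrank_fintype_fun_eq_card, Module.finrank_fintype_fun_eq_card,
      Module.finrank_fintype_fun_eq_card]
    have : Fintype.card {i // i ∈ Set.range mp} = Fintype.card σ :=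
      (Fintype.card_congr (Equiv.ofInjective mp mpi)).symm
    rw [← this]
    have h := Fintype.card_subtype_compl (fun i => i ∈ Set.range mp)
    have h' := Fintype.card_subtype_le (fun i => i ∈ Set.range mp)
    change _ = _ + Fintype.card {i // ¬ i ∈ Set.range mp}
    omega
  let e : (ι → ℂ) ≃L[ℂ] (σ → ℂ) × ({i // i ∉ Set.range mp} → ℂ) :=
    (LinearMap.linearEquivOfInjective D.toLinearMap hinj hcard).toContinuousLinearEquiv
  have he : (e : (ι → ℂ) →L[ℂ] (σ → ℂ) × ({i // i ∉ Set.range mp} → ℂ)) = D := by ext v <;> rfl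
  rw [← he] at hD
  have hs := hΦ.contDiffAt.hasStrictFDerivAt' hD (by norm_num : (2 : WithTop ℕ∞) ≠ 0)
  have hz : Φ z0 = 0 := by
    ext j <;> simp [Φ, h0]
  let Ψ := hs.localInverse Φ e z0
  have hΨ : ContDiffAt ℂ 2 Ψ 0 := by
    have := hΦ.contDiffAt.to_localInverse hD (by norm_num : (2 : WithTop ℕ∞) ≠ 0)
    rwa [hz] at this
  have hpz : ((0 : σ → ℂ), (0 : {i // i ∉ Set.range mp} → ℂ)) = 0 := rfl
  refine ⟨fun s => Ψ (0, s), ?_, ?_, ?_, ?_⟩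
  · have : ContDiffAt ℂ 2 (fun s : {i // i ∉ Set.range mp} → ℂ => ((0 : σ → ℂ), s)) 0 := contDiffAt_const.prodMk contDiffAt_id
    exact ContDiffAt.comp (g := Ψ) (f := fun s : {i // i ∉ Set.range mp} → ℂ => ((0 : σ → ℂ), s)) 0 (by rw [hpz]; exact hΨ) this
  · have := hs.localInverse_apply_image
    rw [hz] at this
    exact this
  · have h1 := hs.eventually_right_inverse
    rw [hz] at h1
    have h2 : Filter.Tendsto (fun s : {i // i ∉ Set.range mp} → ℂ => ((0 : σ → ℂ), s)) (𝓝 0) (𝓝 0) := by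
      have : Continuous (fun s : {i // i ∉ Set.range mp} → ℂ => ((0 : σ → ℂ), s)) := by fun_prop
      exact this.tendsto 0
    filter_upwards [h2.eventually h1] with s hs'
    refine ⟨fun j => congrFun (congrArg Prod.fst hs') j, fun i => ?_⟩
    have := congrFun (congrArg Prod.snd hs') i
    exact eq_add_of_sub_eq this
  · filter_upwards [hs.eventually_left_inverse] with z hz1 hz2
    have : Φ z = ((0 : σ → ℂ), fun i : {i // i ∉ Set.range mp} => z i - z0 i) := by
      ext j
      · exact hz2 j
      · rfl
    rw [this] at hz1
    exact hz1

end mv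

theorem chart {K A : Type} [Field K] [CommRing A] [Algebra K A] [Algebra K ℂ] (n : ℕ)
    [hsm : Algebra.IsStandardSmoothOfRelativeDimension n K A] (χ0 : A →ₐ[K] ℂ) :
    ∃ (c : (Fin n → ℂ) → (A →ₐ[K] ℂ)) (t : Fin n → A) (S : Finset A), c 0 = χ0 ∧
      (∀ a, ContDiffAt ℂ 2 (fun s => c s a) 0) ∧
      (∀ᶠ s in 𝓝 0, ∀ i, c s (t i) = s i + χ0 (t i)) ∧
      ∀ W ∈ 𝓝 (0 : Fin n → ℂ), ∃ ε > 0, ∀ χ : A →ₐ[K] ℂ, (∀ a ∈ S, ‖χ a - χ0 a‖ < ε) → ∃ s ∈ W, χ = c s := by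
  classical
  obtain ⟨ι, σ, hσ, hι, P, hP⟩ := hsm.out
  have := Fintype.ofFinite ι
  have := Fintype.ofFinite σ
  set z0 : ι → ℂ := fun i => χ0 (P.val i) with hz0
  have hev : ∀ (χ : A →ₐ[K] ℂ) (p : MvPolynomial ι K), χ (MvPolynomial.aeval P.val p) = MvPolynomial.aeval (fun i => χ (P.val i)) p := by
    intro χ p
    rw [← AlgHom.comp_apply, MvPolynomial.comp_aeval]
  have hrel : ∀ (χ : A →ₐ[K] ℂ) j, MvPolynomial.aeval (fun i => χ (P.val i)) (P.relation j) = 0 := by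
    intro χ j
    rw [← hev, P.aeval_val_relation, map_zero]
  have hsurj : ∀ a : A, ∃ p : MvPolynomial ι K, MvPolynomial.aeval P.val p = a := fun a => ⟨P.σ a, P.aeval_val_σ a⟩
  have hlift : ∀ z : ι → ℂ, (∀ j, MvPolynomial.aeval z (P.relation j) = 0) →
      ∃ χ : A →ₐ[K] ℂ, ∀ i, χ (P.val i) = z i := by
    intro z hz
    have hker : RingHom.ker (MvPolynomial.aeval (R := K) P.val) ≤ RingHom.ker (MvPolynomial.aeval (R := K) z) := by
      have := P.span_range_relation_eq_ker
      rw [P.ker_eq_ker_aeval_val] at this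
      rw [← this, Ideal.span_le]
      rintro _ ⟨j, rfl⟩
      exact hz j
    refine ⟨AlgHom.liftOfSurjective (MvPolynomial.aeval (R := K) P.val) hsurj (MvPolynomial.aeval (R := K) z) hker, fun i => ?_⟩
    have := AlgHom.liftOfSurjective_apply (MvPolynomial.aeval (R := K) P.val) hsurj (MvPolynomial.aeval (R := K) z) hker (MvPolynomial.X i)
    simpa using this
  obtain ⟨γ, g1, g2, g3, g4⟩ := implicit P.relation P.map P.map_inj z0 (hrel χ0) (by
    have h1 : IsUnit (χ0 P.jacobian) := P.jacobian_isUnit.map χ0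
    have h2 : χ0 P.jacobian = (Matrix.of (fun i j : σ => MvPolynomial.aeval z0 (MvPolynomial.pderiv (P.map i) (P.relation j)))).det := by
      rw [P.jacobian_eq_jacobiMatrix_det, P.algebraMap_eq]
      erw [hev]
      rw [← hz0]
      erw [AlgHom.map_det]
      congr 1
      ext i j
      simp [P.jacobiMatrix_apply]
    rw [← h2]
    exact h1.ne_zero)
  have hcard : Fintype.card {i // i ∉ Set.range P.map} = n := by
    rw [← hP, Algebra.Presentation.dimension, Nat.card_eq_fintype_card, Nat.card_eq_fintype_card]
    have : Fintype.card {i // i ∈ Set.range P.map} = Fintype.card σ :=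
      (Fintype.card_congr (Equiv.ofInjective P.map P.map_inj)).symm
    rw [← this]
    exact Fintype.card_subtype_compl (fun i => i ∈ Set.range P.map)
  let eq : {i // i ∉ Set.range P.map} ≃ Fin n := Fintype.equivFinOfCardEq hcard
  let rx : (Fin n → ℂ) → ({i // i ∉ Set.range P.map} → ℂ) := fun s i => s (eq i)
  have rxc : ContDiff ℂ 2 rx := contDiff_pi.2 fun i => contDiff_apply ℂ ℂ _
  have rx0 : rx 0 = 0 := rfl
  let c : (Fin n → ℂ) → (A →ₐ[K] ℂ) := fun s =>
    if h : ∀ j, MvPolynomial.aeval (γ (rx s)) (P.relation j) = 0 then (hlift _ h).choose else χ0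
  have hcs : ∀ s, (∀ j, MvPolynomial.aeval (γ (rx s)) (P.relation j) = 0) → ∀ i, c s (P.val i) = γ (rx s) i := by
    intro s h
    simp only [c, dif_pos h]
    exact (hlift _ h).choose_spec
  have hext : ∀ χ χ' : A →ₐ[K] ℂ, (∀ i, χ (P.val i) = χ' (P.val i)) → χ = χ' := by
    intro χ χ' h
    ext a
    obtain ⟨p, rfl⟩ := hsurj a
    rw [hev, hev, funext h]
  have htend : Filter.Tendsto rx (𝓝 0) (𝓝 0) := rxc.continuous.tendsto 0
  have hg3 := htend.eventually g3
  refine ⟨c, fun i => P.val (eq.symm i), Finset.univ.image P.val, ?_, ?_, ?_, ?_⟩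
  · apply hext
    intro i
    have hh : ∀ j, MvPolynomial.aeval (γ (rx 0)) (P.relation j) = 0 := by rw [rx0, g2]; exact hrel χ0
    rw [hcs 0 hh i, rx0, g2]
  · intro a
    obtain ⟨p, rfl⟩ := hsurj a
    have h1 : ContDiffAt ℂ 2 (fun s => MvPolynomial.aeval (γ (rx s)) p) 0 :=
      ContDiffAt.comp (g := fun z : ι → ℂ => MvPolynomial.aeval z p) (f := fun s => γ (rx s)) 0 (mv_contDiff p).contDiffAt
        (ContDiffAt.comp (g := γ) (f := rx) 0 (by rw [rx0]; exact g1) rxc.contDiffAt)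
    refine h1.congr_of_eventuallyEq ?_
    filter_upwards [hg3] with s hs
    rw [hev, funext (hcs s hs.1)]
  · filter_upwards [hg3] with s hs i
    rw [hcs s hs.1, hs.2]
    simp [rx, hz0]
  · intro W hW
    have h1 : ∀ᶠ z : ι → ℂ in 𝓝 z0, (fun i : Fin n => z (eq.symm i) - z0 (eq.symm i)) ∈ W := by
      have hc : Continuous (fun z : ι → ℂ => (fun i : Fin n => z (eq.symm i) - z0 (eq.symm i))) := by fun_prop
      refine hc.continuousAt.eventually_mem ?_
      simpa [Pi.zero_def] using hW
    obtain ⟨ε, hε, hb⟩ := Metric.eventually_nhds_iff.1 (g4.and h1)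
    refine ⟨ε, hε, fun χ hχ => ?_⟩
    obtain ⟨h2, h3⟩ := hb (y := fun i => χ (P.val i)) (by
      rw [dist_pi_lt_iff hε]
      intro i
      rw [dist_eq_norm]
      exact hχ _ (Finset.mem_image_of_mem _ (Finset.mem_univ i)))
    refine ⟨_, h3, ?_⟩
    have h4 := h2 (hrel χ)
    have h5 : rx (fun i : Fin n => χ (P.val (eq.symm i)) - z0 (eq.symm i)) =
      (fun i : {i // i ∉ Set.range P.map} => χ (P.val i) - z0 i) := by
      ext i; simp [rx]
    apply hext
    intro i
    have h6 := hcs (fun i : Fin n => χ (P.val (eq.symm i)) - z0 (eq.symm i)) (by rw [h5, h4]; exact hrel χ) i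
    rw [h5, h4] at h6
    exact h6.symm
end AVProof

namespace AVProof
open Topology

lemma ultra_bdd {G : Type} (U : Ultrafilter G) (f : G → ℂ) (C : ℝ) (hf : ∀ x, ‖f x‖ ≤ C) :
    ∃ z, Filter.Tendsto f U (𝓝 z) := by
  obtain ⟨z, -, hz⟩ := (isCompact_closedBall (0 : ℂ) C).ultrafilter_le_nhds (U.map f) (by
    rw [Filter.le_principal_iff]
    change f ⁻¹' _ ∈ (U : Filter G)
    apply Filter.mem_of_superset Filter.univ_mem
    intro x _
    simpa using hf x)
  exact ⟨z, hz⟩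

theorem ultra {G : Type} (U : Ultrafilter G) : ∃ (L : Type) (_ : Field L) (π : (G → ℂ) →+* L)
    (O : ValuationSubring L) (st : O →+* ℂ), (∀ f, π f ≠ 0 → ∀ᶠ x in (U : Filter G), f x ≠ 0) ∧
      (∀ z : ℂ, π (fun _ => z) ∈ O) ∧
      (∀ (o : O) (f : G → ℂ), π f = o → Filter.Tendsto f U (𝓝 (st o))) := by
  classical
  let L := Filter.Germ (U : Filter G) ℂ
  let π : (G → ℂ) →+* L := Filter.Germ.coeRingHom _
  have hπ : ∀ f g : G → ℂ, π f = π g ↔ f =ᶠ[(U : Filter G)] g := fun f g => Filter.Germ.coe_eq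
  have hπs : ∀ l : L, ∃ f, π f = l := fun l => Quotient.inductionOn' l fun f => ⟨f, rfl⟩
  have hcase : ∀ l : L, (∀ f : G → ℂ, π f = l → ∀ᶠ x in (U : Filter G), ‖f x‖ ≤ 1) →
      ∃ (f : G → ℂ) (C : ℝ), (∀ x, ‖f x‖ ≤ C) ∧ π f = l := by
    intro l h
    obtain ⟨f, rfl⟩ := hπs l
    refine ⟨fun x => if ‖f x‖ ≤ 1 then f x else 0, 1, fun x => ?_, ?_⟩
    · dsimp only
      split_ifs with h <;> simp [h]
    · rw [hπ]
      filter_upwards [h f rfl] with x hx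
      simp [hx]
  let O : ValuationSubring L :=
    { carrier := {l | ∃ (f : G → ℂ) (C : ℝ), (∀ x, ‖f x‖ ≤ C) ∧ π f = l}
      mul_mem' := by
        rintro _ _ ⟨f, C, hf, rfl⟩ ⟨f', C', hf', rfl⟩
        refine ⟨f * f', C * C', fun x => ?_, map_mul _ _ _⟩
        rw [Pi.mul_apply, norm_mul]
        exact mul_le_mul (hf x) (hf' x) (norm_nonneg _) ((norm_nonneg _).trans (hf x))
      one_mem' := ⟨1, 1, by simp, map_one _⟩
      add_mem' := by
        rintro _ _ ⟨f, C, hf, rfl⟩ ⟨f', C', hf', rfl⟩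
        exact ⟨f + f', C + C', fun x => (norm_add_le _ _).trans (add_le_add (hf x) (hf' x)), map_add _ _ _⟩
      zero_mem' := ⟨0, 0, by simp, map_zero _⟩
      neg_mem' := by
        rintro _ ⟨f, C, hf, rfl⟩
        exact ⟨-f, C, fun x => by simpa using hf x, map_neg _ _⟩
      mem_or_inv_mem' := by
        intro l
        obtain ⟨f, rfl⟩ := hπs l
        rcases (U.eventually_or (p := fun x => ‖f x‖ ≤ 1) (q := fun x => 1 < ‖f x‖)).1
          (Filter.Eventually.of_forall fun x => le_or_gt _ _) with h | h
        · left
          apply hcase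
          intro f' hf'
          filter_upwards [h, (hπ _ _).1 hf'] with x h1 h2
          rwa [h2]
        · right
          apply hcase
          intro f' hf'
          have h0 : π f * π f' = 1 := by
            rw [hf']
            apply mul_inv_cancel₀
            intro h0
            have h0' : π f = π 0 := by rw [h0, map_zero]
            obtain ⟨x, hx1, hx2⟩ := (h.and ((hπ _ _).1 h0')).exists
            rw [hx2] at hx1
            simp at hx1
            linarith
          rw [← map_mul, ← map_one π, hπ] at h0
          filter_upwards [h, h0] with x h1 h2
          have h3 : ‖f x‖ * ‖f' x‖ = 1 := by rw [← norm_mul]; simpa using congrArg norm h2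
          nlinarith [norm_nonneg (f' x)] }
  have hlim : ∀ o : O, ∃ z : ℂ, ∀ f, π f = o → Filter.Tendsto f U (𝓝 z) := by
    rintro ⟨_, f, C, hf, rfl⟩
    obtain ⟨z, hz⟩ := ultra_bdd U f C hf
    refine ⟨z, fun f' hf' => hz.congr' ?_⟩
    exact ((hπ _ _).1 hf').symm
  choose st hst using hlim
  have huniq : ∀ (o : O) f z, π f = o → Filter.Tendsto f U (𝓝 z) → st o = z := fun o f z h h2 =>
    tendsto_nhds_unique (hst o f h) h2
  refine ⟨L, inferInstance, π, O, { toFun := st, map_one' := ?_, map_mul' := ?_, map_zero' := ?_, map_add' := ?_ }, ?_, ?_, ?_⟩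
  · exact huniq 1 1 1 (map_one π) tendsto_const_nhds
  · intro a b
    obtain ⟨f, hf⟩ := hπs a
    obtain ⟨f', hf'⟩ := hπs b
    exact huniq _ (f * f') _ (by rw [map_mul, hf, hf']; rfl) ((hst a f hf).mul (hst b f' hf'))
  · exact huniq 0 0 0 (map_zero π) tendsto_const_nhds
  · intro a b
    obtain ⟨f, hf⟩ := hπs a
    obtain ⟨f', hf'⟩ := hπs b
    exact huniq _ (f + f') _ (by rw [map_add, hf, hf']; rfl) ((hst a f hf).add (hst b f' hf'))
  · intro f hf
    refine Ultrafilter.eventually_not.2 ?_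
    intro h
    apply hf
    rw [← map_zero π, hπ]
    exact h
  · intro z
    exact ⟨fun _ => z, ‖z‖, fun _ => le_rfl, rfl⟩
  · intro o f h
    exact hst o f h

theorem ultra_point {K : Type} [Field K] [Algebra K ℂ] (Y : Over (Spec (CommRingCat.of K)))
    [IsProper Y.hom] [GrpFun Y] {A : Type} [CommRing A] [Algebra K A] (j : spO K A ⟶ Y)
    [IsOpenImmersion j.left] (χ0 : A →ₐ[K] ℂ) (h0 : spM χ0 ≫ j = 0) (S : Finset A) (ε : ℝ) (hε : 0 < ε)
    (U : Ultrafilter (spO K ℂ ⟶ Y)) :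
    ∃ g : spO K ℂ ⟶ Y, ∀ᶠ x in (U : Filter _), ∃ χ : A →ₐ[K] ℂ, x - g = spM χ ≫ j ∧ ∀ a ∈ S, ‖χ a - χ0 a‖ < ε := by
  classical
  obtain ⟨L, _, π', O, st', hne, hc, hst⟩ := ultra U
  -- algebra structures
  letI : Algebra K L := (π'.comp (algebraMap K ((spO K ℂ ⟶ Y) → ℂ))).toAlgebra
  let κ' : ℂ →+* O := (π'.comp (Pi.constRingHom (spO K ℂ ⟶ Y) ℂ)).codRestrict O.toSubring (fun z => hc z)
  letI : Algebra K O := (κ'.comp (algebraMap K ℂ)).toAlgebra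
  let π : ((spO K ℂ ⟶ Y) → ℂ) →ₐ[K] L := { π' with commutes' := fun r => rfl }
  let κ : ℂ →ₐ[K] O := { κ' with commutes' := fun r => rfl }
  have hκst : ∀ z, st' (κ' z) = z := fun z =>
    tendsto_nhds_unique (hst (κ' z) (fun _ => z) rfl) tendsto_const_nhds
  let st : O →ₐ[K] ℂ := { st' with commutes' := fun r => hκst _ }
  let inc : O →ₐ[K] L := { algebraMap O L with commutes' := fun r => rfl }
  let cst : ℂ →ₐ[K] ((spO K ℂ ⟶ Y) → ℂ) := Pi.constAlgHom K (spO K ℂ ⟶ Y) ℂ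
  have e1 : inc.comp κ = π.comp cst := rfl
  have e2 : st.comp κ = AlgHom.id K ℂ := by ext z; exact hκst z
  have idY : spM (AlgHom.id K ℂ) = 𝟙 _ := by
    ext1
    exact Spec.map_id _
  have : CompactSpace Y.left := by
    have : QuasiCompact Y.hom := inferInstance
    exact QuasiCompact.compactSpace_of_compactSpace Y.hom
  -- tautological point
  obtain ⟨τ0, hτ0⟩ : ∃ τ0 : spO K ((spO K ℂ ⟶ Y) → ℂ) ⟶ Y, ∀ x : (spO K ℂ ⟶ Y), spM (Pi.evalAlgHom K (fun _ : (spO K ℂ ⟶ Y) => ℂ) x) ≫ τ0 = x := by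
    obtain ⟨τ, hτ⟩ := pointsPi_surjective (fun _ : (spO K ℂ ⟶ Y) => CommRingCat.of ℂ) Y.left (fun x : (spO K ℂ ⟶ Y) => x.left)
    refine ⟨Over.homMk τ ?_, ?_⟩
    · apply pointsPi_injective (fun _ : (spO K ℂ ⟶ Y) => CommRingCat.of ℂ) (Spec (CommRingCat.of K))
      ext x : 1
      have h1 := congrFun hτ x
      refine (Category.assoc _ _ _).symm.trans ?_
      refine (congrArg (fun w => w ≫ Y.hom) h1).trans ?_
      refine (Over.w x).trans ?_
      exact (Over.w (spM (Pi.evalAlgHom K (fun _ : (spO K ℂ ⟶ Y) => ℂ) x))).symm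
    · intro x
      ext1
      exact congrFun hτ x
  -- valuative criterion
  obtain ⟨l, hl⟩ : ∃ l : spO K O ⟶ Y, spM inc ≫ l = spM π ≫ τ0 := by
    have hsq : CommSq (spM π ≫ τ0).left (Spec.map (CommRingCat.ofHom (algebraMap O L))) Y.hom
        (spO K O).hom := ⟨(Over.w (spM π ≫ τ0)).trans (Over.w (spM inc)).symm⟩
    have hv : ValuativeCriterion.Existence Y.hom := by
      have h1 : UniversallyClosed Y.hom := inferInstance
      have h2 := h1
      rw [UniversallyClosed.eq_valuativeCriterion] at h2
      exact h2.1
    have := hv ⟨O, L, (spM π ≫ τ0).left, (spO K O).hom, hsq⟩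
    obtain ⟨⟨⟨l, hl1, hl2⟩⟩⟩ := this
    refine ⟨Over.homMk l hl2, ?_⟩
    ext1
    exact hl1
  obtain ⟨g, hg⟩ : ∃ g, g = spM st ≫ l := ⟨_, rfl⟩
  obtain ⟨y, hy⟩ : ∃ y, y = l - spM κ ≫ g := ⟨_, rfl⟩
  have hsty : spM st ≫ y = 0 := by
    rw [hy, comp_sub, ← hg, ← Category.assoc, spM_comp, e2, idY, Category.id_comp, sub_self]
  -- y factors
  have hrange : Set.range y.left ⊆ Set.range j.left := by
    have hcl : y.left (IsLocalRing.closedPoint O) ∈ Set.range j.left := by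
      have hz : (spM st).left (⊥ : PrimeSpectrum ℂ) = IsLocalRing.closedPoint O := by
        have hmax : (RingHom.ker st').IsMaximal := RingHom.ker_isMaximal_of_surjective st' (fun z => ⟨κ' z, hκst z⟩)
        apply PrimeSpectrum.ext
        have h2 := IsLocalRing.eq_maximalIdeal hmax
        refine Eq.trans ?_ h2
        rfl
      rw [← hz]
      have h3 : (spM st ≫ y).left = (spM χ0 ≫ j).left := by rw [hsty, h0]
      exact ⟨(spM χ0).left (⊥ : PrimeSpectrum ℂ), congr($(h3) (⊥ : PrimeSpectrum ℂ)).symm⟩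
    rintro _ ⟨x, rfl⟩
    exact ((IsLocalRing.specializes_closedPoint x).map y.left.continuous).mem_open
      j.left.isOpenEmbedding.isOpen_range hcl
  obtain ⟨q, hq⟩ := factor_open j y hrange
  obtain ⟨η, rfl⟩ := spM_surj q
  have hη : st.comp η = χ0 := by
    apply comp_mono_inj j
    rw [← spM_comp, Category.assoc, hq, hsty, h0]
  obtain ⟨τ, hτ⟩ : ∃ τ, τ = τ0 - spM cst ≫ g := ⟨_, rfl⟩
  have hπτ : spM π ≫ τ = spM (inc.comp η) ≫ j := by
    rw [← spM_comp, Category.assoc, hq, hτ, hy, comp_sub, comp_sub, hl, ← Category.assoc, ← Category.assoc, spM_comp, spM_comp, e1]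
  obtain ⟨h, hh, u, hu⟩ := localMap j τ (PrimeSpectrum.comap π.toRingHom ⊥) (by
    refine ⟨(spM (inc.comp η)).left (⊥ : PrimeSpectrum L), ?_⟩
    have h3 : (spM π ≫ τ).left = (spM (inc.comp η) ≫ j).left := by rw [hπτ]
    exact congr($(h3) (⊥ : PrimeSpectrum L)).symm)
  have hh' : π' h ≠ 0 := hh
  refine ⟨g, ?_⟩
  obtain ⟨χL, hL1, hL2⟩ := localMap_eval j τ h u hu π (IsUnit.mk0 _ hh')
  have hL3 : χL = inc.comp η := comp_mono_inj j (by rw [← hL1, hπτ])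
  have hbk : ∀ a : A, ∃ (b : (spO K ℂ ⟶ Y) → ℂ) (k : ℕ), u a * algebraMap ((spO K ℂ ⟶ Y) → ℂ) _ (h ^ k) = algebraMap ((spO K ℂ ⟶ Y) → ℂ) _ b :=
    fun a => away_form h (u a)
  choose b k hbk using hbk
  have hlim : ∀ a, Filter.Tendsto (fun x => b a x * ((h x)⁻¹) ^ (k a)) U (𝓝 (χ0 a)) := by
    intro a
    rw [← hη]
    refine hst (η a) _ ?_
    have h5 := hL2 a (b a) (k a) (hbk a)
    rw [hL3] at h5
    have hi : π' h * (π' h⁻¹ * π' h - 1) = 0 := by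
      have : h * (h⁻¹ * h - 1) = 0 := by
        ext x
        by_cases hx : h x = 0 <;> simp [hx]
      rw [← map_one π', ← map_mul, ← map_sub, ← map_mul, this, map_zero]
    have hi2 : π' h⁻¹ * π' h = 1 := sub_eq_zero.1 ((mul_eq_zero.1 hi).resolve_left hh')
    have : (fun x => b a x * ((h x)⁻¹) ^ (k a)) = b a * h⁻¹ ^ (k a) := rfl
    rw [this, map_mul, map_pow]
    have h6 : (η a : L) * π' h ^ (k a) = π' (b a) := h5
    rw [← h6, mul_assoc, ← mul_pow, mul_comm (π' h), hi2, one_pow, mul_one]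
  have hev : ∀ᶠ x in (U : Filter (spO K ℂ ⟶ Y)), ∀ a ∈ S, ‖b a x * ((h x)⁻¹) ^ (k a) - χ0 a‖ < ε := by
    rw [Filter.eventually_all_finset]
    intro a _
    have := (Metric.tendsto_nhds.1 (hlim a)) ε hε
    simpa [dist_eq_norm] using this
  filter_upwards [hev, hne h hh'] with x hx1 hx2
  obtain ⟨χ, hχ1, hχ2⟩ := localMap_eval j τ h u hu (Pi.evalAlgHom K (fun _ : (spO K ℂ ⟶ Y) => ℂ) x) (IsUnit.mk0 _ hx2)
  refine ⟨χ, ?_, fun a ha => ?_⟩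
  · rw [← hχ1, hτ, comp_sub, hτ0, ← Category.assoc, spM_comp]
    have : (Pi.evalAlgHom K (fun _ : (spO K ℂ ⟶ Y) => ℂ) x).comp cst = AlgHom.id K ℂ := rfl
    rw [this, idY, Category.id_comp]
  · have h7 : χ a * h x ^ (k a) = b a x := hχ2 a (b a) (k a) (hbk a)
    have h8 : χ a = b a x * ((h x)⁻¹) ^ (k a) := by
      rw [← h7, mul_assoc, ← mul_pow, mul_inv_cancel₀ hx2, one_pow, mul_one]
    rw [h8]
    exact hx1 a ha

theorem compactness {K : Type} [Field K] [Algebra K ℂ] (Y : Over (Spec (CommRingCat.of K)))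
    [IsProper Y.hom] [GrpFun Y] {A : Type} [CommRing A] [Algebra K A] (j : spO K A ⟶ Y)
    [IsOpenImmersion j.left] (χ0 : A →ₐ[K] ℂ) (h0 : spM χ0 ≫ j = 0) (S : Finset A) (ε : ℝ) (hε : 0 < ε) :
    ∃ T : Finset (spO K ℂ ⟶ Y), ∀ x, ∃ g ∈ T, ∃ χ : A →ₐ[K] ℂ, x - g = spM χ ≫ j ∧ ∀ a ∈ S, ‖χ a - χ0 a‖ < ε := by
  classical
  by_contra hcon
  push Not at hcon
  let bad : (spO K ℂ ⟶ Y) → Set (spO K ℂ ⟶ Y) := fun g =>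
    {x | ¬ ∃ χ : A →ₐ[K] ℂ, x - g = spM χ ≫ j ∧ ∀ a ∈ S, ‖χ a - χ0 a‖ < ε}
  obtain ⟨U, hU⟩ := Ultrafilter.exists_ultrafilter_of_finite_inter_nonempty (Set.range bad) (by
    intro T hT
    choose! f hf using fun t (ht : t ∈ T) => hT ht
    obtain ⟨x, hx⟩ := hcon (T.image f)
    refine ⟨x, fun t ht => ?_⟩
    rw [← hf t ht]
    rintro ⟨χ, h1, h2⟩
    obtain ⟨a, ha, h3⟩ := hx (f t) (Finset.mem_image_of_mem _ ht) χ h1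
    exact absurd (h2 a ha) (not_lt.2 h3))
  obtain ⟨g, hg⟩ := ultra_point Y j χ0 h0 S ε hε U
  have hb : bad g ∈ (U : Filter _) := hU ⟨g, rfl⟩
  obtain ⟨x, h1, h2⟩ := (hg.and hb).exists
  exact h2 h1
end AVProof

namespace AVProof
open Topology

theorem chart_map {K : Type} [Field K] [Algebra K ℂ] (Y : Over (Spec (CommRingCat.of K)))
    {A : Type} [CommRing A] [Algebra K A] (j : spO K A ⟶ Y)
    [IsOpenImmersion j.left] (χ0 : A →ₐ[K] ℂ) {n : ℕ}
    (c : (Fin n → ℂ) → (A →ₐ[K] ℂ)) (t : Fin n → A) (S : Finset A)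
    (h3 : ∀ᶠ s in 𝓝 0, ∀ i, c s (t i) = s i + χ0 (t i))
    (h4 : ∀ W ∈ 𝓝 (0 : Fin n → ℂ), ∃ ε > 0, ∀ χ : A →ₐ[K] ℂ, (∀ a ∈ S, ‖χ a - χ0 a‖ < ε) → ∃ s ∈ W, χ = c s)
    {P : Type} [NormedAddCommGroup P] [NormedSpace ℂ P] {B : Type} [CommRing B] [Algebra K B]
    (β : P → (B →ₐ[K] ℂ)) (hβ : ∀ w, ContDiffAt ℂ 2 (fun p => β p w) 0) (f : spO K B ⟶ Y)
    (hf : spM (β 0) ≫ f = spM χ0 ≫ j) :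
    ∃ m : P → (Fin n → ℂ), ContDiffAt ℂ 2 m 0 ∧ m 0 = 0 ∧ ∀ᶠ p in 𝓝 0, spM (β p) ≫ f = spM (c (m p)) ≫ j := by
  obtain ⟨h, hh, u, hu⟩ := localMap j f (PrimeSpectrum.comap (β 0).toRingHom ⊥) (by
    refine ⟨(spM χ0).left (⊥ : PrimeSpectrum ℂ), ?_⟩
    have h3 : (spM (β 0) ≫ f).left = (spM χ0 ≫ j).left := by rw [hf]
    exact congr($(h3) (⊥ : PrimeSpectrum ℂ)).symm)
  have hh' : β 0 h ≠ 0 := hh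
  have hbk : ∀ a : A, ∃ (b : B) (k : ℕ), u a * algebraMap B _ (h ^ k) = algebraMap B _ b :=
    fun a => away_form h (u a)
  choose b k hbk using hbk
  have key : ∀ p, β p h ≠ 0 → ∃ χ : A →ₐ[K] ℂ, spM (β p) ≫ f = spM χ ≫ j ∧
      ∀ a, χ a = β p (b a) * (β p h)⁻¹ ^ (k a) := by
    intro p hp
    obtain ⟨χ, hχ1, hχ2⟩ := localMap_eval j f h u hu (β p) (IsUnit.mk0 _ hp)
    refine ⟨χ, hχ1, fun a => ?_⟩
    rw [← hχ2 a (b a) (k a) (hbk a), mul_assoc, ← mul_pow, mul_inv_cancel₀ hp, one_pow, mul_one]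
  have hcd : ∀ a, ContDiffAt ℂ 2 (fun p => β p (b a) * (β p h)⁻¹ ^ (k a)) 0 := fun a =>
    (hβ _).mul (((hβ h).inv hh').pow _)
  have hχ0 : ∀ a, β 0 (b a) * (β 0 h)⁻¹ ^ (k a) = χ0 a := by
    intro a
    obtain ⟨χ, h1, h2⟩ := key 0 hh'
    rw [← h2, comp_mono_inj j (h1.symm.trans hf)]
  refine ⟨fun p i => β p (b (t i)) * (β p h)⁻¹ ^ (k (t i)) - χ0 (t i), ?_, ?_, ?_⟩
  · exact contDiffAt_pi.2 fun i => (hcd _).sub contDiffAt_const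
  · ext i
    simp only [hχ0, sub_self, Pi.zero_apply]
  · obtain ⟨ε, hε, h5⟩ := h4 _ h3
    have e1 : ∀ᶠ p in 𝓝 (0 : P), β p h ≠ 0 := (hβ h).continuousAt.eventually_ne hh'
    have e2 : ∀ᶠ p in 𝓝 (0 : P), ∀ a ∈ S, ‖β p (b a) * (β p h)⁻¹ ^ (k a) - χ0 a‖ < ε := by
      rw [Filter.eventually_all_finset]
      intro a _
      have := (Metric.tendsto_nhds.1 (hcd a).continuousAt.tendsto) ε hε
      simpa only [dist_eq_norm, hχ0] using this
    filter_upwards [e1, e2] with p hp1 hp2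
    obtain ⟨χ, h6, h7⟩ := key p hp1
    obtain ⟨s, hs, rfl⟩ := h5 χ (fun a ha => by rw [h7]; exact hp2 a ha)
    rw [h6]
    congr 3
    ext i
    rw [← h7, hs i]
    ring

theorem klevel {K : Type} [Field K] [Algebra K ℂ] (Y : Over (Spec (CommRingCat.of K)))
    [IsProper Y.hom] [GrpFun Y] {A : Type} [CommRing A] [Algebra K A] (j : spO K A ⟶ Y)
    [IsOpenImmersion j.left] (χ0 : A →ₐ[K] ℂ) (h0 : spM χ0 ≫ j = 0) (n : ℕ)
    [Algebra.IsStandardSmoothOfRelativeDimension n K A]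
    {ι : Type} [Fintype ι] (ψ : ι → (Y ⟶ Y)) (hψ : ∀ k, IsHomm (ψ k))
    (hred : ∀ δ : Y ⟶ Y, (∀ x : spO K ℂ ⟶ Y, x ≫ δ = 0) → δ = 0)
    (hind : ∀ n : ι → ℤ, ∑ k, n k • ψ k = 0 → n = 0) :
    Fintype.card ι ≤ 2 * n ^ 2 := by
  classical
  obtain ⟨c, t, S, c1, c2, c3, c4⟩ := chart n χ0
  have hfin : 2 * (Module.finrank ℂ (Fin n → ℂ)) ^ 2 = 2 * n ^ 2 := by simp
  rw [← hfin]
  let φ : ι → ((spO K ℂ ⟶ Y) →+ (spO K ℂ ⟶ Y)) := fun k => AddMonoidHom.mk' (fun x => x ≫ ψ k) (hψ k _)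
  have hcpt : ∀ W ∈ 𝓝 (0 : Fin n → ℂ), ∃ T : Finset (spO K ℂ ⟶ Y), ∀ x, ∃ g ∈ T, ∃ s ∈ W, x - g = spM (c s) ≫ j := by
    intro W hW
    obtain ⟨ε, hε, h5⟩ := c4 W hW
    obtain ⟨T, hT⟩ := compactness Y j χ0 h0 S ε hε
    refine ⟨T, fun x => ?_⟩
    obtain ⟨g, hg, χ, h6, h7⟩ := hT x
    obtain ⟨s, hs, rfl⟩ := h5 χ h7
    exact ⟨g, hg, s, hs, h6⟩
  obtain ⟨m, m1, m2, m3⟩ := chart_map Y j χ0 c t S c3 c4 (P := (Fin n → ℂ) × (Fin n → ℂ))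
    (β := fun p => Algebra.TensorProduct.productMap (c p.1) (c p.2)) (by
      intro w
      induction w using TensorProduct.induction_on with
      | zero => simpa using contDiffAt_const
      | tmul a a' =>
        simp only [Algebra.TensorProduct.productMap_apply_tmul]
        refine ContDiffAt.mul ?_ ?_
        · exact ContDiffAt.comp (g := fun s => c s a) (f := Prod.fst) 0 (c2 a) contDiffAt_fst
        · exact ContDiffAt.comp (g := fun s => c s a') (f := Prod.snd) 0 (c2 a') contDiffAt_snd
      | add x y hx hy => simpa using hx.add hy)
    (spM (Algebra.TensorProduct.includeLeft) ≫ j + spM (Algebra.TensorProduct.includeRight) ≫ j) (by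
      rw [comp_add, spM_comp_assoc, spM_comp_assoc, Algebra.TensorProduct.productMap_left,
        Algebra.TensorProduct.productMap_right]
      change spM (c 0) ≫ j + spM (c 0) ≫ j = _
      rw [c1, h0, add_zero])
  refine analytic_bound (fun s => spM (c s) ≫ j) (by rw [c1, h0]) ⟨_, c3, ?_⟩ m m1 m2 ?_ hcpt φ ?_ ?_
  · intro s hs s' hs' h
    have : c s = c s' := comp_mono_inj j h
    ext i
    have h1 := hs i
    rw [this, hs' i] at h1
    exact (add_right_cancel h1).symm
  · filter_upwards [m3] with p hp
    rw [← hp, comp_add, spM_comp_assoc, spM_comp_assoc, Algebra.TensorProduct.productMap_left,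
        Algebra.TensorProduct.productMap_right]
  · intro k
    obtain ⟨f, f1, f2, f3⟩ := chart_map Y j χ0 c t S c3 c4 c c2 (j ≫ ψ k) (by
      rw [c1, ← Category.assoc, h0]; exact map_zero (φ k))
    refine ⟨f, fderiv ℂ f 0, f2, (f1.differentiableAt (by norm_num)).hasFDerivAt, ?_⟩
    filter_upwards [f3] with s hs
    rw [← hs, ← Category.assoc]
    rfl
  · intro a ha
    obtain ⟨T, hT⟩ := hcpt _ ha
    set Φ := ∑ k, a k • φ k with hΦ
    have hfin : (Set.range Φ).Finite := by
      refine (T.image Φ).finite_toSet.subset ?_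
      rintro _ ⟨x, rfl⟩
      obtain ⟨g, hg, s, hs, h6⟩ := hT x
      have h7 : Φ (x - g) = 0 := by rw [h6]; exact hs
      rw [map_sub, sub_eq_zero] at h7
      rw [h7]
      exact Finset.mem_coe.2 (Finset.mem_image_of_mem _ hg)
    have : Finite Φ.range := hfin
    have hN : ∀ x, Nat.card Φ.range • Φ x = 0 := by
      intro x
      have := card_nsmul_eq_zero' (x := (⟨Φ x, x, rfl⟩ : Φ.range))
      exact congrArg Subtype.val this
    have hN0 : Nat.card Φ.range ≠ 0 := Nat.card_pos.ne'
    have hz := hred (∑ k, ((Nat.card Φ.range : ℤ) * a k) • ψ k) (by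
      intro x
      rw [comp_sum]
      have := hN x
      rw [hΦ] at this
      rw [← this, ← hΦ, AddMonoidHom.finset_sum_apply, Finset.smul_sum]
      refine Finset.sum_congr rfl fun k _ => ?_
      rw [comp_zsmul, mul_smul, natCast_zsmul]
      rfl)
    have h8 := hind _ hz
    ext k
    have := congrFun h8 k
    exact (mul_eq_zero.1 this).resolve_left (Nat.cast_ne_zero.2 hN0)
end AVProof

namespace AVProof

theorem exists_chart {K : Type} [Field K] (Y : Over (Spec (CommRingCat.of K))) [Smooth Y.hom]
    (y : Y.left) : ∃ (A : Type) (_ : CommRing A) (_ : Algebra K A) (j : spO K A ⟶ Y)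
      (_ : IsOpenImmersion j.left) (n : ℕ) (_ : Algebra.IsStandardSmoothOfRelativeDimension n K A),
      y ∈ Set.range j.left := by
  obtain ⟨U, hU, V, hV, hx, e, hf⟩ := Smooth.exists_isStandardSmooth Y.hom y
  have hx2 : Y.hom y ∈ U := e hx
  have hsq := IsAffineOpen.SpecMap_appLE_fromSpec Y.hom hU hV e
  have hsurj : Surjective hU.fromSpec := ⟨fun z => by
    have hz : z ∈ (U : Set _) := by
      have : Subsingleton (PrimeSpectrum K) := inferInstance
      have h3 : z = Y.hom y := this.elim _ _
      rw [h3]; exact hx2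
    rw [← hU.range_fromSpec] at hz
    exact hz⟩
  have hiso : IsIso hU.fromSpec := by
    have : Epi hU.fromSpec.base := by
      rw [TopCat.epi_iff_surjective]; exact hsurj.surj
    exact (isIso_iff_isOpenImmersion_and_epi_base _).2 ⟨inferInstance, this⟩
  obtain ⟨θ, hθ⟩ : ∃ θ, Spec.map θ = hU.fromSpec := ⟨Spec.preimage hU.fromSpec, Spec.map_preimage _⟩
  have hθi : IsIso θ := by
    have : IsIso (Scheme.Spec.map θ.op) := by
      change IsIso (Spec.map θ); rw [hθ]; exact hiso
    rw [← isIso_op_iff]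
    exact isIso_of_reflects_iso θ.op Scheme.Spec
  rw [← hθ, ← Spec.map_comp] at hsq
  have hf2 : (θ ≫ Y.hom.appLE U V e).hom.IsStandardSmooth :=
    RingHom.isStandardSmooth_respectsIso.2 _ (asIso θ).commRingCatIsoToRingEquiv hf
  algebraize [(θ ≫ Y.hom.appLE U V e).hom]
  obtain ⟨ι, σ, _, _, ⟨P⟩⟩ := (hf2 : Algebra.IsStandardSmooth K Γ(Y.left, V))
  refine ⟨Γ(Y.left, V), inferInstance, inferInstance, Over.homMk hV.fromSpec hsq.symm, ?_,
    P.dimension, ⟨ι, σ, ‹_›, ‹_›, P, rfl⟩, ?_⟩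
  · change IsOpenImmersion hV.fromSpec; infer_instance
  · change y ∈ Set.range hV.fromSpec
    rw [hV.range_fromSpec]; exact hx

theorem smooth_reduced {K A : Type} [Field K] [CommRing A] [Algebra K A] (n : ℕ)
    [Algebra.IsStandardSmoothOfRelativeDimension n K A] : _root_.IsReduced A := by
  obtain ⟨g, hg⟩ := Algebra.IsStandardSmoothOfRelativeDimension.exists_etale_mvPolynomial n K A
  letI := g.toRingHom.toAlgebra
  have hE : Algebra.Etale (MvPolynomial (Fin n) K) A := hg
  have hfl : Module.Flat (MvPolynomial (Fin n) K) A := inferInstance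
  have hinj : Function.Injective (Algebra.TensorProduct.includeRight :
      A →ₐ[MvPolynomial (Fin n) K] FractionRing (MvPolynomial (Fin n) K) ⊗[MvPolynomial (Fin n) K] A) :=
    Algebra.TensorProduct.includeRight_injective
      (IsFractionRing.injective (MvPolynomial (Fin n) K) _)
  have : _root_.IsReduced (FractionRing (MvPolynomial (Fin n) K) ⊗[MvPolynomial (Fin n) K] A) :=
    Algebra.FormallyUnramified.isReduced_of_field (FractionRing (MvPolynomial (Fin n) K)) _
  exact isReduced_of_injective _ hinj

theorem exists_cpoint {K : Type} [Field K] [Algebra K ℂ] {A : Type} [CommRing A] [Algebra K A]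
    [Algebra.FiniteType K A] (h : A) (hh : ¬ IsNilpotent h) : ∃ χ : A →ₐ[K] ℂ, χ h ≠ 0 := by
  have hne : Nontrivial (Localization.Away h) := by
    by_contra hn
    rw [not_nontrivial_iff_subsingleton] at hn
    rw [IsLocalization.subsingleton_iff (M := Submonoid.powers h) (S := Localization.Away h)] at hn
    exact hh hn
  obtain ⟨m, hm⟩ := Ideal.exists_maximal (Localization.Away h)
  have hft : Algebra.FiniteType A (Localization.Away h) :=
    inferInstance
  have hft2 : Algebra.FiniteType K (Localization.Away h) := Algebra.FiniteType.trans (S := A) inferInstance hft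
  letI := Ideal.Quotient.field m
  have hft3 : Algebra.FiniteType K (Localization.Away h ⧸ m) := inferInstance
  have hfin : Module.Finite K (Localization.Away h ⧸ m) := finite_of_finite_type_of_isJacobsonRing K _
  let l : (Localization.Away h ⧸ m) →ₐ[K] ℂ := IsAlgClosed.lift
  refine ⟨(l.comp (Ideal.Quotient.mkₐ K m)).comp (IsScalarTower.toAlgHom K A (Localization.Away h)), ?_⟩
  have hu : IsUnit (algebraMap A (Localization.Away h) h) :=
    IsLocalization.map_units _ (⟨h, Submonoid.mem_powers h⟩ : Submonoid.powers h)
  exact (hu.map (l.comp (Ideal.Quotient.mkₐ K m))).ne_zero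

theorem smooth_hred {K : Type} [Field K] [Algebra K ℂ] (Y : Over (Spec (CommRingCat.of K)))
    [IsProper Y.hom] [Smooth Y.hom] [GrpFun Y] (δ : Y ⟶ Y)
    (hδ : ∀ x : spO K ℂ ⟶ Y, x ≫ δ = 0) : δ = 0 := by
  have hsp : ∀ A : Type, ∀ [CommRing A], ∀ [Algebra K A], (spO K A).left = Spec (CommRingCat.of A) := fun _ _ _ => rfl
  have hR : IsReduced Y.left := by
    have : ∀ x : Y.left, _root_.IsReduced (Y.left.presheaf.stalk x) := by
      intro y
      obtain ⟨A, _, _, j, hj, n, hn, z, rfl⟩ := exists_chart Y y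
      have h1 := smooth_reduced (K := K) (A := A) n
      have h2 : IsReduced (spO K A).left := by
        change IsReduced (Spec (CommRingCat.of A)); infer_instance
      have h3 : IsIso (j.left.stalkMap z) := inferInstance
      exact isReduced_of_injective (j.left.stalkMap z).hom
        (ConcreteCategory.injective_of_mono_of_preservesPullback (j.left.stalkMap z))
    exact isReduced_of_isReduced_stalk _
  have hdom : IsDominant (equalizer.ι δ.left (0 : Y ⟶ Y).left) := by
    refine ⟨?_⟩
    rw [DenseRange, dense_iff_inter_open]
    rintro W hW ⟨y, hy⟩
    obtain ⟨A, _, _, j, hj, n, hn, z, rfl⟩ := exists_chart Y y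
    have hr := smooth_reduced (K := K) (A := A) n
    have hss : Algebra.IsStandardSmooth K A := Algebra.IsStandardSmoothOfRelativeDimension.isStandardSmooth n
    have hft : Algebra.FiniteType K A := inferInstance
    obtain ⟨_, ⟨h, rfl⟩, hph, hsub⟩ :=
      PrimeSpectrum.isTopologicalBasis_basic_opens.exists_subset_of_mem_open
      (show (z : PrimeSpectrum A) ∈ _ from hy) (hW.preimage j.left.continuous)
    obtain ⟨χ, hχ⟩ := exists_cpoint (K := K) h (fun hn => by
      rw [hn.eq_zero] at hph
      exact hph (Ideal.zero_mem _))
    have hx : (spM χ ≫ j) ≫ δ = (spM χ ≫ j) ≫ (0 : Y ⟶ Y) := by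
      rw [hδ, comp_zero]
    have hx2 : (spM χ ≫ j).left ≫ δ.left = (spM χ ≫ j).left ≫ (0 : Y ⟶ Y).left :=
      congr($(hx).left)
    obtain ⟨pt⟩ : Nonempty (PrimeSpectrum ℂ) := inferInstance
    refine ⟨(spM χ ≫ j).left pt, ?_, equalizer.lift _ hx2 pt, ?_⟩
    · apply hsub
      change h ∉ Ideal.comap χ.toRingHom pt.asIdeal
      intro hc
      exact pt.isPrime.ne_top (Ideal.eq_top_of_isUnit_mem _ hc (IsUnit.mk0 _ hχ))
    · exact congrArg (fun w : (spO K ℂ).left ⟶ Y.left => w pt) (equalizer.lift_ι _ hx2)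
  ext1
  exact ext_of_isDominant_of_isSeparated Y.hom ((Over.w δ).trans (Over.w (0 : Y ⟶ Y)).symm) _
    (equalizer.condition δ.left (0 : Y ⟶ Y).left)
end AVProof

namespace AVProof

/-- substitute constants for the first `i` variables -/
noncomputable def subst {F : Type} [Field F] {n : ℕ} (a : Fin n → F) (i : ℕ) :
    MvPolynomial (Fin n) F →ₐ[F] MvPolynomial (Fin n) F :=
  MvPolynomial.aeval (fun k => if k.val < i then MvPolynomial.C (a k) else MvPolynomial.X k)

lemma subst_comp {F : Type} [Field F] {n : ℕ} (a : Fin n → F) {i j : ℕ} (h : i ≤ j) :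
    (subst a j).comp (subst a i) = subst a j := by
  ext k : 1
  simp only [subst, AlgHom.comp_apply, MvPolynomial.aeval_X]
  split_ifs with h1 h2 h3
  · rw [← MvPolynomial.algebraMap_eq, AlgHom.commutes]
  · omega
  · rw [MvPolynomial.aeval_X, if_pos h3]
  · rw [MvPolynomial.aeval_X, if_neg h3]

lemma chain_point {F : Type} [Field F] {n : ℕ} (a : Fin n → F) :
    ∃ l : LTSeries (PrimeSpectrum (MvPolynomial (Fin n) F)), l.length = n ∧
      l.last.asIdeal = RingHom.ker (MvPolynomial.aeval a : MvPolynomial (Fin n) F →ₐ[F] F).toRingHom := by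
  refine ⟨LTSeries.mk n (fun i => ⟨RingHom.ker (subst a i.val).toRingHom, RingHom.ker_isPrime _⟩) ?_, rfl, ?_⟩
  · rw [Fin.strictMono_iff_lt_succ]
    intro i
    rw [← PrimeSpectrum.asIdeal_lt_asIdeal, SetLike.lt_iff_le_and_exists]
    refine ⟨fun x hx => ?_, MvPolynomial.X i - MvPolynomial.C (a i), ?_, ?_⟩
    · have hx2 : subst a i.castSucc.val x = 0 := hx
      change subst a i.succ.val x = 0
      rw [← subst_comp a (show i.castSucc.val ≤ i.succ.val by simp), AlgHom.comp_apply, hx2, map_zero]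
    · change subst a i.succ.val _ = 0
      rw [map_sub, ← MvPolynomial.algebraMap_eq, AlgHom.commutes, subst, MvPolynomial.aeval_X, if_pos (by simp)]
      exact sub_self _
    · intro hx
      have hx2 : subst a i.castSucc.val (MvPolynomial.X i - MvPolynomial.C (a i)) = 0 := hx
      rw [map_sub, ← MvPolynomial.algebraMap_eq, AlgHom.commutes, subst, MvPolynomial.aeval_X, if_neg (by simp)] at hx2
      have := congrArg (MvPolynomial.aeval (fun _ => a i + 1) : MvPolynomial (Fin n) F →ₐ[F] F) hx2
      simp at this
  · change RingHom.ker (subst a n).toRingHom = _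
    have h : subst a n = (Algebra.ofId F (MvPolynomial (Fin n) F)).comp (MvPolynomial.aeval a) := by
      ext k : 1
      simp [subst, Algebra.ofId_apply]
    ext x
    change subst a n x = 0 ↔ MvPolynomial.aeval a x = 0
    rw [h, AlgHom.comp_apply]
    exact map_eq_zero_iff _ (MvPolynomial.C_injective _ _)

theorem smooth_dim {F B : Type} [Field F] [IsAlgClosed F] [CommRing B] [Algebra F B] [Nontrivial B] (n : ℕ)
    [Algebra.IsStandardSmoothOfRelativeDimension n F B] : (n : WithBot ℕ∞) ≤ ringKrullDim B := by
  obtain ⟨g, hg⟩ := Algebra.IsStandardSmoothOfRelativeDimension.exists_etale_mvPolynomial n F B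
  have hss : Algebra.IsStandardSmooth F B := Algebra.IsStandardSmoothOfRelativeDimension.isStandardSmooth n
  have hft : Algebra.FiniteType F B := inferInstance
  letI := g.toRingHom.toAlgebra
  have hE : Algebra.Etale (MvPolynomial (Fin n) F) B := hg
  have hfl : Module.Flat (MvPolynomial (Fin n) F) B := inferInstance
  obtain ⟨m, hm⟩ := Ideal.exists_maximal B
  letI := Ideal.Quotient.field m
  have hfin : Module.Finite F (B ⧸ m) := finite_of_finite_type_of_isJacobsonRing F _
  let l : (B ⧸ m) →ₐ[F] F := IsAlgClosed.lift
  let a : Fin n → F := fun k => l (Ideal.Quotient.mkₐ F m (g (MvPolynomial.X k)))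
  have ha : (l.comp (Ideal.Quotient.mkₐ F m)).comp g = MvPolynomial.aeval a := by
    ext k : 1
    simp [a]
  obtain ⟨s, hs, hs2⟩ := chain_point a
  have hlo : m.LiesOver s.last.asIdeal := by
    refine ⟨?_⟩
    rw [hs2, ← ha]
    ext x
    change l (Ideal.Quotient.mk m (g x)) = 0 ↔ g x ∈ m
    rw [map_eq_zero_iff l l.toRingHom.injective, Ideal.Quotient.eq_zero_iff_mem]
  obtain ⟨L, hL, -⟩ := Ideal.exists_ltSeries_of_hasGoingDown s m
  have := Order.LTSeries.length_le_krullDim L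
  rw [hL, hs] at this
  exact this

end AVProof

namespace AVProof

lemma pullback_open {K F : Type} [Field K] [Field F] [Algebra K F]
    {Y T : Over (Spec (CommRingCat.of K))} (j : T ⟶ Y) [IsOpenImmersion j.left] :
    IsOpenImmersion ((Over.pullback (sig K F)).map j).left := by
  have h1 : IsPullback (pullback.snd Y.hom (sig K F)) (pullback.fst Y.hom (sig K F)) (sig K F) Y.hom :=
    (IsPullback.of_hasPullback _ _).flip
  have h2 : IsPullback (pullback.snd T.hom (sig K F)) (pullback.fst T.hom (sig K F)) (sig K F) T.hom :=
    (IsPullback.of_hasPullback _ _).flip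
  have h3 : IsPullback (pbm (sig K F) j.left (Over.w j)) (pullback.fst T.hom (sig K F))
      (pullback.fst Y.hom (sig K F)) j.left := by
    refine IsPullback.of_right ?_ (pbm_fst _ _ _) h1
    rw [pbm_snd, Over.w j]
    exact h2
  rw [pbm_left]
  exact MorphismProperty.of_isPullback (P := @IsOpenImmersion) h3.flip inferInstance

theorem dim_bound {K F : Type} [Field K] [Field F] [IsAlgClosed F] [Algebra K F]
    {X : Over (Spec (CommRingCat.of F))} (Y : Over (Spec (CommRingCat.of K)))
    (e : (Over.pullback (sig K F)).obj Y ≅ X) (g : ℕ) (hg : topologicalKrullDim X.left = (g : ℕ∞))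
    {A : Type} [CommRing A] [Algebra K A] [Nontrivial A] (j : spO K A ⟶ Y) [IsOpenImmersion j.left]
    (n : ℕ) [Algebra.IsStandardSmoothOfRelativeDimension n K A] : n ≤ g := by
  have ho : IsOpenImmersion ((Over.pullback (sig K F)).map j).left := pullback_open j
  have h1 : Topology.IsInducing ((Over.pullback (sig K F)).map j ≫ e.hom).left := by
    have : IsIso e.hom.left := ((Over.forget _).mapIso e).isIso_hom
    have : IsOpenImmersion ((Over.pullback (sig K F)).map j ≫ e.hom).left := by
      rw [Over.comp_left]; infer_instance
    exact (Scheme.Hom.isOpenEmbedding _).isInducing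
  have h2 := h1.topologicalKrullDim_le
  rw [hg] at h2
  let f2 : Spec (CommRingCat.of (A ⊗[K] F)) ⟶ ((Over.pullback (sig K F)).obj (spO K A)).left :=
    (pullbackSpecIso K A F).inv
  have hf2 : IsOpenImmersion f2 := by
    change IsOpenImmersion (pullbackSpecIso K A F).inv; infer_instance
  have h3 := (Scheme.Hom.isOpenEmbedding f2).isInducing.topologicalKrullDim_le
  have h4 : topologicalKrullDim (Spec (CommRingCat.of (A ⊗[K] F))) = ringKrullDim (A ⊗[K] F) :=
    PrimeSpectrum.topologicalKrullDim_eq_ringKrullDim _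
  rw [h4, ringKrullDim_eq_of_ringEquiv (Algebra.TensorProduct.comm K A F).toRingEquiv] at h3
  have h5 := smooth_dim (F := F) (B := F ⊗[K] A) n
  have := (h5.trans h3).trans h2
  exact_mod_cast this
end AVProof

namespace AVProof

theorem core {F : Type} [Field F] [IsAlgClosed F] [CharZero F] (X : Over (Spec (CommRingCat.of F)))
    [IsProper X.hom] [Smooth X.hom] [GrpFun X] (g : ℕ)
    (hg : topologicalKrullDim X.left = (g : ℕ∞)) {ι : Type} [Fintype ι] (φ : ι → (X ⟶ X))
    (hφ : ∀ k, IsHomm (φ k)) (hind : ∀ n : ι → ℤ, ∑ k, n k • φ k = 0 → n = 0) :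
    Fintype.card ι ≤ 2 * g ^ 2 := by
  obtain ⟨K, _, _, _, Y, e, _, ψ, hadd, hψ⟩ := descent X φ
  have hfaith := faithful_sig K F
  have hchar : CharZero K := (algebraMap K F).charZero
  obtain ⟨em⟩ := embed_complex K
  letI := em.toAlgebra
  have hsq : IsPullback (pullback.fst Y.hom (sig K F)) (pullback.snd Y.hom (sig K F)) Y.hom (sig K F) :=
    IsPullback.of_hasPullback _ _
  have hsnd : pullback.snd Y.hom (sig K F) = e.hom.left ≫ X.hom := (Over.w e.hom).symm
  have hiso : IsIso e.hom.left := ((Over.forget _).mapIso e).isIso_hom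
  have hp1 : IsProper (pullback.snd Y.hom (sig K F)) := by
    rw [hsnd]; exact MorphismProperty.comp_mem @IsProper _ _ inferInstance inferInstance
  have hs1 : Smooth (pullback.snd Y.hom (sig K F)) := by
    rw [hsnd]; exact MorphismProperty.comp_mem @Smooth _ _ inferInstance inferInstance
  have hpY : IsProper Y.hom := isProper_descend hsq (ffq_sig K F)
  have hsY : Smooth Y.hom :=
    MorphismProperty.of_isPullback_of_descendsAlong (P := @Smooth) (Q := FFQ) hsq.flip (ffq_sig K F) hs1
  -- the comparison homomorphism
  let bc : ∀ T : Over (Spec (CommRingCat.of K)), (T ⟶ Y) →+ ((Over.pullback (sig K F)).obj T ⟶ X) :=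
    fun T => AddMonoidHom.mk' (fun a => (Over.pullback (sig K F)).map a ≫ e.hom) (hadd T)
  have bc_inj : ∀ T, Function.Injective (bc T) := by
    intro T a b hab
    have h1 : (Over.pullback (sig K F)).map a ≫ e.hom = (Over.pullback (sig K F)).map b ≫ e.hom := hab
    exact hfaith.map_injective ((cancel_mono e.hom).1 h1)
  have bc_comp : ∀ T (a : T ⟶ Y) k, bc T (a ≫ ψ k) = bc T a ≫ φ k := by
    intro T a k
    change (Over.pullback (sig K F)).map (a ≫ ψ k) ≫ e.hom = ((Over.pullback (sig K F)).map a ≫ e.hom) ≫ φ k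
    rw [Functor.map_comp, Category.assoc, hψ, Category.assoc]
  have hψh : ∀ k, IsHomm (ψ k) := by
    intro k T a b
    apply bc_inj
    rw [map_add, bc_comp, bc_comp, bc_comp, map_add]
    exact hφ k _ _ _
  have hindψ : ∀ n : ι → ℤ, ∑ k, n k • ψ k = 0 → n = 0 := by
    intro n hn
    apply hind
    have h1 := congrArg (bc Y) hn
    rw [map_sum, map_zero] at h1
    have h2 : ∀ k, bc Y (n k • ψ k) = e.hom ≫ (n k • φ k) := by
      intro k
      rw [map_zsmul, comp_zsmul]
      congr 1
      exact hψ k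
    simp only [h2] at h1
    rw [← comp_sum] at h1
    rw [← cancel_epi e.hom, comp_zero]
    exact h1
  obtain ⟨pt⟩ : Nonempty (PrimeSpectrum ℂ) := inferInstance
  obtain ⟨A, _, _, j, hj, n, hn, hy⟩ := exists_chart Y ((0 : spO K ℂ ⟶ Y).left pt)
  obtain ⟨q, hq⟩ := factor_open j (0 : spO K ℂ ⟶ Y) (by
    rintro _ ⟨z, rfl⟩
    have : Subsingleton (PrimeSpectrum ℂ) := inferInstance
    have h3 : z = pt := this.elim _ _
    rw [h3]; exact hy)
  obtain ⟨χ0, rfl⟩ := spM_surj q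
  have hnt : Nontrivial A := χ0.toRingHom.domain_nontrivial
  have h1 := klevel Y j χ0 hq n ψ hψh (smooth_hred Y) hindψ
  have h2 := dim_bound Y e g hg j n
  calc _ ≤ 2 * n ^ 2 := h1
    _ ≤ 2 * g ^ 2 := by gcongr

theorem rank_le_of {E : Type} [Ring E] (N : ℕ)
    (H : ∀ s : Finset E, (LinearIndependent ℤ fun i : s => (i : E)) → s.card ≤ N) :
    Module.rank ℚ (ℚ ⊗[ℤ] E) ≤ N := by
  have hl : IsLocalizedModule (nonZeroDivisors ℤ) (TensorProduct.mk ℤ ℚ E 1) :=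
    (isLocalizedModule_iff_isBaseChange (nonZeroDivisors ℤ) ℚ _).2 (TensorProduct.isBaseChange ℤ E ℚ)
  have h1 := IsLocalizedModule.rank_eq (nonZeroDivisors ℤ) le_rfl (TensorProduct.mk ℤ ℚ E 1)
  refine (Eq.trans ?_ h1).trans_le (rank_le H)
  exact IsLocalization.rank_eq ℚ (nonZeroDivisors ℤ) le_rfl
end AVProof

theorem av_end_dim_lt_char_zero (F : Type) [Field F] [IsAlgClosed F] [CharZero F]
    (A : AbelianVariety F) (g : ℕ) (hg : 1 ≤ g)
    (hdim : topologicalKrullDim A.X.left = (g : ℕ∞))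
    -- `E`, via `ε`, is the endomorphism ring of `A`: the ring of group-scheme
    -- endomorphisms of `A`, with composition as multiplication and pointwise
    -- addition given by the group law of `A`.
    (E : Type) [Ring E] (ε : E → (A.X ⟶ A.X))
    (hinj : Function.Injective ε)
    (hone : ε 1 = 𝟙 A.X)
    (hmul : ∀ a b : E, ε (a * b) = ε b ≫ ε a)
    (hadd : ∀ a b : E, ε (a + b) = prod.lift (ε a) (ε b) ≫ A.mul)
    (hhom : ∀ a : E, A.mul ≫ ε a = prod.map (ε a) (ε a) ≫ A.mul)
    (hsurj : ∀ φ : A.X ⟶ A.X,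
      A.mul ≫ φ = prod.map φ φ ≫ A.mul → ∃ a : E, ε a = φ) :
    Module.rank ℚ (ℚ ⊗[ℤ] E) < ((2 * g) ^ 2 : ℕ) := by
  obtain ⟨_, hG⟩ := AVProof.avGrp A
  have := A.proper
  have hsm : Smooth A.X.hom := A.smooth
  let εh : E →+ (A.X ⟶ A.X) := AddMonoidHom.mk' ε (fun a b => by rw [hadd, hG])
  have hle : Module.rank ℚ (ℚ ⊗[ℤ] E) ≤ ((2 * g ^ 2 : ℕ) : Cardinal) := by
    apply AVProof.rank_le_of
    intro s hs
    have h := AVProof.core A.X g hdim (fun i : s => ε i)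
      (fun k => AVProof.isHomm_of A.mul hG _ (hhom _)) (by
      intro n hn
      have h1 : εh (∑ k : s, n k • (k : E)) = 0 := by
        rw [map_sum, ← hn]
        exact Finset.sum_congr rfl fun k _ => map_zsmul εh _ _
      have h2 : ∑ k : s, n k • (k : E) = 0 := by
        apply hinj
        exact h1.trans (map_zero εh).symm
      funext k
      exact Fintype.linearIndependent_iff.1 hs n h2 k)
    simpa using h
  refine hle.trans_lt ?_
  rw [Nat.cast_lt]
  nlinarith
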